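/- arXiv:1007.0257 — 2 statements merged into one kernel-verified Lean document; each statement's English description precedes it below -/
import Mathlib

section
/- Let m, n be positive integers with m ≥ 2, suppose m is not divisible by any prime strictly greater than 7, let G = C_m ⊕ C_{mn}, and let S be a sequence over G. Then S has length 2m + 2mn − 4 (which equals s(G) − 1) and no zero-sum subsequence of length mn = exp(G) if and only if either (a) there exist a basis {e_1, e_2} of G with ord(e_2) = mn, an integer x with gcd(x, m) = 1, s, t ∈ [1, n], and g ∈ G such that S = g^{tm−1} · (e_1 + g)^{(n+1−t)m−1} · (e_2 + g)^{sm−1} · (−x·e_1 + e_2 + g)^{(n+1−s)m−1}, or (b) there exist a generating set {g_1, g_2} of G with ord(g_2) = mn and g ∈ G such that S = g^{mn−1} · (g_1 + g)^{m−1} · (g_2 + g)^{mn−1} · (−g_1 + g_2 + g)^{m−1}. -/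
namespace ZeroSum

/-! ### A kernel-friendly exhaustive search over multisets of grid points -/

/-- Candidate points, each with its shift, its mask of forbidding bits and its multiplicity cap. -/
inductive Cands
  | nil
  | cons (s f c : ℕ) (t : Cands)

namespace Cands

noncomputable def filt (σ : ℕ) (l : Cands) : Cands :=
  Cands.rec (motive := fun _ => Cands) nil (fun s f c _ ih =>
    Bool.rec (motive := fun _ => Cands) ih (cons s f c ih) (Nat.beq (Nat.land σ f) 0)) l

noncomputable def total (l : Cands) : ℕ :=
  Cands.rec (motive := fun _ => ℕ) 0 (fun _ _ c _ ih => Nat.add c ih) l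

noncomputable def decr (s f c : ℕ) (t : Cands) : Cands :=
  Bool.rec (motive := fun _ => Cands) (cons s f (Nat.sub c 1) t) t (Nat.ble c 1)

end Cands

open Cands

/-- Add the element with shift `s` to the set `σ` of coded subsums. -/
noncomputable def addShift (W M s σ : ℕ) : ℕ :=
  Nat.land M (Nat.lor σ (Nat.lor (Nat.shiftLeft σ s) (Nat.shiftRight (Nat.shiftLeft σ s) W)))

noncomputable def searchLoop (W M σ need : ℕ) (rec : ℕ → Cands → Bool) (a : Cands) : ℕ → Bool :=
  Cands.rec (motive := fun _ => ℕ → Bool)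
    (fun tot => Bool.rec (motive := fun _ => Bool) true false (Nat.ble need tot))
    (fun s f c t ih tot => Bool.rec (motive := fun _ => Bool) true
      (Bool.rec (motive := fun _ => Bool) false (ih (Nat.sub tot c))
        (rec (addShift W M s σ) (decr s f c t)))
      (Nat.ble need tot)) a

/-- `search W M need σ l = true` certifies that the current sequence cannot be prolonged by `need`
elements of `l`. -/
noncomputable def search (W M : ℕ) (need : ℕ) : ℕ → Cands → Bool :=
  Nat.rec (motive := fun _ => ℕ → Cands → Bool) (fun _ _ => false)
    (fun n ih σ l => searchLoop W M σ (Nat.succ n) ih (filt σ l) (total (filt σ l))) need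

/-- Number of bits of a coded first coordinate sum. -/
def colBits (p : ℕ) : ℕ := p * (p - 1) + 1

/-- Number of bits of a row. -/
def rowBits (p : ℕ) : ℕ := (p + 1) * colBits p

def code (p : ℕ) (x : ℕ × ℕ) : ℕ := x.2 * rowBits p + colBits p + x.1

noncomputable def lorPow (e d k : ℕ) : ℕ :=
  Nat.rec (motive := fun _ => ℕ) 0 (fun j ih => Nat.lor (2 ^ (e + d * j)) ih) k

noncomputable def forbid (p : ℕ) (x : ℕ × ℕ) : ℕ :=
  lorPow (((p - x.2) % p) * rowBits p + (p - 1) * colBits p + ((p - x.1) % p)) p (p - 1)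

noncomputable def levelMask (p : ℕ) (k : ℕ) : ℕ :=
  Nat.rec (motive := fun _ => ℕ) 0
    (fun j ih => Nat.lor (Nat.shiftLeft (2 ^ (p * colBits p) - 1) (rowBits p * j)) ih) k

/-- `T` has `p` elements and both coordinate sums are divisible by `p`. -/
def IsBad (p : ℕ) (T : Multiset (ℕ × ℕ)) : Prop :=
  T.card = p ∧ p ∣ (T.map Prod.fst).sum ∧ p ∣ (T.map Prod.snd).sum

/-- Every bit of `σ` codes a subsum of `cur` with fewer than `p` terms. -/
def Sound (p σ : ℕ) (cur : Multiset (ℕ × ℕ)) : Prop :=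
  ∀ i, σ.testBit i = true → ∃ T ≤ cur, T.card ≤ p - 1 ∧
    ∃ k, (T.map (code p)).sum = i + p * rowBits p * k

def InGrid (p : ℕ) (x : ℕ × ℕ) : Prop := x.1 < p ∧ x.2 < p

/-- `X` can be chosen among the candidates of `l`. -/
def Fit (p : ℕ) : Cands → Multiset (ℕ × ℕ) → Prop
  | .nil, X => X = 0
  | .cons s f c t, X => ∃ x, InGrid p x ∧ s = code p x ∧ f = forbid p x ∧
      ∃ i ≤ c, ∃ Y, Fit p t Y ∧ X = Multiset.replicate i x + Y

lemma testBit_lorPow (e d k i : ℕ) (h : (lorPow e d k).testBit i = true) :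
    ∃ j < k, i = e + d * j := by
  induction k with
  | zero => simp [lorPow] at h
  | succ k ih =>
    have h2 : (2 ^ (e + d * k) ||| lorPow e d k).testBit i = true := h
    rw [Nat.testBit_or, Bool.or_eq_true] at h2
    rcases h2 with h2 | h2
    · rw [Nat.testBit_two_pow] at h2
      exact ⟨k, by omega, by simpa using (of_decide_eq_true h2).symm⟩
    · obtain ⟨j, hj, e⟩ := ih h2
      exact ⟨j, by omega, e⟩

lemma testBit_levelMask (p k i : ℕ) (h : (levelMask p k).testBit i = true) :
    i % rowBits p < p * colBits p := by
  induction k with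
  | zero => simp [levelMask] at h
  | succ k ih =>
    have h2 : (((2 ^ (p * colBits p) - 1) <<< (rowBits p * k)) ||| levelMask p k).testBit i
      = true := h
    rw [Nat.testBit_or, Bool.or_eq_true] at h2
    rcases h2 with h2 | h2
    · rw [Nat.testBit_shiftLeft, Nat.testBit_two_pow_sub_one] at h2
      simp only [Bool.and_eq_true, decide_eq_true_eq] at h2
      obtain ⟨h3, h4⟩ := h2
      obtain ⟨j, rfl⟩ := Nat.exists_eq_add_of_le h3
      rw [Nat.mul_add_mod]
      refine lt_of_le_of_lt (Nat.mod_le _ _) ?_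
      simpa using h4
    · exact ih h2

lemma sum_code (p : ℕ) (T : Multiset (ℕ × ℕ)) :
    (T.map (code p)).sum =
      rowBits p * (T.map Prod.snd).sum + colBits p * T.card + (T.map Prod.fst).sum := by
  induction T using Multiset.induction with
  | empty => simp
  | cons x T ih => simp [ih, code]; ring

lemma sum_fst_le (p : ℕ) (T : Multiset (ℕ × ℕ)) (h : ∀ x ∈ T, InGrid p x) :
    (T.map Prod.fst).sum ≤ (p - 1) * T.card := by
  induction T using Multiset.induction with
  | empty => simp
  | cons x T ih =>
    have h1 := ih fun y hy => h y (Multiset.mem_cons_of_mem hy)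
    have h2 := (h x (Multiset.mem_cons_self x T)).1
    simp only [Multiset.map_cons, Multiset.sum_cons, Multiset.card_cons, mul_add, mul_one]
    omega

lemma level_lt (p : ℕ) (T : Multiset (ℕ × ℕ)) (h : ∀ x ∈ T, InGrid p x)
    (hT : T.card ≤ p) : colBits p * T.card + (T.map Prod.fst).sum < rowBits p := by
  have h1 := sum_fst_le p T h
  have h2 : (p - 1) * T.card ≤ p * (p - 1) := by rw [mul_comm p]; gcongr
  have h3 : colBits p * T.card ≤ colBits p * p := by gcongr
  simp only [rowBits, add_mul, one_mul]
  rw [mul_comm p (colBits p)]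
  have : colBits p = p * (p - 1) + 1 := rfl
  omega

lemma Sound.addShift {p σ : ℕ} (hp : 0 < p) {cur : Multiset (ℕ × ℕ)} (hσ : Sound p σ cur)
    (hcur : ∀ x ∈ cur, InGrid p x) {x : ℕ × ℕ} (hx : InGrid p x) :
    Sound p (addShift (p * rowBits p) (levelMask p p) (code p x) σ) (x ::ₘ cur) := by
  intro i hi
  have hi2 : (levelMask p p &&& (σ ||| ((σ <<< code p x) |||
    ((σ <<< code p x) >>> (p * rowBits p))))).testBit i = true := hi
  simp only [Nat.testBit_and, Nat.testBit_or, Bool.and_eq_true, Bool.or_eq_true,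
    Nat.testBit_shiftRight, Nat.testBit_shiftLeft, decide_eq_true_eq] at hi2
  obtain ⟨hm, hi3⟩ := hi2
  have key : ∀ T ≤ cur, T.card ≤ p - 1 → ∀ k, ((x ::ₘ T).map (code p)).sum =
      i + p * rowBits p * k → ∃ T ≤ x ::ₘ cur, T.card ≤ p - 1 ∧
    ∃ k, (T.map (code p)).sum = i + p * rowBits p * k := by
    intro T hT hc k hk
    refine ⟨x ::ₘ T, Multiset.cons_le_cons x hT, ?_, k, hk⟩
    have hg : ∀ y ∈ x ::ₘ T, InGrid p y := by
      intro y hy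
      rcases Multiset.mem_cons.1 hy with rfl | hy
      · exact hx
      · exact hcur y (Multiset.mem_of_le hT hy)
    have hl := level_lt p _ hg (by rw [Multiset.card_cons]; omega)
    have h5 := testBit_levelMask p p i hm
    rw [sum_code] at hk
    have h6 : i % rowBits p =
        colBits p * (x ::ₘ T).card + ((x ::ₘ T).map Prod.fst).sum := by
      have := congrArg (· % rowBits p) hk
      simp only [add_assoc, Nat.mul_add_mod] at this
      rw [Nat.mod_eq_of_lt hl] at this
      rw [this, mul_comm p, mul_assoc, Nat.add_mul_mod_self_left]
    rw [h6] at h5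
    have : colBits p * (x ::ₘ T).card < colBits p * p := by rw [mul_comm _ p]; omega
    have := Nat.lt_of_mul_lt_mul_left this
    omega
  rcases hi3 with h | ⟨h1, h⟩ | ⟨h1, h⟩
  · obtain ⟨T, hT, hc, k, hk⟩ := hσ i h
    exact ⟨T, hT.trans (Multiset.le_cons_self _ _), hc, k, hk⟩
  · obtain ⟨T, hT, hc, k, hk⟩ := hσ _ h
    refine key T hT hc k ?_
    simp only [Multiset.map_cons, Multiset.sum_cons, hk]; omega
  · obtain ⟨T, hT, hc, k, hk⟩ := hσ _ h
    refine key T hT hc (k + 1) ?_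
    simp only [Multiset.map_cons, Multiset.sum_cons, hk, mul_add, mul_one]; omega

lemma sub_mod_add (p c : ℕ) (hc : c < p) : ∃ κ ≤ 1, (p - c) % p + c = p * κ := by
  rcases Nat.eq_zero_or_pos c with rfl | h
  · exact ⟨0, by omega, by simp⟩
  · exact ⟨1, le_rfl, by rw [Nat.mod_eq_of_lt (by omega)]; omega⟩

lemma Sound.forbid {p σ : ℕ} (hp : 0 < p) {cur : Multiset (ℕ × ℕ)} (hσ : Sound p σ cur)
    (hcur : ∀ x ∈ cur, InGrid p x) {x : ℕ × ℕ} (hx : InGrid p x)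
    (h : σ &&& forbid p x ≠ 0) : ∃ T ≤ x ::ₘ cur, IsBad p T := by
  obtain ⟨i, hi⟩ := Nat.exists_testBit_of_ne_zero h
  rw [Nat.testBit_and, Bool.and_eq_true] at hi
  obtain ⟨T, hT, hc, k, hk⟩ := hσ i hi.1
  obtain ⟨j, hj, rfl⟩ := testBit_lorPow _ _ _ _ hi.2
  refine ⟨x ::ₘ T, Multiset.cons_le_cons x hT, ?_⟩
  have hg : ∀ y ∈ x ::ₘ T, InGrid p y := by
    intro y hy
    rcases Multiset.mem_cons.1 hy with rfl | hy
    · exact hx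
    · exact hcur y (Multiset.mem_of_le hT hy)
  have hcard : (x ::ₘ T).card ≤ p := by rw [Multiset.card_cons]; omega
  have hl := level_lt p _ hg hcard
  have hf := sum_fst_le p _ hg
  obtain ⟨κ, hκ, e1⟩ := sub_mod_add p x.1 hx.1
  obtain ⟨μ, hμ, e2⟩ := sub_mod_add p x.2 hx.2
  have hsum : ((x ::ₘ T).map (code p)).sum =
      rowBits p * (p * (μ + k)) + (colBits p * p + p * (κ + j)) := by
    rw [Multiset.map_cons, Multiset.sum_cons, hk]
    have e3 : (p - 1) * colBits p + colBits p = colBits p * p := by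
      obtain ⟨q, rfl⟩ : ∃ q, p = q + 1 := ⟨p - 1, by omega⟩
      simp only [Nat.add_sub_cancel]; ring
    have e4 : rowBits p * (p * (μ + k)) = ((p - x.2) % p) * rowBits p + x.2 * rowBits p
        + p * rowBits p * k := by
      rw [← add_mul, e2]; ring
    rw [e4, ← e3, mul_add, ← e1, code]
    ring
  rw [sum_code, add_assoc] at hsum
  have hs : p * (κ + j) ≤ p * (p - 1) := Nat.mul_le_mul_left _ (by omega)
  have hcb : colBits p = p * (p - 1) + 1 := rfl
  have hl2 : colBits p * p + p * (κ + j) < rowBits p := by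
    simp only [rowBits, add_mul, one_mul]
    rw [mul_comm p (colBits p)]; omega
  have hR : 0 < rowBits p := by omega
  have hmod : colBits p * (x ::ₘ T).card + ((x ::ₘ T).map Prod.fst).sum =
      colBits p * p + p * (κ + j) := by
    have := congrArg (· % rowBits p) hsum
    simpa only [Nat.mul_add_mod, Nat.mod_eq_of_lt hl, Nat.mod_eq_of_lt hl2] using this
  have hrow : ((x ::ₘ T).map Prod.snd).sum = p * (μ + k) := by
    have : rowBits p * ((x ::ₘ T).map Prod.snd).sum = rowBits p * (p * (μ + k)) := by omega
    exact Nat.eq_of_mul_eq_mul_left hR this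
  have hcard2 : (x ::ₘ T).card = p := by
    refine le_antisymm hcard ?_
    by_contra hlt
    have h1 : colBits p * ((x ::ₘ T).card + 1) ≤ colBits p * p :=
      Nat.mul_le_mul_left _ (by omega)
    have h2 : (p - 1) * (x ::ₘ T).card ≤ p * (p - 1) := by
      rw [mul_comm p]; exact Nat.mul_le_mul_left _ hcard
    rw [mul_add, mul_one] at h1
    omega
  rw [hcard2] at hmod
  exact ⟨hcard2, ⟨κ + j, by omega⟩, ⟨μ + k, hrow⟩⟩

lemma Fit.card_le {p : ℕ} : ∀ {l : Cands} {X : Multiset (ℕ × ℕ)}, Fit p l X → X.card ≤ total l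
  | .nil, X, h => by simp [show X = 0 from h]
  | .cons s f c t, X, ⟨y, hy, _, _, i, hi, Y, hY, e⟩ => by
    have h1 := hY.card_le
    rw [e, Multiset.card_add, Multiset.card_replicate]
    have h2 : total (.cons s f c t) = c + total t := rfl
    omega

lemma Fit.filt {p σ : ℕ} (hp : 0 < p) {cur : Multiset (ℕ × ℕ)} (hσ : Sound p σ cur)
    (hcur : ∀ x ∈ cur, InGrid p x) : ∀ {l : Cands} {X : Multiset (ℕ × ℕ)}, Fit p l X →
    (∀ T ≤ cur + X, ¬ IsBad p T) → Fit p (filt σ l) X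
  | .nil, X, h, _ => h
  | .cons s f c t, X, ⟨y, hy, hs, hf, i, hi, Y, hY, e⟩, hX => by
    have hYt : Fit p (Cands.filt σ t) Y := hY.filt hp hσ hcur fun T hT =>
      hX T (hT.trans (by rw [e]; exact add_le_add_right (Multiset.le_add_left _ _) _))
    have hd : Cands.filt σ (.cons s f c t) =
      Bool.rec (motive := fun _ => Cands) (Cands.filt σ t) (.cons s f c (Cands.filt σ t))
        (Nat.beq (Nat.land σ f) 0) := rfl
    rw [hd]
    cases hb : Nat.beq (Nat.land σ f) 0 with
    | true => exact ⟨y, hy, hs, hf, i, hi, Y, hYt, e⟩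
    | false =>
      have hne : σ &&& ZeroSum.forbid p y ≠ 0 := by
        intro h0
        rw [← hf] at h0
        have : Nat.land σ f = 0 := h0
        rw [this] at hb
        simp at hb
      rcases Nat.eq_zero_or_pos i with rfl | hpos
      · simpa [e] using hYt
      · exfalso
        obtain ⟨T, hT, hbad⟩ := hσ.forbid hp hcur hy hne
        refine hX T (hT.trans ?_) hbad
        rw [← Multiset.singleton_add, add_comm]
        refine add_le_add_right ?_ _
        rw [Multiset.singleton_le, e, Multiset.mem_add]
        exact Or.inl (Multiset.mem_replicate.2 ⟨by omega, rfl⟩)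

lemma searchLoop_sound {p σ n : ℕ} (hp : 0 < p) {cur : Multiset (ℕ × ℕ)} (hσ : Sound p σ cur)
    (hcur : ∀ x ∈ cur, InGrid p x) (rec : ℕ → Cands → Bool)
    (hrec : ∀ σ' l cur' X, rec σ' l = true → Sound p σ' cur' → (∀ x ∈ cur', InGrid p x) →
      Fit p l X → X.card = n → ∃ T ≤ cur' + X, IsBad p T) :
    ∀ (a : Cands) (tot : ℕ) (X : Multiset (ℕ × ℕ)),
      searchLoop (p * rowBits p) (levelMask p p) σ (n + 1) rec a tot = true → total a ≤ tot →
      Fit p a X → X.card = n + 1 → ∃ T ≤ cur + X, IsBad p T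
  | .nil, tot, X, _, _, h, hc => by simp [show X = 0 from h] at hc
  | .cons s f c t, tot, X, hl, ht, hX, hc => by
    have hX' := hX
    obtain ⟨y, hy, hs, hf, i, hi, Y, hY, e⟩ := hX
    have hd : searchLoop (p * rowBits p) (levelMask p p) σ (n + 1) rec (.cons s f c t) tot =
      Bool.rec (motive := fun _ => Bool) true
      (Bool.rec (motive := fun _ => Bool) false
        (searchLoop (p * rowBits p) (levelMask p p) σ (n + 1) rec t (tot - c))
        (rec (addShift (p * rowBits p) (levelMask p p) s σ) (decr s f c t)))
      (Nat.ble (n + 1) tot) := rfl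
    have htot : total (.cons s f c t) = c + total t := rfl
    have hb : Nat.ble (n + 1) tot = true := by
      rw [Nat.ble_eq]; have := hX'.card_le; omega
    rw [hd, hb] at hl
    cases hr : rec (addShift (p * rowBits p) (levelMask p p) s σ) (decr s f c t) with
    | false => rw [hr] at hl; simp at hl
    | true =>
      rw [hr] at hl
      rcases Nat.eq_zero_or_pos i with rfl | hpos
      · have e' : X = Y := by simpa using e
        subst e'
        exact searchLoop_sound hp hσ hcur rec hrec t (tot - c) X hl (by omega) hY hc
      · obtain ⟨j, rfl⟩ : ∃ j, i = j + 1 := ⟨i - 1, by omega⟩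
        rw [hs] at hr
        have hfit : Fit p (decr (code p y) f c t) (Multiset.replicate j y + Y) := by
          have hd2 : decr (code p y) f c t = Bool.rec (motive := fun _ => Cands)
            (.cons (code p y) f (c - 1) t) t (Nat.ble c 1) := rfl
          rw [hd2]
          cases hcb : Nat.ble c 1 with
          | true =>
            have : c ≤ 1 := by simpa using hcb
            have : j = 0 := by omega
            subst this
            simpa using hY
          | false =>
            exact ⟨y, hy, rfl, hf, j, by omega, Y, hY, rfl⟩
        obtain ⟨T, hT, hbad⟩ := hrec _ _ (y ::ₘ cur) _ hr (hσ.addShift hp hcur hy)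
          (by
            intro x hx
            rcases Multiset.mem_cons.1 hx with rfl | hx
            · exact hy
            · exact hcur x hx) hfit (by
              rw [e] at hc; simp at hc ⊢; omega)
        refine ⟨T, hT.trans (le_of_eq ?_), hbad⟩
        rw [e, Multiset.replicate_succ, Multiset.cons_add, Multiset.cons_add,
          Multiset.add_cons]

lemma search_sound {p : ℕ} (hp : 0 < p) (n : ℕ) : ∀ (σ : ℕ) (l : Cands)
    (cur X : Multiset (ℕ × ℕ)), search (p * rowBits p) (levelMask p p) n σ l = true →
    Sound p σ cur → (∀ x ∈ cur, InGrid p x) → Fit p l X → X.card = n →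
    ∃ T ≤ cur + X, IsBad p T := by
  induction n with
  | zero => intro σ l cur X h; exact absurd h (by simp [search])
  | succ n ih =>
    intro σ l cur X h hσ hcur hX hc
    by_contra hcon
    push Not at hcon
    have h' : searchLoop (p * rowBits p) (levelMask p p) σ (n + 1)
      (search (p * rowBits p) (levelMask p p) n) (filt σ l) (total (filt σ l)) = true := h
    obtain ⟨T, hT, hbad⟩ := searchLoop_sound hp hσ hcur _ ih _ _ X h' le_rfl
      (hX.filt hp hσ hcur hcon) hc
    exact hcon T hT hbad

/-- The coded subsums of a list of points. -/
noncomputable def initState (p : ℕ) (l : List (ℕ × ℕ)) : ℕ :=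
  List.rec (motive := fun _ => ℕ) 1
    (fun x _ ih => addShift (p * rowBits p) (levelMask p p) (code p x) ih) l

lemma sound_initState {p : ℕ} (hp : 0 < p) : ∀ l : List (ℕ × ℕ), (∀ x ∈ l, InGrid p x) →
    Sound p (initState p l) (l : Multiset (ℕ × ℕ))
  | [], _ => by
    intro i hi
    have hi' : Nat.testBit 1 i = true := hi
    have : i = 0 := by
      by_contra h
      obtain ⟨j, rfl⟩ : ∃ j, i = j + 1 := ⟨i - 1, by omega⟩
      simp [Nat.testBit_succ] at hi'
    exact ⟨0, by simp, by simp, 0, by simp [this]⟩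
  | x :: l, h => by
    have h1 := sound_initState hp l fun y hy => h y (List.mem_cons_of_mem x hy)
    exact h1.addShift hp (fun y hy => h y (List.mem_cons_of_mem x hy)) (h x List.mem_cons_self)

noncomputable def candsOf (p : ℕ) (cap : ℕ × ℕ → ℕ) (l : List (ℕ × ℕ)) : Cands :=
  List.rec (motive := fun _ => Cands) .nil
    (fun x _ ih => .cons (code p x) (forbid p x) (cap x) ih) l

lemma fit_candsOf {p : ℕ} (cap : ℕ × ℕ → ℕ) : ∀ (l : List (ℕ × ℕ)) (X : Multiset (ℕ × ℕ)),
    (∀ x ∈ l, InGrid p x) → (∀ x ∈ X, x ∈ l) → (∀ x ∈ X, X.count x ≤ cap x) →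
    Fit p (candsOf p cap l) X
  | [], X, _, h, _ => by
    show X = 0
    exact Multiset.eq_zero_of_forall_notMem fun x hx => by simpa using h x hx
  | x :: l, X, hg, h, hc => by
    refine ⟨x, hg x List.mem_cons_self, rfl, rfl, X.count x, ?_, X.filter (x ≠ ·), ?_, ?_⟩
    · by_cases hx : x ∈ X
      · exact hc x hx
      · simp [Multiset.count_eq_zero_of_notMem hx]
    · refine fit_candsOf cap l _ (fun y hy => hg y (List.mem_cons_of_mem x hy)) ?_ ?_
      · intro y hy
        rw [Multiset.mem_filter] at hy
        rcases List.mem_cons.1 (h y hy.1) with e | e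
        · exact absurd e.symm hy.2
        · exact e
      · intro y hy
        exact (Multiset.count_le_of_le y (Multiset.filter_le _ _)).trans
          (hc y (Multiset.mem_of_mem_filter hy))
    · rw [← Multiset.filter_eq, Multiset.filter_add_not]

/-- All points of the grid. -/
def gridPoints (p : ℕ) : List (ℕ × ℕ) :=
  ((List.range p).flatMap fun r => (List.range p).map fun c => (c, r)).reverse

lemma mem_gridPoints {p : ℕ} {x : ℕ × ℕ} : x ∈ gridPoints p ↔ InGrid p x := by
  simp only [gridPoints, List.mem_reverse, List.mem_flatMap, List.mem_range, List.mem_map]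
  constructor
  · rintro ⟨r, hr, c, hc, rfl⟩; exact ⟨hc, hr⟩
  · rintro ⟨h1, h2⟩; exact ⟨x.2, h2, x.1, h1, rfl⟩

/-- No `need` further grid points outside `l`, with multiplicities bounded by `cap`, extend `l`. -/
noncomputable def refute (p need : ℕ) (l : List (ℕ × ℕ)) (cap : ℕ × ℕ → ℕ) : Bool :=
  search (p * rowBits p) (levelMask p p) need (initState p l)
    (candsOf p cap ((gridPoints p).filter fun x => !l.elem x))

lemma exists_isBad_of_refute {p need : ℕ} (hp : 0 < p) {l : List (ℕ × ℕ)} {cap : ℕ × ℕ → ℕ}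
    (h : refute p need l cap = true) (hl : ∀ x ∈ l, InGrid p x) (X : Multiset (ℕ × ℕ))
    (hX : ∀ x ∈ X, InGrid p x ∧ x ∉ l ∧ X.count x ≤ cap x) (hc : X.card = need) :
    ∃ T ≤ (l : Multiset (ℕ × ℕ)) + X, IsBad p T := by
  refine search_sound hp need _ _ _ X h (sound_initState hp l hl) (by simpa using hl) ?_ hc
  refine fit_candsOf cap _ X ?_ ?_ fun x hx => (hX x hx).2.2
  · intro x hx
    exact mem_gridPoints.1 (List.mem_of_mem_filter hx)
  · intro x hx
    rw [List.mem_filter]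
    exact ⟨mem_gridPoints.2 (hX x hx).1, by simpa using (hX x hx).2.1⟩

/-! ### Property D for `C_p ⊕ C_p` with `p ≤ 7` -/

/-- `S` has no zero-sum subsequence of length `k`. -/
def NoZS {G : Type*} [AddCommMonoid G] (k : ℕ) (S : Multiset G) : Prop :=
  ∀ T ≤ S, T.card = k → T.sum ≠ 0

lemma NoZS.mono {G : Type*} [AddCommMonoid G] {k : ℕ} {S T : Multiset G} (h : NoZS k S)
    (hT : T ≤ S) : NoZS k T := fun U hU => h U (hU.trans hT)

section Coordinates

variable {p : ℕ} [Fact p.Prime]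

/-- Coordinates of `y` in the affine frame with origin `a` and directions `u`, `v`. -/
noncomputable def coord (a u v y : ZMod p × ZMod p) : ZMod p × ZMod p :=
  ((u.1 * v.2 - u.2 * v.1)⁻¹ * ((y.1 - a.1) * v.2 - (y.2 - a.2) * v.1),
    (u.1 * v.2 - u.2 * v.1)⁻¹ * (u.1 * (y.2 - a.2) - u.2 * (y.1 - a.1)))

/-- The coordinates as natural numbers below `p`. -/
noncomputable def natCoord (a u v y : ZMod p × ZMod p) : ℕ × ℕ :=
  ((coord a u v y).1.val, (coord a u v y).2.val)

variable {a u v : ZMod p × ZMod p}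

lemma coord_add_smul (hΔ : u.1 * v.2 - u.2 * v.1 ≠ 0) (i j : ZMod p) :
    coord a u v (a + i • u + j • v) = (i, j) := by
  simp only [coord, Prod.fst_add, Prod.smul_fst, Prod.snd_add, Prod.smul_snd, smul_eq_mul]
  ext
  · simp only
    rw [inv_mul_eq_iff_eq_mul₀ hΔ]; ring
  · simp only
    rw [inv_mul_eq_iff_eq_mul₀ hΔ]; ring

lemma add_coord_smul (hΔ : u.1 * v.2 - u.2 * v.1 ≠ 0) (y : ZMod p × ZMod p) :
    a + (coord a u v y).1 • u + (coord a u v y).2 • v = y := by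
  simp only [coord]
  ext
  · simp only [Prod.fst_add, Prod.smul_fst, smul_eq_mul]
    field_simp
    ring
  · simp only [Prod.snd_add, Prod.smul_snd, smul_eq_mul]
    field_simp
    ring

lemma natCoord_add_smul (hΔ : u.1 * v.2 - u.2 * v.1 ≠ 0) (i j : ZMod p) :
    natCoord a u v (a + i • u + j • v) = (i.val, j.val) := by
  rw [natCoord, coord_add_smul hΔ]

lemma natCoord_injective (hΔ : u.1 * v.2 - u.2 * v.1 ≠ 0) :
    Function.Injective (natCoord a u v) := by
  intro y z h
  rw [natCoord, natCoord, Prod.mk.injEq] at h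
  rw [← add_coord_smul hΔ (a := a) y, ← add_coord_smul hΔ (a := a) z,
    ZMod.val_injective p h.1, ZMod.val_injective p h.2]

lemma natCoord_inGrid (y : ZMod p × ZMod p) : InGrid p (natCoord a u v y) :=
  ⟨ZMod.val_lt _, ZMod.val_lt _⟩

lemma natCoord_origin (hΔ : u.1 * v.2 - u.2 * v.1 ≠ 0) : natCoord a u v a = (0, 0) := by
  have := natCoord_add_smul (a := a) hΔ 0 0
  simpa using this

lemma natCoord_fst (hΔ : u.1 * v.2 - u.2 * v.1 ≠ 0) : natCoord a u v (a + u) = (1, 0) := by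
  have := natCoord_add_smul (a := a) hΔ 1 0
  have h1 : Fact (1 < p) := ⟨(Fact.out : p.Prime).one_lt⟩
  simpa [ZMod.val_one] using this

lemma natCoord_snd (hΔ : u.1 * v.2 - u.2 * v.1 ≠ 0) : natCoord a u v (a + v) = (0, 1) := by
  have := natCoord_add_smul (a := a) hΔ 0 1
  have h1 : Fact (1 < p) := ⟨(Fact.out : p.Prime).one_lt⟩
  simpa [ZMod.val_one] using this

lemma natCoord_add (hΔ : u.1 * v.2 - u.2 * v.1 ≠ 0) : natCoord a u v (a + u + v) = (1, 1) := by
  have := natCoord_add_smul (a := a) hΔ 1 1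
  have h1 : Fact (1 < p) := ⟨(Fact.out : p.Prime).one_lt⟩
  simpa [ZMod.val_one] using this

lemma sum_eq_zero_of_isBad (hΔ : u.1 * v.2 - u.2 * v.1 ≠ 0) (T : Multiset (ZMod p × ZMod p))
    (h : IsBad p (T.map (natCoord a u v))) : T.sum = 0 := by
  obtain ⟨hc, h1, h2⟩ := h
  rw [Multiset.card_map] at hc
  rw [Multiset.map_map] at h1 h2
  rw [← ZMod.natCast_eq_zero_iff, Nat.cast_multiset_sum, Multiset.map_map] at h1 h2
  have e1 : (T.map fun y => (coord a u v y).1).sum = 0 := by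
    rw [← h1]; congr 1; refine Multiset.map_congr rfl fun y _ => ?_
    simp [natCoord]
  have e2 : (T.map fun y => (coord a u v y).2).sum = 0 := by
    rw [← h2]; congr 1; refine Multiset.map_congr rfl fun y _ => ?_
    simp [natCoord]
  have e3 : (T.map fun y => a + (coord a u v y).1 • u + (coord a u v y).2 • v) = T := by
    conv_rhs => rw [← Multiset.map_id T]
    exact Multiset.map_congr rfl fun y _ => add_coord_smul hΔ y
  rw [← e3, Multiset.sum_map_add, Multiset.sum_map_add]
  have e4 : (T.map fun y => (coord a u v y).1 • u).sum = 0 := by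
    rw [← zero_smul (ZMod p) u, ← e1, Multiset.sum_smul, Multiset.map_map]
    rfl
  have e5 : (T.map fun y => (coord a u v y).2 • v).sum = 0 := by
    rw [← zero_smul (ZMod p) v, ← e2, Multiset.sum_smul, Multiset.map_map]
    rfl
  rw [e4, e5, Multiset.map_const', Multiset.sum_replicate, hc]
  ext <;> simp

lemma not_noZS_of_refute (hΔ : u.1 * v.2 - u.2 * v.1 ≠ 0) {need : ℕ} {l : List (ℕ × ℕ)}
    {cap : ℕ × ℕ → ℕ} (h : refute p need l cap = true) {L Y S : Multiset (ZMod p × ZMod p)}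
    (hS : L + Y ≤ S) (hL : L.map (natCoord a u v) = l)
    (hY : ∀ y ∈ Y, natCoord a u v y ∉ l ∧ Y.count y ≤ cap (natCoord a u v y))
    (hc : Y.card = need) : ¬ NoZS p S := by
  intro hno
  have hp : 0 < p := (Fact.out : p.Prime).pos
  have hinj := natCoord_injective (a := a) hΔ
  obtain ⟨T, hT, hbad⟩ := exists_isBad_of_refute hp h (by
      intro x hx
      have : x ∈ L.map (natCoord a u v) := by rw [hL]; simpa using hx
      obtain ⟨y, _, rfl⟩ := Multiset.mem_map.1 this
      exact natCoord_inGrid y) (Y.map (natCoord a u v)) (by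
      intro x hx
      obtain ⟨y, hy, rfl⟩ := Multiset.mem_map.1 hx
      refine ⟨natCoord_inGrid y, (hY y hy).1, ?_⟩
      rw [Multiset.count_map_eq_count' _ _ hinj]
      exact (hY y hy).2) (by simpa using hc)
  rw [← hL, ← Multiset.map_add] at hT
  have hg := Function.leftInverse_invFun hinj
  have h1 : T.map (Function.invFun (natCoord a u v)) ≤ L + Y := by
    have := Multiset.map_le_map (f := Function.invFun (natCoord a u v)) hT
    rwa [Multiset.map_map, hg.comp_eq_id, Multiset.map_id] at this
  have h2 : (T.map (Function.invFun (natCoord a u v))).map (natCoord a u v) = T := by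
    rw [Multiset.map_map]
    conv_rhs => rw [← Multiset.map_id T]
    refine Multiset.map_congr rfl fun x hx => ?_
    obtain ⟨y, _, rfl⟩ := Multiset.mem_map.1 (Multiset.mem_of_le hT hx)
    simp [hg y]
  refine hno _ (h1.trans hS) ?_ (sum_eq_zero_of_isBad (a := a) hΔ _ (h2.symm ▸ hbad))
  rw [Multiset.card_map]; exact hbad.1

end Coordinates

/-- Kernel check for a sequence with multiplicities `h`, `h2`, `h3` at the affine basis
`(0, 0)`, `(1, 0)`, `(0, 1)`. -/
noncomputable def refuteTriple (p h h2 h3 : ℕ) : Bool :=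
  refute p (4 * p - 4 - h - h2 - h3)
    (List.replicate h (0, 0) ++ List.replicate h2 (1, 0) ++ List.replicate h3 (0, 1))
    fun x => if h3 = p - 1 then p - 2 else if x.2 = 0 then h2 else h3

set_option maxRecDepth 100000 in
lemma refuteTriple_two : ∀ h < 2, ∀ h2 ≤ h, ∀ h3 ≤ h2, 1 ≤ h3 →
    refuteTriple 2 h h2 h3 = true := by decide +kernel

set_option maxRecDepth 100000 in
lemma refuteTriple_three : ∀ h < 3, ∀ h2 ≤ h, ∀ h3 ≤ h2, 1 ≤ h3 →
    refuteTriple 3 h h2 h3 = true := by decide +kernel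

set_option maxRecDepth 100000 in
lemma refuteTriple_five : ∀ h < 5, ∀ h2 ≤ h, ∀ h3 ≤ h2, 1 ≤ h3 →
    refuteTriple 5 h h2 h3 = true := by decide +kernel

set_option maxRecDepth 100000 in
lemma refuteTriple_seven_two : ∀ h3 ≤ 2, 1 ≤ h3 → refuteTriple 7 2 2 h3 = true := by
  decide +kernel

set_option maxRecDepth 100000 in
lemma refuteTriple_seven_three : ∀ h2 ≤ 3, 2 ≤ h2 → ∀ h3 ≤ h2, 1 ≤ h3 →
    refuteTriple 7 3 h2 h3 = true := by
  decide +kernel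

set_option maxRecDepth 100000 in
lemma refuteTriple_seven_four : ∀ h2 ≤ 4, ∀ h3 ≤ h2, 1 ≤ h3 → refuteTriple 7 4 h2 h3 = true := by
  decide +kernel

set_option maxRecDepth 100000 in
lemma refuteTriple_seven_five : ∀ h2 ≤ 5, ∀ h3 ≤ h2, 1 ≤ h3 → refuteTriple 7 5 h2 h3 = true := by
  decide +kernel

set_option maxRecDepth 100000 in
lemma refuteTriple_seven_six : ∀ h2 ≤ 6, ∀ h3 ≤ h2, 1 ≤ h3 → refuteTriple 7 6 h2 h3 = true := by
  decide +kernel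

set_option maxRecDepth 100000 in
lemma refute_parallelogram :
    refute 7 18 [(0, 0), (1, 0), (0, 1), (1, 1)] (fun _ => 1) = true := by
  decide +kernel

lemma count_le_of_noZS {p : ℕ} [Fact p.Prime] {G : Type*} [AddCommGroup G] [DecidableEq G]
    (hG : ∀ x : G, p • x = 0) {S : Multiset G} (hS : NoZS p S) (x : G) :
    S.count x ≤ p - 1 := by
  by_contra h
  refine hS (Multiset.replicate p x) (Multiset.le_count_iff_replicate_le.1 (by omega)) (by simp) ?_
  rw [Multiset.sum_replicate, hG]

lemma nsmul_eq_zero_prod {p : ℕ} (x : ZMod p × ZMod p) : p • x = 0 := by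
  ext <;> simp

lemma exists_smul_of_det {p : ℕ} [Fact p.Prime] {u v : ZMod p × ZMod p} (hu : u ≠ 0)
    (h : u.1 * v.2 - u.2 * v.1 = 0) : ∃ k : ZMod p, v = k • u := by
  by_cases h1 : u.1 = 0
  · have h2 : u.2 ≠ 0 := fun h2 => hu (Prod.ext h1 h2)
    refine ⟨v.2 * u.2⁻¹, Prod.ext ?_ ?_⟩
    · have : v.1 = 0 := by simpa [h1, h2] using h
      simp [this, h1]
    · simp [h2]
  · refine ⟨v.1 * u.1⁻¹, Prod.ext ?_ ?_⟩
    · simp [h1]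
    · simp only [Prod.smul_snd, smul_eq_mul]
      field_simp
      linear_combination h

/-- A long sequence contained in a line has a zero-sum subsequence of length `p`. -/
lemma not_noZS_of_line {p : ℕ} [Fact p.Prime] {S : Multiset (ZMod p × ZMod p)}
    {a u : ZMod p × ZMod p} (hS : ∀ y ∈ S, ∃ k : ZMod p, y = a + k • u)
    (hc : 2 * p - 1 ≤ S.card) : ¬ NoZS p S := by
  classical
  intro hno
  choose! k hk using hS
  obtain ⟨T, hT, hTc, hsum⟩ := ZMod.erdos_ginzburg_ziv_multiset (S.map k) (by simpa using hc)
  have h1 : T.map (fun i => a + i • u) ≤ S := by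
    have := Multiset.map_le_map (f := fun i => a + i • u) hT
    rw [Multiset.map_map] at this
    refine this.trans (le_of_eq ?_)
    conv_rhs => rw [← Multiset.map_id S]
    exact Multiset.map_congr rfl fun y hy => (hk y hy).symm
  refine hno _ h1 (by simpa using hTc) ?_
  rw [Multiset.sum_map_add, Multiset.map_const', Multiset.sum_replicate, hTc,
    nsmul_eq_zero_prod, zero_add]
  have := Multiset.sum_smul (l := T) (x := u)
  rw [hsum, zero_smul] at this
  exact this.symm

/-- Four points of multiplicity at least `q` exhaust a sequence of length `4q`. -/
lemma count_eq_of_four {G : Type*} [DecidableEq G] {q : ℕ} {S : Multiset G}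
    (hc : S.card = 4 * q) {a b c d : G} (hab : a ≠ b) (hac : a ≠ c) (had : a ≠ d) (hbc : b ≠ c)
    (hbd : b ≠ d) (hcd : c ≠ d) (ha : q ≤ S.count a) (hb : q ≤ S.count b) (hcc : q ≤ S.count c)
    (hd : q ≤ S.count d) (hle : ∀ x, S.count x ≤ q) : ∀ x ∈ S, S.count x = q := by
  have h : Multiset.replicate q a + Multiset.replicate q b + Multiset.replicate q c +
      Multiset.replicate q d ≤ S := by
    rw [Multiset.le_iff_count]
    intro x
    simp only [Multiset.count_add, Multiset.count_replicate]
    by_cases h1 : a = x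
    · subst h1; simp [hab.symm, hac.symm, had.symm, ha]
    by_cases h2 : b = x
    · subst h2; simp [hab, hbc.symm, hbd.symm, hb]
    by_cases h3 : c = x
    · subst h3; simp [hac, hbc, hcd.symm, hcc]
    by_cases h4 : d = x
    · subst h4; simp [had, hbd, hcd, hd]
    simp [h1, h2, h3, h4]
  have h2 := Multiset.eq_of_le_of_card_le h (by simp; omega)
  intro x hx
  have hx2 := hx
  rw [← h2] at hx2
  simp only [Multiset.mem_add, Multiset.mem_replicate] at hx2
  refine le_antisymm (hle x) ?_
  rcases hx2 with ((⟨_, rfl⟩ | ⟨_, rfl⟩) | ⟨_, rfl⟩) | ⟨_, rfl⟩ <;> assumption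

/-- A sequence with no zero-sum subsequence of length `p` has an affine basis of points of
greedily maximal multiplicities. -/
lemma exists_greedy_basis {p : ℕ} [Fact p.Prime] {S : Multiset (ZMod p × ZMod p)}
    (hc : S.card = 4 * (p - 1)) (hS : NoZS p S) : ∃ a b c : ZMod p × ZMod p,
      (b - a).1 * (c - a).2 - (b - a).2 * (c - a).1 ≠ 0 ∧ b ≠ a ∧
      1 ≤ S.count c ∧ S.count c ≤ S.count b ∧ S.count b ≤ S.count a ∧ S.count a ≤ p - 1 ∧
      (∀ x ≠ a, S.count x ≤ S.count b) ∧
      ∀ x, (b - a).1 * (x - a).2 - (b - a).2 * (x - a).1 ≠ 0 → S.count x ≤ S.count c := by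
  have hp2 := (Fact.out : p.Prime).two_le
  have hle := count_le_of_noZS nsmul_eq_zero_prod hS
  obtain ⟨a, ha, hamax⟩ := Finset.exists_max_image S.toFinset (fun x => S.count x) (by
    rw [Multiset.toFinset_nonempty]; rintro rfl; simp at hc; omega)
  have hamax' : ∀ x, S.count x ≤ S.count a := fun x => by
    by_cases hx : x ∈ S
    · exact hamax x (Multiset.mem_toFinset.2 hx)
    · simp [Multiset.count_eq_zero_of_notMem hx]
  obtain ⟨b, hb, hbmax⟩ := Finset.exists_max_image (S.toFinset.erase a) (fun x => S.count x) (by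
    by_contra hne
    rw [Finset.not_nonempty_iff_eq_empty] at hne
    have : S = Multiset.replicate S.card a := by
      rw [Multiset.eq_replicate]
      refine ⟨rfl, fun x hx => ?_⟩
      by_contra hxa
      have : x ∈ S.toFinset.erase a := Finset.mem_erase.2 ⟨hxa, Multiset.mem_toFinset.2 hx⟩
      simp [hne] at this
    have h1 := hle a
    rw [this, Multiset.count_replicate_self] at h1
    omega)
  have hba := (Finset.mem_erase.1 hb).1
  have hbmax' : ∀ x ≠ a, S.count x ≤ S.count b := fun x hxa => by
    by_cases hx : x ∈ S
    · exact hbmax x (Finset.mem_erase.2 ⟨hxa, Multiset.mem_toFinset.2 hx⟩)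
    · simp [Multiset.count_eq_zero_of_notMem hx]
  obtain ⟨c, hcm, hcmax⟩ := Finset.exists_max_image
    (S.toFinset.filter fun x => (b - a).1 * (x - a).2 - (b - a).2 * (x - a).1 ≠ 0)
    (fun x => S.count x) (by
      by_contra hne
      rw [Finset.not_nonempty_iff_eq_empty, Finset.filter_eq_empty_iff] at hne
      refine not_noZS_of_line (a := a) (u := b - a) (S := S) (fun y hy => ?_) (by omega) hS
      have := hne (Multiset.mem_toFinset.2 hy)
      obtain ⟨k, hk⟩ := exists_smul_of_det (sub_ne_zero.2 hba) (not_not.1 this)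
      exact ⟨k, by rw [← hk]; abel⟩)
  rw [Finset.mem_filter, Multiset.mem_toFinset] at hcm
  refine ⟨a, b, c, hcm.2, hba, Multiset.one_le_count_iff_mem.2 hcm.1, hbmax' c ?_, hamax' b, hle a,
    hbmax', fun x hx => ?_⟩
  · rintro rfl; simp at hcm
  · by_cases hxS : x ∈ S
    · exact hcmax x (Finset.mem_filter.2 ⟨Multiset.mem_toFinset.2 hxS, hx⟩)
    · simp [Multiset.count_eq_zero_of_notMem hxS]

lemma det_ne_zero_of_natCoord {p : ℕ} [Fact p.Prime] {a u v x : ZMod p × ZMod p}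
    (h : (natCoord a u v x).2 ≠ 0) : u.1 * (x - a).2 - u.2 * (x - a).1 ≠ 0 := by
  intro h0
  refine h ?_
  have : (coord a u v x).2 = 0 := by
    simp only [coord]
    rw [Prod.fst_sub, Prod.snd_sub] at h0
    rw [h0, mul_zero]
  simp [natCoord, this]

lemma not_noZS_of_refuteTriple {p : ℕ} [Fact p.Prime] {S : Multiset (ZMod p × ZMod p)}
    (hc : S.card = 4 * (p - 1)) {a b c : ZMod p × ZMod p}
    (hΔ : (b - a).1 * (c - a).2 - (b - a).2 * (c - a).1 ≠ 0)
    (h1 : 1 ≤ S.count c) (hcb : S.count c ≤ S.count b) (hba : S.count b ≤ S.count a)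
    (hb : ∀ x ≠ a, S.count x ≤ S.count b)
    (hcx : ∀ x, (b - a).1 * (x - a).2 - (b - a).2 * (x - a).1 ≠ 0 → S.count x ≤ S.count c)
    (hcap : S.count c = p - 1 → ∀ x, x ≠ a → x ≠ b → x ≠ c → S.count x ≤ p - 2)
    (h : refuteTriple p (S.count a) (S.count b) (S.count c) = true) : ¬ NoZS p S := by
  have hb0 := natCoord_fst (a := a) hΔ
  have hc0 := natCoord_snd (a := a) hΔ
  rw [add_sub_cancel] at hb0 hc0
  have ha0 := natCoord_origin (a := a) hΔ
  have hinj := natCoord_injective (a := a) hΔ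
  have hab : a ≠ b := by rintro rfl; simp at hΔ
  have hac : a ≠ c := by rintro rfl; simp at hΔ
  have hbc : b ≠ c := by rintro rfl; exact hΔ (by ring)
  set L := Multiset.replicate (S.count a) a + Multiset.replicate (S.count b) b +
    Multiset.replicate (S.count c) c with hL
  have hcount : ∀ x, L.count x = if x = a ∨ x = b ∨ x = c then S.count x else 0 := by
    intro x
    simp only [hL, Multiset.count_add, Multiset.count_replicate]
    by_cases h1 : a = x
    · subst h1; simp [hab.symm, hac.symm]
    by_cases h2 : b = x
    · subst h2; simp [hab, hbc.symm]
    by_cases h3 : c = x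
    · subst h3; simp [hac, hbc]
    simp [h1, h2, h3, Ne.symm h1, Ne.symm h2, Ne.symm h3]
  have hLS : L ≤ S := by
    rw [Multiset.le_iff_count]; intro x; rw [hcount]; split_ifs <;> simp
  refine not_noZS_of_refute (a := a) hΔ h (L := L) (Y := S - L)
    (le_of_eq (add_tsub_cancel_of_le hLS)) ?_ ?_ ?_
  · simp [hL, ha0, hb0, hc0, ← Multiset.coe_replicate]
  · intro y hy
    have hy2 : 1 ≤ (S - L).count y := Multiset.one_le_count_iff_mem.2 hy
    have hyle : (S - L).count y ≤ S.count y := Multiset.count_le_of_le _ (Multiset.sub_le_self _ _)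
    rw [Multiset.count_sub, hcount] at hy2
    have hyn : ¬ (y = a ∨ y = b ∨ y = c) := by
      intro h; rw [if_pos h] at hy2; omega
    push Not at hyn
    constructor
    · simp only [List.mem_append, List.mem_replicate, ← ha0, ← hb0, ← hc0, hinj.eq_iff]
      tauto
    · refine hyle.trans ?_
      split_ifs with e1 e2
      · exact hcap e1 y hyn.1 hyn.2.1 hyn.2.2
      · exact hb y hyn.1
      · exact hcx y (det_ne_zero_of_natCoord e2)
  · rw [Multiset.card_sub hLS, hc]; simp only [hL, Multiset.card_add, Multiset.card_replicate]
    omega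

/-- A set of at least `22` points of `C_7 ⊕ C_7` contains a non-degenerate parallelogram. -/
lemma exists_parallelogram (D : Finset (ZMod 7 × ZMod 7)) (hD : 22 ≤ D.card) :
    ∃ a u v : ZMod 7 × ZMod 7, u.1 * v.2 - u.2 * v.1 ≠ 0 ∧ a ∈ D ∧ a + u ∈ D ∧ a + v ∈ D ∧
      a + u + v ∈ D := by
  have : Fact (Nat.Prime 7) := ⟨by norm_num⟩
  obtain ⟨d, hd, hlt⟩ := Finset.exists_lt_card_fiber_of_mul_lt_card_of_maps_to
    (s := D.offDiag) (t := Finset.univ.erase (0 : ZMod 7 × ZMod 7)) (f := fun x => x.2 - x.1)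
    (n := 7) (by
      rintro ⟨x, y⟩ hxy
      rw [Finset.mem_offDiag] at hxy
      simpa [sub_eq_zero] using fun h : y = x => hxy.2.2 h.symm) (by
      rw [Finset.card_erase_of_mem (Finset.mem_univ _), Finset.offDiag_card, Finset.card_univ,
        Fintype.card_prod, ZMod.card]
      have : 22 * D.card ≤ D.card * D.card := Nat.mul_le_mul_right _ hD
      omega)
  have hd0 : d ≠ 0 := by simpa using hd
  set E := (D.offDiag.filter fun x => x.2 - x.1 = d).image Prod.fst with hE
  have hEc : 7 < E.card := by
    rw [hE, Finset.card_image_of_injOn]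
    · exact hlt
    · rintro ⟨x, y⟩ hx ⟨z, w⟩ hz h
      simp only [Finset.coe_filter, Set.mem_ofPred_eq] at hx hz h
      have : y = w := by rw [← sub_add_cancel y x, hx.2, ← sub_add_cancel w z, hz.2, h]
      rw [h, this]
  have hmem : ∀ x ∈ E, x ∈ D ∧ x + d ∈ D := by
    intro x hx
    simp only [hE, Finset.mem_image, Finset.mem_filter, Finset.mem_offDiag] at hx
    obtain ⟨⟨x, y⟩, ⟨⟨h1, h2, _⟩, rfl⟩, rfl⟩ := hx
    exact ⟨h1, by simpa using h2⟩
  obtain ⟨a, ha⟩ : E.Nonempty := Finset.card_pos.1 (by omega)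
  obtain ⟨b, hb, hb2⟩ : ∃ b ∈ E, b ∉ Finset.univ.image fun k : ZMod 7 => a + k • d := by
    by_contra! hcon
    have h1 := Finset.card_le_card (show E ⊆ _ from hcon)
    have h2 : (Finset.univ.image fun k : ZMod 7 => a + k • d).card ≤ 7 :=
      Finset.card_image_le.trans (by simp [ZMod.card])
    omega
  refine ⟨a, d, b - a, fun h => ?_, (hmem a ha).1, (hmem a ha).2, ?_, ?_⟩
  · obtain ⟨k, hk⟩ := exists_smul_of_det hd0 h
    exact hb2 (Finset.mem_image.2 ⟨k, Finset.mem_univ _, by rw [← hk]; abel⟩)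
  · rw [add_sub_cancel]; exact (hmem b hb).1
  · have : a + d + (b - a) = b + d := by abel
    rw [this]; exact (hmem b hb).2

lemma not_noZS_seven {S : Multiset (ZMod 7 × ZMod 7)} (hS : 22 ≤ S.toFinset.card) :
    ¬ NoZS 7 S := by
  have : Fact (Nat.Prime 7) := ⟨by norm_num⟩
  obtain ⟨a, u, v, hΔ, h1, h2, h3, h4⟩ := exists_parallelogram S.toFinset hS
  have ha0 := natCoord_origin (a := a) hΔ
  have hu0 := natCoord_fst (a := a) hΔ
  have hv0 := natCoord_snd (a := a) hΔ
  have huv0 := natCoord_add (a := a) hΔ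
  have hinj := natCoord_injective (a := a) hΔ
  set F : Finset (ZMod 7 × ZMod 7) := {a, a + u, a + v, a + u + v} with hF
  have hFD : F ⊆ S.toFinset := by
    intro x hx
    simp only [hF, Finset.mem_insert, Finset.mem_singleton] at hx
    rcases hx with rfl | rfl | rfl | rfl <;> assumption
  have hFc : F.card ≤ 4 := Finset.card_le_four
  obtain ⟨Y, hY, hYc⟩ := Finset.exists_subset_card_eq (s := S.toFinset \ F) (n := 18) (by
    rw [Finset.card_sdiff_of_subset hFD]; omega)
  have hnd : [a, a + u, a + v, a + u + v].Nodup := by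
    refine List.Nodup.of_map (natCoord a u v) ?_
    simp [ha0, hu0, hv0, huv0]
  refine not_noZS_of_refute (a := a) hΔ refute_parallelogram
    (L := ([a, a + u, a + v, a + u + v] : List _)) (Y := Y.val) ?_ ?_ ?_ (by simpa using hYc)
  · refine le_trans ?_ (Multiset.dedup_le S)
    rw [Multiset.le_iff_subset]
    · intro x hx
      rw [← Multiset.toFinset_val, Finset.mem_val]
      rcases Multiset.mem_add.1 hx with h | h
      · exact hFD (by simpa [hF] using h)
      · exact (Finset.mem_sdiff.1 (hY h)).1
    · rw [Multiset.nodup_add]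
      refine ⟨by simpa using hnd, Y.nodup, ?_⟩
      rw [Multiset.disjoint_left]
      intro x hx hxY
      exact (Finset.mem_sdiff.1 (hY hxY)).2 (by simpa [hF] using hx)
  · simp [ha0, hu0, hv0, huv0]
  · intro y hy
    refine ⟨?_, Multiset.nodup_iff_count_le_one.1 Y.nodup y⟩
    have : y ∉ F := (Finset.mem_sdiff.1 (hY hy)).2
    simp only [hF, Finset.mem_insert, Finset.mem_singleton] at this
    simp only [← ha0, ← hu0, ← hv0, ← huv0, List.mem_cons, hinj.eq_iff, List.not_mem_nil, or_false]
    exact this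

/-- Property D for `C_p ⊕ C_p`, `p ≤ 7`. -/
theorem count_eq_of_noZS_prime {p : ℕ} [Fact p.Prime] (hp : p ≤ 7)
    {S : Multiset (ZMod p × ZMod p)} (hc : S.card = 4 * (p - 1)) (hS : NoZS p S) :
    ∀ x ∈ S, S.count x = p - 1 := by
  obtain ⟨a, b, c, hΔ, hba, h1, h2, h3, h4, hb, hcx⟩ := exists_greedy_basis hc hS
  have hp2 := (Fact.out : p.Prime).two_le
  have hle := count_le_of_noZS nsmul_eq_zero_prod hS
  have hac : a ≠ c := by rintro rfl; simp at hΔ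
  have hbc : b ≠ c := by rintro rfl; exact hΔ (by ring)
  by_cases hcap : S.count c = p - 1 ∧ ∃ x, x ≠ a ∧ x ≠ b ∧ x ≠ c ∧ p - 1 ≤ S.count x
  · obtain ⟨e, x, hxa, hxb, hxc, hx⟩ := hcap
    exact count_eq_of_four hc hba.symm hac hxa.symm hbc hxb.symm hxc.symm (by omega) (by omega)
      (by omega) hx hle
  push Not at hcap
  have key := fun h => not_noZS_of_refuteTriple hc hΔ h1 h2 h3 hb hcx
    (fun e x hxa hxb hxc => by have := hcap e x hxa hxb hxc; omega) h hS
  exfalso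
  clear hcap
  have h4' : S.count a < p := by omega
  have hpp := (Fact.out : p.Prime)
  interval_cases p
  · exact key (refuteTriple_two _ h4' _ h3 _ h2 h1)
  · exact key (refuteTriple_three _ h4' _ h3 _ h2 h1)
  · norm_num at hpp
  · exact key (refuteTriple_five _ h4' _ h3 _ h2 h1)
  · norm_num at hpp
  · by_cases hs : S.count b = 1 ∧ S.count a ≤ 3
    · refine not_noZS_seven (S := S) ?_ hS
      have hsum := Multiset.toFinset_sum_count_eq S
      have haS : a ∈ S.toFinset := Multiset.mem_toFinset.2
        (Multiset.one_le_count_iff_mem.1 (by omega))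
      rw [← Finset.add_sum_erase _ _ haS] at hsum
      have : ∑ x ∈ S.toFinset.erase a, S.count x ≤ ∑ x ∈ S.toFinset.erase a, 1 :=
        Finset.sum_le_sum fun x hx => by
          have := hb x (Finset.mem_erase.1 hx).1
          omega
      rw [Finset.sum_const, smul_eq_mul, mul_one, Finset.card_erase_of_mem haS] at this
      omega
    · refine key ?_
      generalize S.count a = i at *
      generalize S.count b = j at *
      generalize S.count c = k at *
      have : 1 ≤ i := by omega
      interval_cases i
      · omega
      · obtain rfl : j = 2 := by omega
        exact refuteTriple_seven_two _ h2 h1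
      · exact refuteTriple_seven_three _ h3 (by omega) _ h2 h1
      · exact refuteTriple_seven_four _ h3 _ h2 h1
      · exact refuteTriple_seven_five _ h3 _ h2 h1
      · exact refuteTriple_seven_six _ h3 _ h2 h1

/-! ### Groups satisfying the inverse theorem and lifting along extensions -/

lemma exists_le_of_le_map {α β : Type*} {f : α → β} {T : Multiset β} :
    ∀ {S : Multiset α}, T ≤ S.map f → ∃ U ≤ S, U.map f = T := by
  induction T using Multiset.induction with
  | empty => exact fun _ => ⟨0, Multiset.zero_le _, rfl⟩
  | cons a T ih =>
    intro S h
    obtain ⟨x, hx, rfl⟩ := Multiset.mem_map.1 (Multiset.mem_of_le h (Multiset.mem_cons_self a T))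
    obtain ⟨S, rfl⟩ := Multiset.exists_cons_of_mem hx
    rw [Multiset.map_cons, Multiset.cons_le_cons_iff] at h
    obtain ⟨U, hU, rfl⟩ := ih h
    exact ⟨x ::ₘ U, Multiset.cons_le_cons x hU, by simp⟩

lemma exists_le_card_eq {α : Type*} {S : Multiset α} {k : ℕ} (h : k ≤ S.card) :
    ∃ T ≤ S, T.card = k := by
  induction S using Quotient.inductionOn with
  | h l => exact ⟨(l.take k : List α), (List.take_sublist k l).subperm, by simpa using h⟩

/-- `r (m - 1)` is the maximal length of a sequence over `H` without zero-sum subsequence of length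
`m`, and all extremal sequences consist of elements repeated `m - 1` times. -/
structure Good (H : Type*) [AddCommGroup H] [DecidableEq H] (m r : ℕ) : Prop where
  exp : ∀ x : H, m • x = 0
  ext : ∀ S : Multiset H, r * (m - 1) < S.card → ∃ T ≤ S, T.card = m ∧ T.sum = 0
  inv : ∀ S : Multiset H, S.card = r * (m - 1) → NoZS m S → ∀ x ∈ S, S.count x = m - 1
  uniq : ∀ (W : Multiset H) (s t : H), (s ::ₘ W).card = r * (m - 1) → NoZS m (s ::ₘ W) →
    NoZS m (t ::ₘ W) → s = t

section

variable {H : Type*} [AddCommGroup H] [DecidableEq H] {m r : ℕ}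

lemma NoZS.count_le {S : Multiset H} (hS : NoZS m S) (hm : 1 ≤ m) (hexp : ∀ x : H, m • x = 0)
    (x : H) : S.count x ≤ m - 1 := by
  by_contra h
  refine hS (Multiset.replicate m x) (Multiset.le_count_iff_replicate_le.1 (by omega)) (by simp) ?_
  rw [Multiset.sum_replicate, hexp]

lemma Good.of_inv [Finite H] (hm : 1 ≤ m) (hr : 1 ≤ r) (hexp : ∀ x : H, m • x = 0)
    (h1 : m = 1 → Subsingleton H) (h2 : m = 2 → Nat.card H ≤ r)
    (hinv : ∀ S : Multiset H, S.card = r * (m - 1) → NoZS m S → ∀ x ∈ S, S.count x = m - 1) :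
    Good H m r where
  exp := hexp
  inv := hinv
  ext := by
    intro S hS
    by_contra hcon
    have hno : NoZS m S := fun T hT hc hs => hcon ⟨T, hT, hc, hs⟩
    obtain ⟨U, hU, hUc⟩ := exists_le_card_eq (S := S) (k := r * (m - 1) + 1) (by omega)
    replace hno := hno.mono hU
    obtain ⟨x₀, hx₀⟩ : ∃ x, x ∈ U := Multiset.card_pos_iff_exists_mem.1 (by omega)
    have hm1 : m ≠ 1 := by
      intro h
      have := h1 h
      exact hno {x₀} (Multiset.singleton_le.2 hx₀) (by simp [h]) (Subsingleton.elim _ _)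
    have hle := hno.count_le hm hexp
    have herase : ∀ x ∈ U, ∀ y ∈ U.erase x, (U.erase x).count y = m - 1 := by
      intro x hx
      refine hinv _ ?_ (hno.mono (Multiset.erase_le _ _))
      rw [Multiset.card_erase_of_mem hx, hUc]; rfl
    have hnd : ∀ x ∈ U, x ∉ U.erase x := by
      intro x hx hx2
      have h3 := herase x hx x hx2
      rw [Multiset.count_erase_self] at h3
      have := hle x
      omega
    obtain ⟨y, hy⟩ : ∃ y, y ∈ U.erase x₀ := by
      refine Multiset.card_pos_iff_exists_mem.1 ?_
      rw [Multiset.card_erase_of_mem hx₀, hUc]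
      exact Nat.mul_pos hr (by omega)
    have h4 : U.Nodup := by
      rw [Multiset.nodup_iff_count_le_one]
      intro x
      by_contra hx
      have hxU : x ∈ U := Multiset.one_le_count_iff_mem.1 (by omega)
      refine hnd x hxU (Multiset.one_le_count_iff_mem.1 ?_)
      rw [Multiset.count_erase_self]; omega
    have h5 : m = 2 := by
      have h6 := herase x₀ hx₀ y hy
      have h7 := Multiset.count_le_of_le y (Multiset.erase_le x₀ U)
      have := Multiset.nodup_iff_count_le_one.1 h4 y
      omega
    have h6 := h2 h5
    have : Fintype H := Fintype.ofFinite H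
    rw [Nat.card_eq_fintype_card] at h6
    have h7 := Finset.card_le_univ (⟨U, h4⟩ : Finset H)
    rw [Finset.card_mk, hUc] at h7
    subst h5
    omega
  uniq := by
    intro W s t hc hs ht
    have hsc := hinv _ hc hs
    have htc := hinv (t ::ₘ W) (by rw [← hc]; simp) ht
    rcases lt_or_ge 2 m with h3 | h3
    · have hsW : W.count s = m - 2 := by
        have := hsc s (Multiset.mem_cons_self _ _)
        rw [Multiset.count_cons_self] at this
        omega
      have hmem : s ∈ t ::ₘ W := Multiset.mem_cons_of_mem
        (Multiset.one_le_count_iff_mem.1 (by omega))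
      have := htc s hmem
      by_contra hne
      rw [Multiset.count_cons_of_ne hne] at this
      omega
    · rcases (show m = 1 ∨ m = 2 by omega) with rfl | rfl
      · have := h1 rfl
        exact Subsingleton.elim _ _
      · have hnd : (s ::ₘ W).Nodup := by
          rw [Multiset.nodup_iff_count_le_one]
          exact hs.count_le hm hexp
        have : Fintype H := Fintype.ofFinite H
        have h6 := h2 rfl
        rw [Nat.card_eq_fintype_card] at h6
        have h7 : (⟨s ::ₘ W, hnd⟩ : Finset H) = Finset.univ := by
          rw [← Finset.card_eq_iff_eq_univ]
          refine le_antisymm (Finset.card_le_univ _) ?_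
          rw [Finset.card_mk, hc]; omega
        have h8 : t ∈ (⟨s ::ₘ W, hnd⟩ : Finset H) := by rw [h7]; exact Finset.mem_univ _
        rcases Multiset.mem_cons.1 (Finset.mem_mk.1 h8) with h | h
        · exact h.symm
        · have := htc t (Multiset.mem_cons_self _ _)
          rw [Multiset.count_cons_self] at this
          have := Multiset.one_le_count_iff_mem.2 h
          omega

/-- If removing any zero-sum subsequence of length `m` from `τ + ρ` leaves no further such
subsequence, then `τ` is constant. -/
lemma Good.exists_eq_replicate (hH : Good H m r) (hm : 2 ≤ m) {τ ρ : Multiset H}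
    (hτ : τ.card = m) (hτ0 : τ.sum = 0) (hρ : ρ.card = r * (m - 1))
    (h : ∀ σ ≤ τ + ρ, σ.card = m → σ.sum = 0 → NoZS m (τ + ρ - σ)) :
    ∃ a ∈ ρ, τ = Multiset.replicate m a := by
  have hρno : NoZS m ρ := by simpa using h τ (Multiset.le_add_right _ _) hτ hτ0
  have hρc := hH.inv ρ hρ hρno
  have key : ∀ x ∈ τ, x ∈ ρ := by
    intro x hx
    by_contra hxρ
    obtain ⟨σ, hσ, hσc, hσ0⟩ := hH.ext (x ::ₘ ρ) (by rw [Multiset.card_cons, hρ]; omega)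
    have hxσ : x ∈ σ := by
      by_contra hxσ
      exact hρno σ ((Multiset.le_cons_of_notMem hxσ).1 hσ) hσc hσ0
    obtain ⟨σ', rfl⟩ := Multiset.exists_cons_of_mem hxσ
    rw [Multiset.cons_le_cons_iff] at hσ
    rw [Multiset.card_cons] at hσc
    have hnr : ∀ a, σ' ≠ Multiset.replicate (m - 1) a := by
      rintro a rfl
      rw [Multiset.sum_cons, Multiset.sum_replicate] at hσ0
      have h3 := hH.exp a
      obtain ⟨l, rfl⟩ : ∃ l, m = l + 1 := ⟨m - 1, by omega⟩
      rw [succ_nsmul'] at h3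
      have hxa : x = a := by
        rw [Nat.add_sub_cancel] at hσ0
        exact add_right_cancel (hσ0.trans h3.symm)
      exact hxρ (hxa ▸ Multiset.mem_of_le hσ (Multiset.mem_replicate.2 ⟨by omega, rfl⟩))
    have hlt : ∀ a, σ'.count a < m - 1 := by
      intro a
      refine lt_of_le_of_ne ((Multiset.count_le_card a σ').trans (by omega)) fun h4 => hnr a ?_
      rw [Multiset.eq_replicate]
      refine ⟨by omega, fun b hb => ?_⟩
      exact (Multiset.count_eq_card.1 (h4.trans (by omega)) b hb).symm
    have hσle : x ::ₘ σ' ≤ τ + ρ := by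
      rw [← Multiset.singleton_add]
      exact add_le_add (Multiset.singleton_le.2 hx) hσ
    have hcard : (τ + ρ - x ::ₘ σ').card = r * (m - 1) := by
      rw [Multiset.card_sub hσle, Multiset.card_add, Multiset.card_cons]; omega
    have hc := hH.inv _ hcard (h _ hσle (by simpa using hσc) hσ0)
    have hxa : ∀ a ∈ ρ, x ≠ a := fun a ha hxa => hxρ (hxa ▸ ha)
    have hle : ρ ≤ τ + ρ - x ::ₘ σ' := by
      rw [Multiset.le_iff_count]
      intro a
      by_cases ha : a ∈ ρ
      · rw [hρc a ha, hc a]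
        rw [← Multiset.one_le_count_iff_mem, Multiset.count_sub, Multiset.count_add, hρc a ha,
          Multiset.count_cons_of_ne (hxa a ha).symm]
        have := hlt a
        omega
      · simp [Multiset.count_eq_zero_of_notMem ha]
    have heq := Multiset.eq_of_le_of_card_le hle (by omega)
    have hτσ : τ = x ::ₘ σ' := by
      have h5 := tsub_add_cancel_of_le hσle
      rw [← heq, add_comm] at h5
      exact (add_right_cancel h5).symm
    obtain ⟨a, ha⟩ : ∃ a, a ∈ σ' := Multiset.card_pos_iff_exists_mem.1 (by omega)
    have haρ := Multiset.mem_of_le hσ ha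
    have h6 : Multiset.replicate m a ≤ τ + ρ := by
      rw [← Multiset.le_count_iff_replicate_le, Multiset.count_add, hρc a haρ]
      have : 1 ≤ τ.count a := Multiset.one_le_count_iff_mem.2
        (hτσ ▸ Multiset.mem_cons_of_mem ha)
      omega
    have h7 := hH.inv _ (by rw [Multiset.card_sub h6]; simp; omega)
      (h _ h6 (by simp) (by rw [Multiset.sum_replicate, hH.exp]))
    have h8 : (τ + ρ - Multiset.replicate m a).count x = 1 := by
      rw [Multiset.count_sub, Multiset.count_add, Multiset.count_eq_zero_of_notMem hxρ, hτσ,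
        Multiset.count_cons_self, Multiset.count_replicate, if_neg (hxa a haρ).symm,
        Multiset.count_eq_zero_of_notMem fun hx' => hxρ (Multiset.mem_of_le hσ hx')]
    have h9 := h7 x (Multiset.one_le_count_iff_mem.1 h8.ge)
    have h10 := hlt a
    have := Multiset.one_le_count_iff_mem.2 ha
    omega
  by_cases h1 : ∃ a, m ≤ τ.count a
  · obtain ⟨a, ha⟩ := h1
    have h2 : τ.count a = τ.card := le_antisymm (Multiset.count_le_card _ _) (by omega)
    refine ⟨a, key a (Multiset.one_le_count_iff_mem.1 (by omega)), ?_⟩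
    rw [Multiset.eq_replicate]
    exact ⟨hτ, fun b hb => (Multiset.count_eq_card.1 h2 b hb).symm⟩
  · push Not at h1
    refine absurd hτ0 (hρno τ ?_ hτ)
    rw [Multiset.le_iff_count]
    intro a
    by_cases ha : a ∈ τ
    · rw [hρc a (key a ha)]; have := h1 a; omega
    · simp [Multiset.count_eq_zero_of_notMem ha]

end

/-- An extremal sequence `S` over an extension `G` of `H` by `K`. -/
structure Frame {G H K : Type*} [AddCommGroup G] [AddCommGroup H] [AddCommGroup K] [DecidableEq G]
    [DecidableEq H] [DecidableEq K] (φ : G →+ H) (ι : K →+ G) (κ : G → K) (m r q r' : ℕ)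
    (S : Multiset G) : Prop where
  base : Good H m r
  fiber : Good K q r'
  two_le : 2 ≤ m
  sec : ∀ g, φ g = 0 → ι (κ g) = g
  card : S.card = r * (m - 1) + r' * (q - 1) * m
  noZS : NoZS (m * q) S

/-- A decomposition of `S` into blocks with sum in the kernel of `φ` and a remainder. -/
structure IsDec {G H : Type*} [AddCommGroup G] [AddCommGroup H] (φ : G →+ H) (m k : ℕ)
    (S : Multiset G) (P : Multiset (Multiset G)) (R : Multiset G) : Prop where
  eq : P.join + R = S
  card : P.card = k
  block : ∀ B ∈ P, B.card = m ∧ φ B.sum = 0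

section

variable {G H K : Type*} [AddCommGroup G] [AddCommGroup H] [AddCommGroup K] [DecidableEq G]
  [DecidableEq H] [DecidableEq K] {φ : G →+ H} {ι : K →+ G} {κ : G → K} {m r q r' : ℕ}
  {S : Multiset G}

omit [DecidableEq G] in
lemma Good.exists_block (hH : Good H m r) (φ : G →+ H) {U : Multiset G}
    (hU : r * (m - 1) < U.card) : ∃ B ≤ U, B.card = m ∧ φ B.sum = 0 := by
  obtain ⟨T, hT, hc, hs⟩ := hH.ext (U.map φ) (by simpa using hU)
  obtain ⟨B, hB, rfl⟩ := exists_le_of_le_map hT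
  exact ⟨B, hB, by simpa using hc, by rw [map_multiset_sum, hs]⟩

lemma Good.exists_isDec (hH : Good H m r) (hm : 1 ≤ m) (φ : G →+ H) (k : ℕ) :
    ∀ {S : Multiset G}, S.card = r * (m - 1) + k * m → ∃ P R, IsDec φ m k S P R := by
  induction k with
  | zero => exact fun {S} _ => ⟨0, S, by simp, rfl, by simp⟩
  | succ k ih =>
    intro S hS
    obtain ⟨B, hB, hBc, hB0⟩ := hH.exists_block φ (U := S) (by rw [hS, add_mul]; omega)
    obtain ⟨P, R, hP⟩ := ih (S := S - B) (by
      rw [Multiset.card_sub hB, hS, hBc, add_mul]; omega)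
    refine ⟨B ::ₘ P, R, ?_, by simp [hP.card], ?_⟩
    · rw [Multiset.join_cons, add_assoc, hP.eq, add_tsub_cancel_of_le hB]
    · intro C hC
      rcases Multiset.mem_cons.1 hC with rfl | hC
      · exact ⟨hBc, hB0⟩
      · exact hP.block C hC

lemma card_join_of_forall {α : Type*} {P : Multiset (Multiset α)} (h : ∀ B ∈ P, B.card = m) :
    P.join.card = P.card * m := by
  rw [Multiset.card_join, Multiset.map_congr rfl h, Multiset.map_const', Multiset.sum_replicate,
    smul_eq_mul]

namespace Frame

lemma noZS_blocks (F : Frame φ ι κ m r q r' S) {P : Multiset (Multiset G)} (hP : P.join ≤ S)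
    (hb : ∀ B ∈ P, B.card = m ∧ φ B.sum = 0) :
    NoZS q (P.map fun B => κ B.sum) := by
  intro T hT hc hs
  obtain ⟨Q, hQ, rfl⟩ := exists_le_of_le_map hT
  obtain ⟨Q', rfl⟩ := Multiset.le_iff_exists_add.1 hQ
  rw [Multiset.card_map] at hc
  refine F.noZS Q.join (le_trans ?_ hP) ?_ ?_
  · rw [Multiset.join_add]; exact Multiset.le_add_right _ _
  · rw [card_join_of_forall fun B hB => (hb B (Multiset.mem_add.2 (Or.inl hB))).1, hc, mul_comm]
  · rw [Multiset.sum_join]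
    have : Q.map Multiset.sum = (Q.map fun B => κ B.sum).map ι := by
      rw [Multiset.map_map]
      exact Multiset.map_congr rfl fun B hB =>
        (F.sec _ (hb B (Multiset.mem_add.2 (Or.inl hB))).2).symm
    rw [this, ← map_multiset_sum, hs, map_zero]

variable {P : Multiset (Multiset G)} {R : Multiset G}

lemma card_rest (F : Frame φ ι κ m r q r' S) (hP : IsDec φ m (r' * (q - 1)) S P R) :
    R.card = r * (m - 1) := by
  have h1 := F.card
  rw [← hP.eq, Multiset.card_add, card_join_of_forall fun B hB => (hP.block B hB).1, hP.card] at h1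
  omega

lemma noZS_rest (F : Frame φ ι κ m r q r' S) (hP : IsDec φ m (r' * (q - 1)) S P R) :
    NoZS m (R.map φ) := by
  intro T hT hc hs
  obtain ⟨B, hB, rfl⟩ := exists_le_of_le_map hT
  have hno := F.noZS_blocks (P := B ::ₘ P) (by
    rw [Multiset.join_cons, ← hP.eq, add_comm]
    exact add_le_add_right hB _) (by
    intro C hC
    rcases Multiset.mem_cons.1 hC with rfl | hC
    · exact ⟨by simpa using hc, by rw [map_multiset_sum, hs]⟩
    · exact hP.block C hC)
  obtain ⟨T, hT, hTc, hTs⟩ := F.fiber.ext ((B ::ₘ P).map fun B => κ B.sum) (by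
    simp [hP.card])
  exact hno T hT hTc hTs

lemma count_rest (F : Frame φ ι κ m r q r' S) (hP : IsDec φ m (r' * (q - 1)) S P R) :
    ∀ a ∈ R.map φ, (R.map φ).count a = m - 1 :=
  F.base.inv _ (by simpa using F.card_rest hP) (F.noZS_rest hP)

omit [DecidableEq H] in
lemma isDec_swap (hP : IsDec φ m (r' * (q - 1)) S P R) {B C : Multiset G} (hB : B ∈ P)
    (hC : C ≤ B + R) (hCc : C.card = m) (hC0 : φ C.sum = 0) :
    IsDec φ m (r' * (q - 1)) S (C ::ₘ P.erase B) (B + R - C) := by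
  refine ⟨?_, ?_, ?_⟩
  · have h1 : C + (B + R - C) = B + R := add_tsub_cancel_of_le hC
    rw [Multiset.join_cons, add_right_comm, h1, add_right_comm, ← Multiset.join_cons,
      Multiset.cons_erase hB, hP.eq]
  · rw [Multiset.card_cons, Multiset.card_erase_add_one hB, hP.card]
  · intro D hD
    rcases Multiset.mem_cons.1 hD with rfl | hD
    · exact ⟨hCc, hC0⟩
    · exact hP.block D (Multiset.mem_of_mem_erase hD)

lemma exists_block_eq (F : Frame φ ι κ m r q r' S) (hP : IsDec φ m (r' * (q - 1)) S P R)
    {B : Multiset G} (hB : B ∈ P) : ∃ a ∈ R.map φ, B.map φ = Multiset.replicate m a := by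
  refine F.base.exists_eq_replicate F.two_le (by simpa using (hP.block B hB).1)
    (by rw [← map_multiset_sum]; exact (hP.block B hB).2) (by simpa using F.card_rest hP) ?_
  intro σ hσ hc hs
  rw [← Multiset.map_add] at hσ ⊢
  obtain ⟨C, hC, rfl⟩ := exists_le_of_le_map hσ
  have := F.noZS_rest (isDec_swap hP hB hC (by simpa using hc) (by rw [map_multiset_sum, hs]))
  obtain ⟨D, hD⟩ := Multiset.le_iff_exists_add.1 hC
  rw [hD, add_tsub_cancel_left] at this
  rwa [hD, Multiset.map_add, add_tsub_cancel_left]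

lemma eq_of_mem_block_of_mem_rest (F : Frame φ ι κ m r q r' S)
    (hP : IsDec φ m (r' * (q - 1)) S P R) {B : Multiset G} (hB : B ∈ P) {x y : G} (hx : x ∈ B)
    (hy : y ∈ R) (hxy : φ x = φ y) : x = y := by
  obtain ⟨B', rfl⟩ := Multiset.exists_cons_of_mem hx
  have hb := hP.block _ hB
  have hC : y ::ₘ B' ≤ x ::ₘ B' + R := by
    rw [← Multiset.singleton_add, add_comm]
    exact add_le_add (Multiset.le_cons_self _ _) (Multiset.singleton_le.2 hy)
  have hC0 : φ (y ::ₘ B').sum = 0 := by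
    rw [Multiset.sum_cons, map_add, ← hxy, ← map_add, ← Multiset.sum_cons]; exact hb.2
  have hsw := isDec_swap hP hB hC (by simpa using hb.1) hC0
  have h1 := F.noZS_blocks (by rw [← hP.eq]; exact Multiset.le_add_right _ _) hP.block
  have h2 := F.noZS_blocks (by rw [← hsw.eq]; exact Multiset.le_add_right _ _) hsw.block
  rw [← Multiset.cons_erase hB, Multiset.map_cons] at h1
  rw [Multiset.map_cons] at h2
  have h3 := F.fiber.uniq _ _ _ (by
    rw [Multiset.card_cons, Multiset.card_map, Multiset.card_erase_add_one hB, hP.card])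
    h1 h2
  have h4 : (x ::ₘ B').sum = (y ::ₘ B').sum := by
    rw [← F.sec _ hb.2, ← F.sec _ hC0, h3]
  simpa using h4

lemma map_mem_rest (F : Frame φ ι κ m r q r' S) (hP : IsDec φ m (r' * (q - 1)) S P R) {x : G}
    (hx : x ∈ S) : φ x ∈ R.map φ := by
  rw [← hP.eq, Multiset.mem_add, Multiset.mem_join] at hx
  rcases hx with ⟨B, hB, hx⟩ | hx
  · obtain ⟨a, ha, h⟩ := F.exists_block_eq hP hB
    have : φ x ∈ B.map φ := Multiset.mem_map_of_mem φ hx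
    rw [h] at this
    rwa [Multiset.eq_of_mem_replicate this]
  · exact Multiset.mem_map_of_mem φ hx

lemma eq_of_mem_block (F : Frame φ ι κ m r q r' S) (hP : IsDec φ m (r' * (q - 1)) S P R)
    {B : Multiset G} (hB : B ∈ P) {x y : G} (hx : x ∈ B) (hy : y ∈ S) (hxy : φ y = φ x) :
    y = x := by
  obtain ⟨z, hz, hzx⟩ := Multiset.mem_map.1 (F.map_mem_rest hP hy)
  have hxz : x = z := F.eq_of_mem_block_of_mem_rest hP hB hx hz (hxy.symm.trans hzx.symm)
  rw [← hP.eq, Multiset.mem_add, Multiset.mem_join] at hy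
  rcases hy with ⟨C, hC, hy⟩ | hy
  · exact (F.eq_of_mem_block_of_mem_rest hP hC hy hz hzx.symm).trans hxz.symm
  · exact (F.eq_of_mem_block_of_mem_rest hP hB hx hy hxy.symm).symm

lemma count_eq (F : Frame φ ι κ m r q r S) (hq : 2 ≤ q)
    (hexp : ∀ x : G, (m * q) • x = 0) : ∀ x ∈ S, S.count x = m * q - 1 := by
  have hm := F.two_le
  have hmq : m * 2 ≤ m * q := Nat.mul_le_mul_left _ hq
  obtain ⟨P, R, hP⟩ := F.base.exists_isDec (by omega) φ (r * (q - 1)) F.card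
  have hc := F.count_rest hP
  have hle := F.noZS.count_le (by omega) hexp
  set A := (R.map φ).toFinset with hA
  have hmem : ∀ a, a ∈ A ↔ a ∈ R.map φ := fun a => Multiset.mem_toFinset
  have hAc : A.card = r := by
    have h1 := Multiset.toFinset_sum_count_eq (R.map φ)
    rw [Finset.sum_congr rfl fun a ha => hc a (Multiset.mem_toFinset.1 ha), Finset.sum_const,
      smul_eq_mul, Multiset.card_map, F.card_rest hP] at h1
    exact Nat.eq_of_mul_eq_mul_right (by omega) h1
  have hfib : ∀ x ∈ S, m - 1 < (S.map φ).count (φ x) → (S.map φ).count (φ x) = S.count x := by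
    intro x hx hlt
    rw [← hP.eq, Multiset.map_add, Multiset.count_add, hc _ (F.map_mem_rest hP hx)] at hlt
    obtain ⟨z, hz, hzx⟩ := Multiset.mem_map.1
      (Multiset.one_le_count_iff_mem.1 (show 1 ≤ (P.join.map φ).count (φ x) by omega))
    obtain ⟨B, hB, hzB⟩ := Multiset.mem_join.1 hz
    have hxz := F.eq_of_mem_block hP hB hzB hx hzx.symm
    rw [Multiset.count_map, Multiset.count_eq_card_filter_eq]
    congr 1
    refine Multiset.filter_congr fun y hy => ⟨fun h => ?_, fun h => by rw [h]⟩
    exact hxz.trans (F.eq_of_mem_block hP hB hzB hy (h.symm.trans hzx.symm)).symm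
  have hub : ∀ a ∈ A, (S.map φ).count a ≤ m * q - 1 := by
    intro a ha
    obtain ⟨x, hx, rfl⟩ := Multiset.mem_map.1 ((hmem a).1 ha)
    have hxS : x ∈ S := by rw [← hP.eq]; exact Multiset.mem_add.2 (Or.inr hx)
    rcases le_or_gt ((S.map φ).count (φ x)) (m - 1) with h | h
    · omega
    · rw [hfib x hxS h]; exact hle x
  have hsum : ∑ a ∈ A, (S.map φ).count a = ∑ a ∈ A, (m * q - 1) := by
    have h1 : (S.map φ).toFinset ⊆ A := by
      intro a ha
      obtain ⟨x, hx, rfl⟩ := Multiset.mem_map.1 (Multiset.mem_toFinset.1 ha)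
      exact (hmem _).2 (F.map_mem_rest hP hx)
    rw [← Finset.sum_subset h1 fun a _ ha => Multiset.count_eq_zero_of_notMem
      (by simpa using ha), Multiset.toFinset_sum_count_eq, Finset.sum_const, hAc, smul_eq_mul,
      Multiset.card_map, F.card]
    obtain ⟨i, rfl⟩ : ∃ i, m = i + 1 := ⟨m - 1, by omega⟩
    obtain ⟨j, rfl⟩ : ∃ j, q = j + 1 := ⟨q - 1, by omega⟩
    have : (i + 1) * (j + 1) - 1 = i * j + i + j := by
      have : (i + 1) * (j + 1) = i * j + i + j + 1 := by ring
      omega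
    rw [this]; simp only [Nat.add_sub_cancel]; ring
  have heq := (Finset.sum_eq_sum_iff_of_le hub).1 hsum
  intro x hx
  have h1 := heq (φ x) ((hmem _).2 (F.map_mem_rest hP hx))
  rw [← hfib x hx (by omega), h1]

end Frame

end

/-! ### Cyclic groups -/

open scoped Pointwise in
lemma card_min_le_of_select {p : ℕ} [Fact p.Prime] (Sel : Multiset (ZMod p × ZMod p) → ZMod p → Prop)
    (hfst : ∀ x Q z, Sel Q z → Sel (x ::ₘ Q) (x.1 + z))
    (hsnd : ∀ x Q z, Sel Q z → Sel (x ::ₘ Q) (x.2 + z)) {Q₀ : Multiset (ZMod p × ZMod p)}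
    {A₀ : Finset (ZMod p)} (hA₀ : A₀.Nonempty) (hSel : ∀ z ∈ A₀, Sel Q₀ z)
    (Q : Multiset (ZMod p × ZMod p)) (hQ : ∀ x ∈ Q, x.1 ≠ x.2) :
    ∃ A : Finset (ZMod p), min p (Q.card + A₀.card) ≤ A.card ∧ ∀ z ∈ A, Sel (Q + Q₀) z := by
  induction Q using Multiset.induction with
  | empty => exact ⟨A₀, by simp, by simpa using hSel⟩
  | cons x Q ih =>
    obtain ⟨A, hA, hs⟩ := ih fun y hy => hQ y (Multiset.mem_cons_of_mem hy)
    have hne : A.Nonempty := by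
      rw [← Finset.card_pos]
      have := Finset.card_pos.2 hA₀
      have := (Fact.out : p.Prime).pos
      omega
    refine ⟨{x.1, x.2} + A, ?_, ?_⟩
    · have h1 := ZMod.cauchy_davenport (Fact.out : p.Prime) (s := {x.1, x.2}) (t := A)
        (by simp) hne
      rw [Finset.card_pair (hQ x (Multiset.mem_cons_self _ _))] at h1
      rw [Multiset.card_cons]
      omega
    · intro z hz
      obtain ⟨y, hy, w, hw, rfl⟩ := Finset.mem_add.1 hz
      rw [Multiset.cons_add]
      rcases Finset.mem_insert.1 hy with rfl | hy
      · exact hfst _ _ _ (hs w hw)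
      · rw [Finset.mem_singleton.1 hy]; exact hsnd _ _ _ (hs w hw)

/-- `z` is a sum of one component of each pair of `Q`. -/
def IsSel {M : Type*} [AddCommMonoid M] (Q : Multiset (M × M)) (z : M) : Prop :=
  ∃ T ≤ Q.map Prod.fst + Q.map Prod.snd, T.card = Q.card ∧ T.sum = z

lemma IsSel.fst {M : Type*} [AddCommMonoid M] (x : M × M) (Q : Multiset (M × M)) (z : M)
    (h : IsSel Q z) : IsSel (x ::ₘ Q) (x.1 + z) := by
  obtain ⟨T, hT, hc, rfl⟩ := h
  refine ⟨x.1 ::ₘ T, ?_, by simp [hc], by simp⟩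
  rw [Multiset.map_cons, Multiset.map_cons, Multiset.cons_add, Multiset.add_cons]
  exact Multiset.cons_le_cons _ (hT.trans (Multiset.le_cons_self _ _))

lemma IsSel.snd {M : Type*} [AddCommMonoid M] (x : M × M) (Q : Multiset (M × M)) (z : M)
    (h : IsSel Q z) : IsSel (x ::ₘ Q) (x.2 + z) := by
  obtain ⟨T, hT, hc, rfl⟩ := h
  refine ⟨x.2 ::ₘ T, ?_, by simp [hc], by simp⟩
  rw [Multiset.map_cons, Multiset.map_cons, Multiset.add_cons, Multiset.cons_add]
  exact Multiset.cons_le_cons _ (hT.trans (Multiset.le_cons_self _ _))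

lemma isSel_zero {M : Type*} [AddCommMonoid M] : IsSel (0 : Multiset (M × M)) 0 :=
  ⟨0, le_rfl, rfl, rfl⟩

/-- A sequence of length `2k` with multiplicities at most `k` splits into pairs of distinct
elements. -/
lemma exists_pairs {α : Type*} [DecidableEq α] (k : ℕ) : ∀ S : Multiset α, S.card = 2 * k →
    (∀ x, S.count x ≤ k) → ∃ P : Multiset (α × α), P.card = k ∧ (∀ x ∈ P, x.1 ≠ x.2) ∧
      P.map Prod.fst + P.map Prod.snd = S := by
  induction k with
  | zero => exact fun S hS _ => ⟨0, rfl, by simp, by simpa using (Multiset.card_eq_zero.1 hS).symm⟩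
  | succ k ih =>
    intro S hS hle
    obtain ⟨x, hx, hxmax⟩ := Finset.exists_max_image S.toFinset (fun x => S.count x) (by
      rw [Multiset.toFinset_nonempty]; rintro rfl; simp at hS)
    obtain ⟨y, hy, hymax⟩ := Finset.exists_max_image (S.toFinset.erase x) (fun x => S.count x) (by
      by_contra hne
      rw [Finset.not_nonempty_iff_eq_empty] at hne
      have h1 := Multiset.toFinset_sum_count_eq S
      rw [← Finset.add_sum_erase _ _ hx, hne, Finset.sum_empty] at h1
      have := hle x
      omega)
    rw [Finset.mem_erase, Multiset.mem_toFinset] at hy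
    rw [Multiset.mem_toFinset] at hx
    obtain ⟨S₁, rfl⟩ := Multiset.exists_cons_of_mem hx
    obtain ⟨S₂, rfl⟩ := Multiset.exists_cons_of_mem ((Multiset.mem_cons.1 hy.2).resolve_left hy.1)
    simp only [Multiset.card_cons] at hS
    obtain ⟨P, hP, hne, hsum⟩ := ih S₂ (by omega) (by
      intro z
      have h1 := hle z
      by_cases hzx : z = x
      · subst hzx; rw [Multiset.count_cons_self, Multiset.count_cons] at h1; omega
      by_cases hzy : z = y
      · subst hzy; rw [Multiset.count_cons, Multiset.count_cons_self] at h1; omega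
      by_contra hz
      have hzm : z ∈ S₂ := Multiset.one_le_count_iff_mem.1 (by omega)
      have h2 := hymax z (Finset.mem_erase.2 ⟨hzx, by simp [hzm]⟩)
      have h3 := hxmax y (by simp)
      simp only [Multiset.count_cons_self, Multiset.count_cons_of_ne hzx,
        Multiset.count_cons_of_ne hzy, Multiset.count_cons_of_ne hy.1,
        Multiset.count_cons_of_ne hy.1.symm] at h2 h3
      have h4 : Multiset.replicate (S₂.count x) x + Multiset.replicate (S₂.count y) y +
          Multiset.replicate (S₂.count z) z ≤ S₂ := by
        rw [Multiset.le_iff_count]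
        intro w
        simp only [Multiset.count_add, Multiset.count_replicate]
        by_cases e1 : x = w
        · subst e1; simp [hy.1, hzx]
        by_cases e2 : y = w
        · subst e2; simp [e1, hzy]
        by_cases e3 : z = w
        · subst e3; simp [e1, e2]
        simp [e1, e2, e3]
      have h5 := Multiset.card_le_card h4
      simp only [Multiset.card_add, Multiset.card_replicate] at h5
      omega)
    refine ⟨(x, y) ::ₘ P, by simp [hP], ?_, ?_⟩
    · intro z hz
      rcases Multiset.mem_cons.1 hz with rfl | hz
      · exact hy.1.symm
      · exact hne z hz
    · rw [Multiset.map_cons, Multiset.map_cons, Multiset.cons_add, Multiset.add_cons, hsum]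

lemma zmod_three_eq_or : ∀ d e : ZMod 3, d ≠ 0 → e ≠ 0 → e = d ∨ e = -d := by decide

section Prime

variable {p : ℕ} [Fact p.Prime]

/-- Two pairs with essentially different differences allow too many sums. -/
lemma sub_eq_or_of_noZS {P : Multiset (ZMod p × ZMod p)} (hP : P.card = p - 1)
    (hne : ∀ x ∈ P, x.1 ≠ x.2) (hno : NoZS p (P.map Prod.fst + P.map Prod.snd)) :
    ∀ x ∈ P, ∀ y ∈ P, y.2 - y.1 = x.2 - x.1 ∨ y.2 - y.1 = -(x.2 - x.1) := by
  intro x hx y hy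
  have hp := (Fact.out : p.Prime)
  by_contra! hcon
  have h3 : p ≠ 2 := by
    rintro rfl
    obtain ⟨z, rfl⟩ := Multiset.card_eq_one.1 hP
    rw [Multiset.mem_singleton] at hx hy
    exact hcon.1 (by rw [hx, hy])
  have h4 : p ≠ 3 := by
    rintro rfl
    rcases zmod_three_eq_or _ _ (sub_ne_zero.2 (hne x hx).symm) (sub_ne_zero.2 (hne y hy).symm) with h | h
    · exact hcon.1 h
    · exact hcon.2 h
  have h5 := hp.two_le
  have hxy : x ≠ y := by rintro rfl; exact hcon.1 rfl
  obtain ⟨P₁, rfl⟩ := Multiset.exists_cons_of_mem hx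
  obtain ⟨P₂, rfl⟩ := Multiset.exists_cons_of_mem ((Multiset.mem_cons.1 hy).resolve_left hxy.symm)
  simp only [Multiset.card_cons] at hP
  obtain ⟨z, hz⟩ : ∃ z, z ∈ P₂ := Multiset.card_pos_iff_exists_mem.1 (by omega)
  obtain ⟨Q, rfl⟩ := Multiset.exists_cons_of_mem hz
  rw [Multiset.card_cons] at hP
  have hx1 := hne x (by simp)
  have hy1 := hne y (by simp)
  have hcard : ({x.1 + (y.1 + 0), x.1 + (y.2 + 0), x.2 + (y.1 + 0), x.2 + (y.2 + 0)} :
      Finset (ZMod p)).card = 4 := by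
    rw [Finset.card_insert_of_notMem, Finset.card_insert_of_notMem, Finset.card_pair]
    · simpa using hy1
    · simp only [Finset.mem_insert, Finset.mem_singleton, not_or, add_zero]
      exact ⟨fun h => hcon.1 (by linear_combination h), fun h => hx1 (add_right_cancel h)⟩
    · simp only [Finset.mem_insert, Finset.mem_singleton, not_or, add_zero]
      exact ⟨fun h => hy1 (add_left_cancel h), fun h => hx1 (add_right_cancel h),
        fun h => hcon.2 (by linear_combination -h)⟩
  obtain ⟨A, hA, hsel⟩ := card_min_le_of_select IsSel IsSel.fst IsSel.snd (Q₀ := {x, y})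
    (A₀ := {x.1 + (y.1 + 0), x.1 + (y.2 + 0), x.2 + (y.1 + 0), x.2 + (y.2 + 0)}) (by simp) (by
      intro w hw
      simp only [Finset.mem_insert, Finset.mem_singleton] at hw
      have h1 := IsSel.fst y 0 0 isSel_zero
      have h2 := IsSel.snd y 0 0 isSel_zero
      rcases hw with rfl | rfl | rfl | rfl
      exacts [h1.fst x, h2.fst x, h1.snd x, h2.snd x]) Q
      fun w hw => hne w (by simp [hw])
  rw [hcard] at hA
  have hA2 : A = Finset.univ := by
    rw [← Finset.card_eq_iff_eq_univ, ZMod.card]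
    refine le_antisymm (by simpa [ZMod.card] using Finset.card_le_univ A) ?_
    omega
  obtain ⟨T, hT, hTc, hTs⟩ := hsel (-(z.1 + z.2)) (by rw [hA2]; exact Finset.mem_univ _)
  refine hno (z.1 ::ₘ z.2 ::ₘ T) ?_ ?_ ?_
  · have : (x ::ₘ y ::ₘ z ::ₘ Q).map Prod.fst + (x ::ₘ y ::ₘ z ::ₘ Q).map Prod.snd =
      z.1 ::ₘ z.2 ::ₘ ((Q + {x, y}).map Prod.fst + (Q + {x, y}).map Prod.snd) := by
      simp only [Multiset.map_cons, Multiset.map_add, Multiset.insert_eq_cons,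
        Multiset.map_singleton]
      simp only [← Multiset.singleton_add]
      abel
    rw [this]
    exact Multiset.cons_le_cons _ (Multiset.cons_le_cons _ hT)
  · have h6 : (Q + {x, y}).card = Q.card + 2 := by simp
    rw [Multiset.card_cons, Multiset.card_cons, hTc, h6]; omega
  · rw [Multiset.sum_cons, Multiset.sum_cons, hTs]; ring

lemma exists_oriented {M : Type*} [AddCommGroup M] [DecidableEq M] (δ : M) (P : Multiset (M × M))
    (h : ∀ x ∈ P, x.2 - x.1 = δ ∨ x.2 - x.1 = -δ) :
    ∃ B : Multiset M, B.card = P.card ∧ B + B.map (· + δ) = P.map Prod.fst + P.map Prod.snd := by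
  induction P using Multiset.induction with
  | empty => exact ⟨0, rfl, rfl⟩
  | cons x P ih =>
    obtain ⟨B, hB, hs⟩ := ih fun y hy => h y (Multiset.mem_cons_of_mem hy)
    rcases h x (Multiset.mem_cons_self _ _) with hx | hx
    · refine ⟨x.1 ::ₘ B, by simp [hB], ?_⟩
      have : x.1 + δ = x.2 := by rw [← hx]; abel
      simp only [Multiset.map_cons, Multiset.cons_add, Multiset.add_cons, hs, this]
    · refine ⟨x.2 ::ₘ B, by simp [hB], ?_⟩
      have : x.2 + δ = x.1 := by
        have : δ = x.1 - x.2 := by rw [← neg_sub, hx, neg_neg]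
        rw [this]; abel
      simp only [Multiset.map_cons, Multiset.cons_add, Multiset.add_cons, hs, this]
      rw [Multiset.cons_swap]

lemma count_eq_of_noZS_cyclic {S : Multiset (ZMod p)} (hc : S.card = 2 * (p - 1))
    (hS : NoZS p S) : ∀ x ∈ S, S.count x = p - 1 := by
  have hp := (Fact.out : p.Prime).two_le
  obtain ⟨P, hP, hne, rfl⟩ := exists_pairs (p - 1) S hc
    (hS.count_le (by omega) fun x => by simp)
  obtain ⟨x₀, hx₀⟩ : ∃ x, x ∈ P := Multiset.card_pos_iff_exists_mem.1 (by omega)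
  obtain ⟨δ, hδ⟩ : ∃ δ, δ = x₀.2 - x₀.1 := ⟨_, rfl⟩
  have hδ0 : δ ≠ 0 := by rw [hδ]; exact sub_ne_zero.2 (hne x₀ hx₀).symm
  obtain ⟨B, hB, hBs⟩ := exists_oriented δ P (by
    rw [hδ]; exact sub_eq_or_of_noZS hP hne hS x₀ hx₀)
  rw [← hBs] at hS ⊢
  have key : ∀ b ∈ B, b = -B.sum := by
    intro b hb
    obtain ⟨Q, rfl⟩ := Multiset.exists_cons_of_mem hb
    rw [Multiset.card_cons] at hB
    set k : ZMod p := (-(b + (b + δ)) - Q.sum) * δ⁻¹ with hk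
    have hkδ : k * δ = -(b + (b + δ)) - Q.sum := by
      rw [hk, mul_assoc, inv_mul_cancel₀ hδ0, mul_one]
    have hkp : k.val = p - 1 := by
      by_contra hne2
      have hlt := ZMod.val_lt k
      obtain ⟨Q₂, hQ₂, hQ₂c⟩ := exists_le_card_eq (S := Q) (k := k.val) (by omega)
      obtain ⟨Q₁, rfl⟩ := Multiset.le_iff_exists_add.1 hQ₂
      refine hS (b ::ₘ (b + δ) ::ₘ (Q₁ + Q₂.map (· + δ))) ?_ ?_ ?_
      · rw [Multiset.map_cons, Multiset.cons_add, Multiset.add_cons]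
        refine Multiset.cons_le_cons _ (Multiset.cons_le_cons _ (add_le_add ?_ ?_))
        · exact Multiset.le_add_left _ _
        · exact Multiset.map_le_map hQ₂
      · simp only [Multiset.card_cons, Multiset.card_add, Multiset.card_map] at hB ⊢
        omega
      · have h2 : (Q₂.map (· + δ)).sum = Q₂.sum + k * δ := by
          rw [Multiset.sum_map_add, Multiset.map_id', Multiset.map_const', Multiset.sum_replicate,
            hQ₂c, nsmul_eq_mul, ZMod.natCast_zmod_val]
        rw [Multiset.sum_cons, Multiset.sum_cons, Multiset.sum_add, h2, hkδ, Multiset.sum_add]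
        ring
    have hk1 : k = -1 := by
      rw [← ZMod.natCast_zmod_val k, hkp, Nat.cast_sub (by omega)]; simp
    rw [hk1] at hkδ
    rw [Multiset.sum_cons]
    linear_combination hkδ
  have hBr : B = Multiset.replicate (p - 1) (-B.sum) :=
    Multiset.eq_replicate.2 ⟨hB.trans hP, key⟩
  generalize -B.sum = b at hBr
  subst hBr
  intro x hx
  have h1 : b + δ ≠ b := by simpa using hδ0
  rw [Multiset.map_replicate, Multiset.mem_add, Multiset.mem_replicate, Multiset.mem_replicate] at hx
  rw [Multiset.map_replicate, Multiset.count_add, Multiset.count_replicate,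
    Multiset.count_replicate]
  rcases hx with ⟨_, rfl⟩ | ⟨_, rfl⟩
  · simp [hδ0]
  · simp [hδ0]

end Prime

/-! ### The inverse theorems for `C_n` and `C_m ⊕ C_m` -/

lemma natCast_mul_natCast_self (a b : ℕ) : (a : ZMod (a * b)) * (b : ZMod (a * b)) = 0 := by
  rw [← Nat.cast_mul, ZMod.natCast_self]

/-- Multiplication by `a` as a map `ℤ/b → ℤ/ab`. -/
def mulHom (a b : ℕ) : ZMod b →+ ZMod (a * b) :=
  ZMod.lift b ⟨(Int.castAddHom (ZMod (a * b))).comp (AddMonoidHom.mulLeft (a : ℤ)), by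
    simpa using natCast_mul_natCast_self a b⟩

lemma mulHom_natCast (a b k : ℕ) : mulHom a b k = ((a * k : ℕ) : ZMod (a * b)) := by
  rw [mulHom, ← Int.cast_natCast (R := ZMod b), ZMod.lift_coe]
  simp

/-- Reduction modulo `a`. -/
def redHom (a b : ℕ) : ZMod (a * b) →+ ZMod a :=
  (ZMod.castHom (dvd_mul_right a b) (ZMod a)).toAddMonoidHom

lemma redHom_natCast (a b k : ℕ) : redHom a b k = k :=
  map_natCast (ZMod.castHom (dvd_mul_right a b) (ZMod a)) k

/-- Division by `a`. -/
def divMap (a b : ℕ) (g : ZMod (a * b)) : ZMod b := ((g.val / a : ℕ) : ZMod b)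

lemma mulHom_divMap {a b : ℕ} (ha : 1 ≤ a) (hb : 1 ≤ b) {g : ZMod (a * b)}
    (hg : redHom a b g = 0) : mulHom a b (divMap a b g) = g := by
  have : NeZero (a * b) := ⟨(Nat.mul_pos ha hb).ne'⟩
  rw [← ZMod.natCast_zmod_val g, redHom_natCast, ZMod.natCast_eq_zero_iff] at hg
  rw [divMap, mulHom_natCast, Nat.mul_div_cancel' hg, ZMod.natCast_zmod_val]

lemma two_mul_sub_add (r p q : ℕ) (hp : 1 ≤ p) (hq : 1 ≤ q) :
    r * (p * q - 1) = r * (p - 1) + r * (q - 1) * p := by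
  obtain ⟨i, rfl⟩ : ∃ i, p = i + 1 := ⟨p - 1, by omega⟩
  obtain ⟨j, rfl⟩ : ∃ j, q = j + 1 := ⟨q - 1, by omega⟩
  have : (i + 1) * (j + 1) - 1 = i * j + i + j := by
    have : (i + 1) * (j + 1) = i * j + i + j + 1 := by ring
    omega
  rw [this]; simp only [Nat.add_sub_cancel]; ring

lemma good_cyclic_of_inv {n : ℕ} (hn : 1 ≤ n)
    (hinv : ∀ S : Multiset (ZMod n), S.card = 2 * (n - 1) → NoZS n S → ∀ x ∈ S, S.count x = n - 1) :
    Good (ZMod n) n 2 := by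
  have : NeZero n := ⟨by omega⟩
  refine Good.of_inv hn (by norm_num) (fun x => by simp) ?_ ?_ hinv
  · rintro rfl; infer_instance
  · rintro rfl; simp

lemma good_prod_of_inv {n : ℕ} (hn : 1 ≤ n)
    (hinv : ∀ S : Multiset (ZMod n × ZMod n), S.card = 4 * (n - 1) → NoZS n S →
      ∀ x ∈ S, S.count x = n - 1) :
    Good (ZMod n × ZMod n) n 4 := by
  have : NeZero n := ⟨by omega⟩
  refine Good.of_inv hn (by norm_num) nsmul_eq_zero_prod ?_ ?_ hinv
  · rintro rfl; infer_instance
  · rintro rfl; simp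

lemma good_cyclic (n : ℕ) (hn : 1 ≤ n) : Good (ZMod n) n 2 := by
  induction n using Nat.strong_induction_on with
  | _ n ih =>
    rcases hn.eq_or_lt with rfl | h2
    · exact good_cyclic_of_inv le_rfl fun S hS _ x hx => by simp_all
    have hp := Nat.minFac_prime (n := n) (by omega)
    obtain ⟨q, hq⟩ := Nat.minFac_dvd n
    obtain ⟨p, hpn⟩ : ∃ p, p = n.minFac := ⟨_, rfl⟩
    rw [← hpn] at hp hq
    clear hpn
    subst hq
    have : Fact p.Prime := ⟨hp⟩
    have h2p := hp.two_le
    have hbase : Good (ZMod p) p 2 :=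
      good_cyclic_of_inv (by omega) fun S hc hS => count_eq_of_noZS_cyclic hc hS
    have hq0 : 1 ≤ q := Nat.pos_of_ne_zero (by rintro rfl; simp at hn)
    rcases hq0.eq_or_lt with rfl | hq2
    · rwa [mul_one]
    refine good_cyclic_of_inv hn fun S hc hS => ?_
    have F : Frame (redHom p q) (mulHom p q) (divMap p q) p 2 q 2 S :=
      { base := hbase
        fiber := ih q (by nlinarith) hq0
        two_le := h2p
        sec := fun g hg => mulHom_divMap (by omega) hq0 hg
        card := by rw [hc, two_mul_sub_add _ _ _ (by omega) hq0]
        noZS := hS }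
    exact F.count_eq hq2 fun x => by rw [nsmul_eq_mul, ZMod.natCast_self, zero_mul]

lemma good_prod (n : ℕ) (hn : 1 ≤ n) (h7 : ∀ p : ℕ, p.Prime → p ∣ n → p ≤ 7) :
    Good (ZMod n × ZMod n) n 4 := by
  induction n using Nat.strong_induction_on with
  | _ n ih =>
    rcases hn.eq_or_lt with rfl | h2
    · exact good_prod_of_inv le_rfl fun S hS _ x hx => by simp_all
    have hp := Nat.minFac_prime (n := n) (by omega)
    obtain ⟨q, hq⟩ := Nat.minFac_dvd n
    obtain ⟨p, hpn⟩ : ∃ p, p = n.minFac := ⟨_, rfl⟩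
    rw [← hpn] at hp hq
    clear hpn
    subst hq
    have : Fact p.Prime := ⟨hp⟩
    have h2p := hp.two_le
    have hbase : Good (ZMod p × ZMod p) p 4 :=
      good_prod_of_inv (by omega) fun S hc hS =>
        count_eq_of_noZS_prime (h7 p hp (dvd_mul_right _ _)) hc hS
    have hq0 : 1 ≤ q := Nat.pos_of_ne_zero (by rintro rfl; simp at hn)
    rcases hq0.eq_or_lt with rfl | hq2
    · rwa [mul_one]
    refine good_prod_of_inv hn fun S hc hS => ?_
    have F : Frame ((redHom p q).prodMap (redHom p q)) ((mulHom p q).prodMap (mulHom p q))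
        (Prod.map (divMap p q) (divMap p q)) p 4 q 4 S :=
      { base := hbase
        fiber := ih q (by nlinarith) hq0 fun l hl hlq => h7 l hl (dvd_mul_of_dvd_right hlq _)
        two_le := h2p
        sec := fun g hg => by
          rw [Prod.ext_iff] at hg
          exact Prod.ext (mulHom_divMap (by omega) hq0 hg.1) (mulHom_divMap (by omega) hq0 hg.2)
        card := by rw [hc, two_mul_sub_add _ _ _ (by omega) hq0]
        noZS := hS }
    exact F.count_eq hq2 nsmul_eq_zero_prod

/-! ### A lemma on floor functions -/

lemma div_jump {m r k k' : ℕ} (hm : 0 < m) (hk : 1 ≤ k) (h1 : (k - 1) * r / m < k * r / m)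
    (hk' : k < k') (h2 : (k' - 1) * r / m < k' * r / m) : m < (k' - k + 1) * r := by
  obtain ⟨i, rfl⟩ : ∃ i, k = i + 1 := ⟨k - 1, by omega⟩
  obtain ⟨j, rfl⟩ : ∃ j, k' = i + j + 2 := ⟨k' - i - 2, by omega⟩
  have h3 : (i + 1) * r / m ≤ (i + j + 1) * r / m :=
    Nat.div_le_div_right (Nat.mul_le_mul_right _ (by omega))
  have h4 : i * r / m + 2 ≤ (i + j + 2) * r / m := by
    simp only [Nat.add_sub_cancel] at h1
    rw [show i + j + 2 - 1 = i + j + 1 by omega] at h2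
    omega
  rw [Nat.le_div_iff_mul_le hm] at h4
  have h5 := Nat.lt_div_mul_add (a := i * r) hm
  rw [show i + j + 2 - (i + 1) + 1 = j + 2 by omega]
  nlinarith

/-- The first `k` with `s * m < k * X`. -/
lemma exists_first {m X s : ℕ} (hm : 0 < m) (h2 : 2 ≤ X) (hXm : X < m) (hs : s < X)
    (hX0 : ∀ k, 1 ≤ k → k < m → k * X % m ≠ 0) :
    ∃ k, 1 ≤ k ∧ k ≤ m ∧ (k - 1) * X ≤ s * m ∧ s * m < k * X ∧
      (k - 1) * X / m ≤ s ∧ (1 ≤ s → (k - 1) * X / m < s) ∧ (k < m → s ≤ k * X / m) := by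
  refine ⟨s * m / X + 1, Nat.le_add_left _ _, ?_, ?_, ?_, ?_, ?_, ?_⟩
  · have : s * m / X < m := by
      rw [Nat.div_lt_iff_lt_mul (by omega), mul_comm]
      exact Nat.mul_lt_mul_of_pos_left hs hm
    omega
  · rw [Nat.add_sub_cancel]; exact Nat.div_mul_le_self _ _
  · have := Nat.lt_div_mul_add (a := s * m) (b := X) (by omega)
    rw [add_mul, one_mul]; exact this
  · rw [Nat.add_sub_cancel]
    exact Nat.div_le_of_le_mul (by rw [mul_comm m]; exact Nat.div_mul_le_self _ _)
  · intro h1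
    rw [Nat.add_sub_cancel, Nat.div_lt_iff_lt_mul hm]
    refine lt_of_le_of_ne (Nat.div_mul_le_self _ _) fun h => ?_
    have hpos : 1 ≤ s * m / X := by
      rw [Nat.le_div_iff_mul_le (by omega)]; nlinarith
    refine hX0 (s * m / X) hpos ?_ (by rw [h]; simp)
    rw [Nat.div_lt_iff_lt_mul (by omega), mul_comm]
    exact Nat.mul_lt_mul_of_pos_left hs hm
  · intro _
    rw [Nat.le_div_iff_mul_le hm]
    have := Nat.lt_div_mul_add (a := s * m) (b := X) (by omega)
    rw [add_mul, one_mul]; exact this.le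

lemma floor_contradiction {m V W r : ℕ} (hr : r + 1 = V + W) (hWV : W ≤ V) (hW : 2 ≤ W)
    (hrm : 2 * r < m) (hV : ∀ k, 1 ≤ k → k < m → k * V % m ≠ 0)
    (hW0 : ∀ k, 1 ≤ k → k < m → k * W % m ≠ 0)
    (hF : ∀ k, k < m → k * V / m + k * W / m = k * r / m) : False := by
  have hm : 0 < m := by omega
  have hV0 : 0 < V := by omega
  have step : ∀ k, 1 ≤ k → k * r / m ≤ (k - 1) * r / m + 1 := by
    intro k hk
    obtain ⟨i, rfl⟩ : ∃ i, k = i + 1 := ⟨k - 1, by omega⟩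
    have h5 := Nat.lt_div_mul_add (a := i * r) hm
    rw [Nat.add_sub_cancel, ← Nat.lt_add_one_iff, Nat.div_lt_iff_lt_mul hm]
    nlinarith
  have mono : ∀ X k k', k ≤ k' → k * X / m ≤ k' * X / m := fun X k k' h =>
    Nat.div_le_div_right (Nat.mul_le_mul_right _ h)
  obtain ⟨k₀, h01, h0m, h0a, h0b, h0c, h0d, h0e⟩ := exists_first (X := W) (s := 1) hm hW (by omega) (by omega) hW0
  have hk₀ : k₀ < m := by
    by_contra h
    have : k₀ = m := by omega
    rw [this] at h0a
    nlinarith [Nat.sub_add_cancel hm]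
  have hk₀2 : 2 ≤ k₀ := by
    by_contra h
    have : k₀ = 1 := by omega
    rw [this] at h0b; omega
  have hh0 := h0d le_rfl
  have hh1 := h0e hk₀
  have F0 := hF k₀ hk₀
  have F0' := hF (k₀ - 1) (by omega)
  have s0 := step k₀ h01
  have m0 := mono V (k₀ - 1) k₀ (by omega)
  have jump0 : (k₀ - 1) * r / m < k₀ * r / m := by omega
  obtain ⟨t, ht⟩ : ∃ t, t = k₀ * V / m := ⟨_, rfl⟩
  have ht' : (k₀ - 1) * V / m = t := by omega
  have ht1 : 1 ≤ t := by
    have : k₀ * W / m ≤ k₀ * V / m := Nat.div_le_div_right (Nat.mul_le_mul_left _ hWV)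
    omega
  have htV : t + 2 ≤ V := by
    by_contra h
    have h1 : t * m ≤ (k₀ - 1) * V := (Nat.le_div_iff_mul_le hm).1 ht'.ge
    obtain ⟨i, hi⟩ : ∃ i, k₀ = i + 1 := ⟨k₀ - 1, by omega⟩
    obtain ⟨j, hj⟩ : ∃ j, m = i + j := ⟨m - i, by omega⟩
    rw [hi, Nat.add_sub_cancel] at h1 h0a hh0
    rw [Nat.div_lt_iff_lt_mul hm] at hh0
    have h2 : (V - 1) * m ≤ t * m := Nat.mul_le_mul_right _ (by omega)
    obtain ⟨v, hv⟩ : ∃ v, V = v + 1 := ⟨V - 1, by omega⟩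
    rw [hv] at h2 h1
    rw [Nat.add_sub_cancel] at h2
    have h3 : j * V ≤ m := by rw [hv]; nlinarith
    nlinarith
  obtain ⟨k₁, h11, h1m, h1a, h1b, h1c, h1d, h1e⟩ := exists_first (X := V) (s := t) hm (by omega) (by omega) (by omega) hV
  obtain ⟨k₂, h21, h2m, h2a, h2b, h2c, h2d, h2e⟩ :=
    exists_first (X := V) (s := t + 1) hm (by omega) (by omega) (by omega) hV
  obtain ⟨g, hg1, hgm, hga, hgb, hgc, hgd, hge⟩ := exists_first (X := V) (s := 1) hm (by omega) (by omega) (by omega) hV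
  have hk₁ : k₁ ≤ k₀ - 1 := by
    by_contra h
    have := mono V (k₀ - 1) (k₁ - 1) (by omega)
    have := h1d ht1
    omega
  have hk₂ : k₀ < k₂ := by
    by_contra h
    have : (t + 1) * m < k₀ * V := lt_of_lt_of_le h2b (Nat.mul_le_mul_right _ (by omega))
    have := (Nat.le_div_iff_mul_le hm).2 this.le
    omega
  have hk₂m : k₂ < m := by
    by_contra h
    have : k₂ = m := by omega
    rw [this] at h2a
    have h3 : (t + 1 + 1) * m ≤ V * m := Nat.mul_le_mul_right _ (by omega)
    obtain ⟨i, hi⟩ : ∃ i, m = i + 1 := ⟨m - 1, by omega⟩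
    rw [hi] at h2a h3
    rw [Nat.add_sub_cancel] at h2a
    have h4 : (t + 1 + 1) * (i + 1) = (t + 1) * (i + 1) + (i + 1) := by ring
    have h5 : V * (i + 1) = i * V + V := by ring
    have : V < i + 1 := by omega
    linarith
  have hgk : g ≤ k₀ - 1 := by
    by_contra h
    have := mono V (k₀ - 1) (g - 1) (by omega)
    have := hgd le_rfl
    omega
  have F1 := hF k₁ (by omega)
  have F1' := hF (k₁ - 1) (by omega)
  have F2 := hF k₂ hk₂m
  have F2' := hF (k₂ - 1) (by omega)
  have Fg := hF g (by omega)
  have Fg' := hF (g - 1) (by omega)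
  have w1 := mono W (k₁ - 1) k₁ (by omega)
  have w2 := mono W (k₂ - 1) k₂ (by omega)
  have wg := mono W (g - 1) (k₀ - 1) (by omega)
  have wg' := mono W g (k₀ - 1) (by omega)
  have jump1 : (k₁ - 1) * r / m < k₁ * r / m := by
    have := h1d ht1; have := h1e (by omega); omega
  have jump2 : (k₂ - 1) * r / m < k₂ * r / m := by
    have := h2d (by omega); have := h2e (by omega); omega
  have d1 := div_jump hm h11 jump1 (by omega) jump0
  have d2 := div_jump hm h01 jump0 hk₂ jump2
  have hgr : (g - 1) * r < m := by
    have h1 := hgd le_rfl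
    have : (g - 1) * r / m < 1 := by omega
    rwa [Nat.div_lt_iff_lt_mul hm, one_mul] at this
  have hgr' : m ≤ g * r := by
    have h1 := hge (by omega)
    have : 1 ≤ g * r / m := Fg ▸ h1.trans (Nat.le_add_right _ _)
    rwa [Nat.le_div_iff_mul_le hm, one_mul] at this
  have e1 : g - 1 < k₀ - k₁ + 1 := lt_of_mul_lt_mul_right (hgr.trans d1) (Nat.zero_le r)
  have e2 : g - 1 < k₂ - k₀ + 1 := lt_of_mul_lt_mul_right (hgr.trans d2) (Nat.zero_le r)
  have e3 : 2 < g := lt_of_mul_lt_mul_right (lt_of_lt_of_le hrm hgr') (Nat.zero_le r)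
  have e4 : k₂ - 1 - k₁ < g := by
    refine lt_of_mul_lt_mul_right (a := V) ?_ (Nat.zero_le V)
    rw [Nat.sub_mul]
    rw [add_mul] at h2a
    omega
  omega

lemma floor_sum {m U V W : ℕ} (hsum : U + V + W = m + 1) (hW : 2 ≤ W) (hWV : W ≤ V) (hVU : V ≤ U)
    (hU0 : ∀ k, 1 ≤ k → k < m → k * U % m ≠ 0) (hV0 : ∀ k, 1 ≤ k → k < m → k * V % m ≠ 0)
    (hW0 : ∀ k, 1 ≤ k → k < m → k * W % m ≠ 0)
    (hmod : ∀ k, 1 ≤ k → k < m → k * U % m + k * V % m + k * W % m = m + k) : False := by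
  have hm : 0 < m := by omega
  have hfl : ∀ k, 1 ≤ k → k < m → k * U / m + k * V / m + k * W / m + 1 = k := by
    intro k hk hkm
    have h1 := hmod k hk hkm
    have h2 := Nat.div_add_mod (k * U) m
    have h3 := Nat.div_add_mod (k * V) m
    have h4 := Nat.div_add_mod (k * W) m
    have h5 : k * U + k * V + k * W = k * m + k := by rw [← mul_add, ← mul_add, hsum]; ring
    refine Nat.eq_of_mul_eq_mul_left hm ?_
    linarith
  have h2 := hfl 2 (by omega) (by omega)
  have hU2 : m < 2 * U := by
    refine lt_of_le_of_ne ?_ fun h => hU0 2 (by omega) (by omega) (by rw [← h]; simp)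
    by_contra h
    rw [Nat.div_eq_of_lt (by omega), Nat.div_eq_of_lt (by omega), Nat.div_eq_of_lt (by omega)] at h2
    omega
  refine floor_contradiction (m := m) (V := V) (W := W) (r := V + W - 1) (by omega) hWV hW
    (by omega) hV0 hW0 ?_
  intro k hkm
  rcases Nat.eq_zero_or_pos k with rfl | hk
  · simp
  have h3 := hfl k hk hkm
  have h4 := hU0 k hk hkm
  have h5 := Nat.div_add_mod (k * U) m
  have h6 := Nat.mod_lt (k * U) hm
  have h7 : k * U + k * (V + W - 1) = m * k := by
    rw [← mul_add, mul_comm m]; congr 1; omega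
  generalize k * U / m = A at h3 h5
  generalize k * V / m = B at h3 ⊢
  generalize k * W / m = C at h3 ⊢
  refine (Nat.div_eq_of_lt_le ?_ ?_).symm
  · have h9 : m * k = m * A + (B + C) * m + m := by
      rw [← h3]; ring
    omega
  · have h9 : m * k = m * A + (B + C + 1) * m := by
      rw [← h3]; ring
    omega

/-- The three-term form: `k < ku + kv < m + k` modulo `m` for all `k` forces a degenerate pair. -/
lemma eq_one_or_add_eq {m u v : ℕ} (hu : u < m) (hv : v < m)
    (h : ∀ k, 1 ≤ k → k < m → k * u % m ≠ 0 ∧ k * v % m ≠ 0 ∧ k < k * u % m + k * v % m ∧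
      k * u % m + k * v % m < m + k) (hm : 2 ≤ m) : u = 1 ∨ v = 1 ∨ u + v = m := by
  have h1 := h 1 le_rfl (by omega)
  rw [one_mul, one_mul, Nat.mod_eq_of_lt hu, Nat.mod_eq_of_lt hv] at h1
  by_contra! hcon
  obtain ⟨w, hw⟩ : ∃ w, u + v + w = m + 1 := ⟨m + 1 - u - v, by omega⟩
  have hmod : ∀ k, 1 ≤ k → k < m → k * u % m + k * v % m + k * w % m = m + k := by
    intro k hk hkm
    obtain ⟨-, -, h2, h3⟩ := h k hk hkm
    have h4 : k * w % m = m + k - (k * u % m + k * v % m) := by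
      rw [← Nat.mod_eq_of_lt (show m + k - (k * u % m + k * v % m) < m by omega)]
      refine Nat.ModEq.add_left_cancel (n := m) (a := k * u % m + k * v % m)
        (b := k * u % m + k * v % m) rfl ?_
      rw [Nat.add_sub_cancel' h3.le]
      have h5 : k * u % m + k * v % m + k * w ≡ k * u + k * v + k * w [MOD m] :=
        ((Nat.mod_modEq _ _).add (Nat.mod_modEq _ _)).add_right _
      refine h5.trans ?_
      have h6 : k * u + k * v + k * w = k * m + (m * 0 + k) := by
        rw [← mul_add, ← mul_add, hw]; ring
      rw [h6]
      simp [Nat.ModEq]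
    omega
  have hu0 := fun k hk hkm => (h k hk hkm).1
  have hv0 := fun k hk hkm => (h k hk hkm).2.1
  have hw0 : ∀ k, 1 ≤ k → k < m → k * w % m ≠ 0 := by
    intro k hk hkm
    have := hmod k hk hkm
    have := h k hk hkm
    omega
  have e1 := fun k hk hkm => (show k * u % m + k * w % m + k * v % m = m + k by
    rw [← hmod k hk hkm]; ring)
  have e2 := fun k hk hkm => (show k * v % m + k * u % m + k * w % m = m + k by
    rw [← hmod k hk hkm]; ring)
  have e3 := fun k hk hkm => (show k * v % m + k * w % m + k * u % m = m + k by
    rw [← hmod k hk hkm]; ring)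
  have e4 := fun k hk hkm => (show k * w % m + k * u % m + k * v % m = m + k by
    rw [← hmod k hk hkm]; ring)
  have e5 := fun k hk hkm => (show k * w % m + k * v % m + k * u % m = m + k by
    rw [← hmod k hk hkm]; ring)
  rcases le_total u v with a | a <;> rcases le_total v w with b | b <;>
    rcases le_total u w with c | c
  · exact floor_sum (by omega) (by omega) a b hw0 hv0 hu0 e5
  · exact floor_sum (by omega) (by omega) a b hw0 hv0 hu0 e5
  · exact floor_sum (by omega) (by omega) c b hv0 hw0 hu0 e3
  · exact floor_sum (by omega) (by omega) c a hv0 hu0 hw0 e2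
  · exact floor_sum (by omega) (by omega) a c hw0 hu0 hv0 e4
  · exact floor_sum (by omega) (by omega) b c hu0 hw0 hv0 e1
  · exact floor_sum (by omega) (by omega) b a hu0 hv0 hw0 hmod
  · exact floor_sum (by omega) (by omega) b a hu0 hv0 hw0 hmod

/-! ### Extremal configurations in `C_m ⊕ C_m` -/

/-- Four elements with `d = c - x (b - a)`, where `b - a` and `c - a` are independent of order
`m`. -/
structure Conf {H : Type*} [AddCommGroup H] (m x : ℕ) (a b c d : H) : Prop where
  lt : x < m
  coprime : x.Coprime m
  eq : d - c = -(x : ℤ) • (b - a)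
  indep : ∀ i j : ℤ, i • (b - a) + j • (c - a) = 0 → (m : ℤ) ∣ i ∧ (m : ℤ) ∣ j

section

variable {H : Type*} [AddCommGroup H] {m : ℕ}

lemma zsmul_eq_zero_of_dvd (hexp : ∀ g : H, m • g = 0) {k : ℤ} (hk : (m : ℤ) ∣ k) (g : H) :
    k • g = 0 := by
  obtain ⟨l, rfl⟩ := hk
  rw [mul_comm, mul_smul, natCast_zsmul, hexp, smul_zero]

lemma emod_zsmul (hexp : ∀ g : H, m • g = 0) (k : ℤ) (g : H) : (k % m) • g = k • g := by
  rw [← sub_eq_zero, ← sub_smul]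
  exact zsmul_eq_zero_of_dvd hexp (Int.dvd_sub_self_of_emod_eq rfl) g

namespace Conf

variable {x : ℕ} {a b c d : H}

lemma pos (h : Conf m x a b c d) (hm : 2 ≤ m) : 1 ≤ x := by
  rcases Nat.eq_zero_or_pos x with rfl | h1
  · have := h.coprime
    rw [Nat.coprime_zero_left] at this
    omega
  · exact h1

lemma flip (h : Conf m x a b c d) : Conf m x b a d c where
  lt := h.lt
  coprime := h.coprime
  eq := by rw [← neg_sub, h.eq, ← neg_sub b a, smul_neg]
  indep i j hij := by
    have h1 : (-(i + j * (x + 1))) • (b - a) + j • (c - a) = 0 := by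
      rw [← hij, show d = c + -(x : ℤ) • (b - a) by rw [← h.eq]; abel]
      module
    obtain ⟨h2, h3⟩ := h.indep _ _ h1
    refine ⟨?_, h3⟩
    have := dvd_sub (dvd_neg.2 h2) (h3.mul_right (x + 1))
    rwa [neg_neg, add_sub_cancel_right] at this

lemma neg (h : Conf m x a b c d) (hexp : ∀ g : H, m • g = 0) (hm : 2 ≤ m) :
    Conf m (m - x) b a c d where
  lt := by have := h.pos hm; omega
  coprime := by
    obtain ⟨u, v, huv⟩ := Nat.isCoprime_iff_coprime.2 h.coprime
    rw [← Nat.isCoprime_iff_coprime, Nat.cast_sub h.lt.le]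
    exact ⟨-u, v + u, by linear_combination huv⟩
  eq := by
    have h1 := hexp (b - a)
    rw [← natCast_zsmul] at h1
    rw [h.eq, Nat.cast_sub h.lt.le, ← sub_eq_zero, ← neg_eq_zero, ← h1]
    module
  indep i j hij := by
    have h1 : (-(i + j)) • (b - a) + j • (c - a) = 0 := by rw [← hij]; module
    obtain ⟨h2, h3⟩ := h.indep _ _ h1
    refine ⟨?_, h3⟩
    have := dvd_sub (dvd_neg.2 h2) h3
    rwa [neg_neg, add_sub_cancel_right] at this

lemma pair (h : Conf m x a b c d) (hexp : ∀ g : H, m • g = 0) {y : ℕ} (hy : y < m)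
    (hxy : (m : ℤ) ∣ y * x - 1) : Conf m y c d a b where
  lt := hy
  coprime := by
    rw [← Nat.isCoprime_iff_coprime]
    obtain ⟨z, hz⟩ := hxy
    exact ⟨x, -z, by linear_combination hz⟩
  eq := by
    have := zsmul_eq_zero_of_dvd hexp hxy (b - a)
    rw [h.eq, smul_smul, ← sub_eq_zero, ← neg_eq_zero, ← this]
    module
  indep i j hij := by
    have h1 : (-(i * x)) • (b - a) + (-j) • (c - a) = 0 := by
      rw [← hij, h.eq]; module
    obtain ⟨h2, h3⟩ := h.indep _ _ h1
    rw [dvd_neg] at h2 h3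
    exact ⟨((Nat.isCoprime_iff_coprime.2 h.coprime).symm).dvd_of_dvd_mul_right h2, h3⟩

lemma exists_pair (h : Conf m x a b c d) (hexp : ∀ g : H, m • g = 0) (hm : 2 ≤ m) :
    ∃ y : ℕ, (m : ℤ) ∣ y * x - 1 ∧ Conf m y c d a b := by
  obtain ⟨y, hy, hy1⟩ := Nat.exists_mul_mod_eq_one_of_coprime h.coprime (by omega)
  have h1 : (m : ℤ) ∣ y * x - 1 := by
    have : ((x * y : ℕ) : ℤ) % m = 1 := by exact_mod_cast hy1
    have h2 := Int.dvd_self_sub_of_emod_eq this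
    rw [mul_comm]; exact_mod_cast h2
  exact ⟨y, h1, h.pair hexp hy h1⟩

end Conf

end

/-- No zero-sum subsequence of length `m` of `a^(m-1) b^(m-1) c^(m-1) d^(m-1)`. -/
def Quad {H : Type*} [AddCommGroup H] (m : ℕ) (a b c d : H) : Prop :=
  ∀ i j k l : ℤ, 0 ≤ i → i < m → 0 ≤ j → j < m → 0 ≤ k → k < m → 0 ≤ l → l < m →
    i + j + k + l = m → i • a + j • b + k • c + l • d ≠ 0

section

variable {H : Type*} [AddCommGroup H] {m : ℕ} {a b c d : H}

lemma quad_of_noZS {S : Multiset H} (h : NoZS m S)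
    (hS : S = Multiset.replicate (m - 1) a + Multiset.replicate (m - 1) b +
      Multiset.replicate (m - 1) c + Multiset.replicate (m - 1) d) : Quad m a b c d := by
  intro i j k l hi hi' hj hj' hk hk' hl hl' hs h0
  lift i to ℕ using hi
  lift j to ℕ using hj
  lift k to ℕ using hk
  lift l to ℕ using hl
  refine h (Multiset.replicate i a + Multiset.replicate j b + Multiset.replicate k c +
    Multiset.replicate l d) ?_ ?_ ?_
  · rw [hS]
    refine add_le_add (add_le_add (add_le_add ?_ ?_) ?_) ?_ <;>
      exact Multiset.replicate_le_replicate _ |>.2 (by omega)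
  · simp only [Multiset.card_add, Multiset.card_replicate]
    omega
  · simpa only [Multiset.sum_add, Multiset.sum_replicate, natCast_zsmul] using h0

namespace Quad

lemma swap (h : Quad m a b c d) : Quad m a c b d := by
  intro i j k l hi hi' hj hj' hk hk' hl hl' hs h0
  exact h i k j l hi hi' hk hk' hj hj' hl hl' (by omega) (by rw [← h0]; abel)

lemma rotate (h : Quad m a b c d) : Quad m b c d a := by
  intro i j k l hi hi' hj hj' hk hk' hl hl' hs h0
  exact h l i j k hl hl' hi hi' hj hj' hk hk' (by omega) (by rw [← h0]; abel)

lemma indep (h : Quad m a b c d) (hexp : ∀ g : H, m • g = 0) (hm : 2 ≤ m) (i j : ℤ)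
    (hij : i • (b - a) + j • (c - a) = 0) : (m : ℤ) ∣ i ∧ (m : ℤ) ∣ j := by
  have hexp' : ∀ g : H, (m : ℤ) • g = 0 := fun g => by rw [natCast_zsmul, hexp]
  rw [← emod_zsmul hexp i, ← emod_zsmul hexp j] at hij
  rw [Int.dvd_iff_emod_eq_zero, Int.dvd_iff_emod_eq_zero]
  have hi := Int.emod_nonneg i (show (m : ℤ) ≠ 0 by omega)
  have hi' := Int.emod_lt_of_pos i (show (0 : ℤ) < m by omega)
  have hj := Int.emod_nonneg j (show (m : ℤ) ≠ 0 by omega)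
  have hj' := Int.emod_lt_of_pos j (show (0 : ℤ) < m by omega)
  generalize i % (m : ℤ) = s at *
  generalize j % (m : ℤ) = t at *
  by_contra hne
  rcases le_or_gt (s + t) m with hst | hst
  · refine h (m - s - t) s t 0 (by omega) (by omega) hi hi' hj hj' le_rfl (by omega) (by omega) ?_
    linear_combination (norm := module) hij + hexp' a
  · refine h (s + t - m) (m - s) (m - t) 0 (by omega) (by omega) (by omega) (by omega) (by omega)
      (by omega) le_rfl (by omega) (by omega) ?_
    linear_combination (norm := module) hexp' (b + c - a) - hij

lemma conf (h : Quad m a b c d) (hexp : ∀ g : H, m • g = 0) (hm : 2 ≤ m) {x : ℕ} (hx : x < m)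
    (hd : d - c = -(x : ℤ) • (b - a)) : Conf m x a b c d where
  lt := hx
  coprime := by
    obtain ⟨y, hy⟩ := Nat.gcd_dvd_left x m
    obtain ⟨z, hz⟩ := Nat.gcd_dvd_right x m
    have hg : 0 < x.gcd m := Nat.gcd_pos_of_pos_right _ (by omega)
    have h1 := (h.rotate.rotate.indep hexp hm z 0 (by
      rw [hd, smul_smul, zero_smul, add_zero]
      refine zsmul_eq_zero_of_dvd hexp ?_ _
      refine ⟨-y, ?_⟩
      have h2 : z * x = m * y := by
        calc z * x = z * (x.gcd m * y) := by rw [← hy]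
          _ = x.gcd m * z * y := by ring
          _ = m * y := by rw [← hz]
      have : (z : ℤ) * x = m * y := by exact_mod_cast h2
      linear_combination -this)).1
    have h3 : m ∣ z := by exact_mod_cast h1
    have hz0 : 0 < z := Nat.pos_of_ne_zero (by rintro rfl; omega)
    have h4 := Nat.le_of_dvd hz0 h3
    rw [Nat.Coprime]
    by_contra hne
    have : 2 * z ≤ x.gcd m * z := Nat.mul_le_mul_right _ (by omega)
    omega
  eq := hd
  indep := h.indep hexp hm

end Quad

end

lemma exists_smul_add_smul {m : ℕ} (hm : 2 ≤ m) {e f : ZMod m × ZMod m}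
    (h : ∀ i j : ℤ, i • e + j • f = 0 → (m : ℤ) ∣ i ∧ (m : ℤ) ∣ j) (g : ZMod m × ZMod m) :
    ∃ u v : ℕ, u < m ∧ v < m ∧ g = (u : ℤ) • e + (v : ℤ) • f := by
  have : NeZero m := ⟨by omega⟩
  have hinj : Function.Injective fun s : ZMod m × ZMod m =>
      (s.1.val : ℤ) • e + (s.2.val : ℤ) • f := by
    intro s t hst
    obtain ⟨h1, h2⟩ := h (s.1.val - t.1.val) (s.2.val - t.2.val) (by
      rw [← sub_eq_zero.2 hst]; module)
    have aux : ∀ y z : ZMod m, (m : ℤ) ∣ y.val - z.val → y = z := by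
      intro y z hyz
      have := (ZMod.intCast_zmod_eq_zero_iff_dvd _ _).2 hyz
      simpa [sub_eq_zero] using this
    exact Prod.ext (aux _ _ h1) (aux _ _ h2)
  obtain ⟨s, hs⟩ := (Finite.injective_iff_surjective.1 hinj) g
  exact ⟨s.1.val, s.2.val, ZMod.val_lt _, ZMod.val_lt _, hs.symm⟩

lemma Quad.exists_conf {m : ℕ} (hm : 2 ≤ m) {a b c d : ZMod m × ZMod m} (h : Quad m a b c d) :
    ∃ x, Conf m x a b c d ∨ Conf m x a c b d ∨ Conf m x b c a d := by
  have hexp := nsmul_eq_zero_prod (p := m)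
  have hexp' : ∀ g : ZMod m × ZMod m, (m : ℤ) • g = 0 := fun g => by rw [natCast_zsmul, hexp]
  obtain ⟨u, v, hu, hv, hd⟩ := exists_smul_add_smul hm (h.indep hexp hm) (d - a)
  have hfl : ∀ k, 1 ≤ k → k < m → k * u % m ≠ 0 ∧ k * v % m ≠ 0 ∧
      k < k * u % m + k * v % m ∧ k * u % m + k * v % m < m + k := by
    intro k hk hkm
    have hkd : (k : ℤ) • (d - a) =
        ((k * u % m : ℕ) : ℤ) • (b - a) + ((k * v % m : ℕ) : ℤ) • (c - a) := by
      push_cast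
      rw [hd, emod_zsmul hexp, emod_zsmul hexp]
      module
    have hp := Nat.mod_lt (k * u) (show m > 0 by omega)
    have hq := Nat.mod_lt (k * v) (show m > 0 by omega)
    generalize k * u % m = p at *
    generalize k * v % m = q at *
    have hβ : k < p + q := by
      by_contra hcon
      refine h (k - p - q) p q (m - k) (by omega) (by omega) (by omega) (by omega) (by omega)
        (by omega) (by omega) (by omega) (by omega) ?_
      linear_combination (norm := module) hexp' d - hkd
    have hp0 : p ≠ 0 := by
      rintro rfl
      refine h (q - k) 0 (m - q) k (by omega) (by omega) (by omega) (by omega) (by omega)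
        (by omega) (by omega) (by omega) (by omega) ?_
      push_cast at hkd
      linear_combination (norm := module) hexp' c + hkd
    have hq0 : q ≠ 0 := by
      rintro rfl
      refine h (p - k) (m - p) 0 k (by omega) (by omega) (by omega) (by omega) (by omega)
        (by omega) (by omega) (by omega) (by omega) ?_
      push_cast at hkd
      linear_combination (norm := module) hexp' b + hkd
    refine ⟨hp0, hq0, hβ, ?_⟩
    by_contra hcon
    refine h (p + q - m - k) (m - p) (m - q) k (by omega) (by omega) (by omega) (by omega)
      (by omega) (by omega) (by omega) (by omega) (by omega) ?_
    linear_combination (norm := module) hexp' (b + c - a) + hkd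
  have h1 := hfl 1 le_rfl (by omega)
  rw [one_mul, one_mul, Nat.mod_eq_of_lt hu, Nat.mod_eq_of_lt hv] at h1
  rcases eq_one_or_add_eq hu hv hfl hm with rfl | rfl | huv
  · refine ⟨m - v, Or.inr (Or.inl (h.swap.conf hexp hm (by omega) ?_))⟩
    rw [Nat.cast_sub hv.le]
    push_cast at hd
    linear_combination (norm := module) hd + hexp' (c - a)
  · refine ⟨m - u, Or.inl (h.conf hexp hm (by omega) ?_)⟩
    rw [Nat.cast_sub hu.le]
    push_cast at hd
    linear_combination (norm := module) hd + hexp' (b - a)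
  · refine ⟨u, Or.inr (Or.inr (h.rotate.rotate.swap.rotate.rotate.rotate.conf hexp hm hu ?_))⟩
    have hv' : (v : ℤ) = m - u := by omega
    rw [hv'] at hd
    linear_combination (norm := module) hd + hexp' (c - a)

lemma exists_eq_replicate {α : Type*} [DecidableEq α] {k : ℕ} {T : Multiset α} (hk : 1 ≤ k)
    (hc : T.card = 4 * k) (h : ∀ x ∈ T, T.count x = k) : ∃ a b c d,
    T = Multiset.replicate k a + Multiset.replicate k b + Multiset.replicate k c +
      Multiset.replicate k d := by
  have h1 := Multiset.toFinset_sum_count_eq T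
  rw [Finset.sum_congr rfl fun a ha => h a (Multiset.mem_toFinset.1 ha), Finset.sum_const,
    smul_eq_mul, hc] at h1
  have h4 := Nat.eq_of_mul_eq_mul_right (by omega) h1
  obtain ⟨a, A, ha, hA, h3⟩ := Finset.card_eq_succ.1 h4
  obtain ⟨b, c, d, hbc, hbd, hcd, rfl⟩ := Finset.card_eq_three.1 h3
  refine ⟨a, b, c, d, ?_⟩
  have h5 := Multiset.toFinset_sum_count_nsmul_eq T
  rw [Finset.sum_congr rfl fun a ha => by rw [h a (Multiset.mem_toFinset.1 ha)], ← hA,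
    Finset.sum_insert ha, Finset.sum_insert (by simp [hbc, hbd]), Finset.sum_pair hcd] at h5
  rw [← h5]
  simp only [Multiset.nsmul_singleton, add_assoc]

lemma exists_conf {m : ℕ} (hm : 2 ≤ m) (hG : Good (ZMod m × ZMod m) m 4)
    {T : Multiset (ZMod m × ZMod m)} (hc : T.card = 4 * (m - 1)) (hT : NoZS m T) :
    ∃ x a b c d, Conf m x a b c d ∧
      T = Multiset.replicate (m - 1) a + Multiset.replicate (m - 1) b +
        Multiset.replicate (m - 1) c + Multiset.replicate (m - 1) d := by
  obtain ⟨a, b, c, d, h⟩ := exists_eq_replicate (by omega) hc (hG.inv T hc hT)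
  obtain ⟨x, hx | hx | hx⟩ := (quad_of_noZS hT h).exists_conf hm
  · exact ⟨x, a, b, c, d, hx, h⟩
  · exact ⟨x, a, c, b, d, hx, by rw [h]; abel⟩
  · exact ⟨x, b, c, a, d, hx, by rw [h]; abel⟩

/-! ### Structure of extremal sequences over `C_m ⊕ C_{mn}` -/

lemma exists_eq_replicate_cyclic {n : ℕ} (hn : 2 ≤ n) {W : Multiset (ZMod n)}
    (hc : W.card = 2 * (n - 1)) (hW : NoZS n W) :
    ∃ u v, W = Multiset.replicate (n - 1) u + Multiset.replicate (n - 1) v ∧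
      ∀ k : ℤ, k • (u - v) = 0 → (n : ℤ) ∣ k := by
  have hcount := (good_cyclic n (by omega)).inv W hc hW
  have h1 := Multiset.toFinset_sum_count_eq W
  rw [Finset.sum_congr rfl fun a ha => hcount a (Multiset.mem_toFinset.1 ha), Finset.sum_const,
    smul_eq_mul, hc] at h1
  obtain ⟨u, v, huv, h3⟩ := Finset.card_eq_two.1 (Nat.eq_of_mul_eq_mul_right (by omega) h1)
  have hWe : W = Multiset.replicate (n - 1) u + Multiset.replicate (n - 1) v := by
    have h5 := Multiset.toFinset_sum_count_nsmul_eq W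
    rw [Finset.sum_congr rfl fun a ha => by rw [hcount a (Multiset.mem_toFinset.1 ha)], h3,
      Finset.sum_pair huv] at h5
    rw [← h5]
    simp only [Multiset.nsmul_singleton]
  refine ⟨u, v, hWe, fun k hk => ?_⟩
  have hexp : ∀ g : ZMod n, n • g = 0 := fun g => by simp
  rw [← emod_zsmul hexp] at hk
  rw [Int.dvd_iff_emod_eq_zero]
  have hk0 := Int.emod_nonneg k (show (n : ℤ) ≠ 0 by omega)
  have hkn := Int.emod_lt_of_pos k (show (0 : ℤ) < n by omega)
  generalize k % (n : ℤ) = s at *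
  lift s to ℕ using hk0
  by_contra hs
  refine hW (Multiset.replicate s u + Multiset.replicate (n - s) v) ?_ ?_ ?_
  · rw [hWe]
    exact add_le_add (Multiset.replicate_le_replicate _ |>.2 (by omega))
      (Multiset.replicate_le_replicate _ |>.2 (by omega))
  · simp only [Multiset.card_add, Multiset.card_replicate]
    omega
  · have h2 := hexp v
    rw [Multiset.sum_add, Multiset.sum_replicate, Multiset.sum_replicate, ← natCast_zsmul,
      ← natCast_zsmul, Nat.cast_sub (by omega)]
    rw [← natCast_zsmul] at h2
    linear_combination (norm := module) hk + h2

lemma Conf.ne {H : Type*} [AddCommGroup H] {m x : ℕ} {a b c d : H} (h : Conf m x a b c d)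
    (hm : 2 ≤ m) : d ≠ a ∧ d ≠ b ∧ d ≠ c := by
  have h0 := h.eq
  have hnd : ¬ (m : ℤ) ∣ 1 := by
    rw [Int.natCast_dvd]; simpa using (show m ≠ 1 by omega)
  refine ⟨?_, ?_, ?_⟩
  · rintro rfl
    exact hnd (h.indep (-x) 1 (by linear_combination (norm := module) - h0)).2
  · rintro rfl
    exact hnd (h.indep (-x - 1) 1 (by linear_combination (norm := module) - h0)).2
  · rintro rfl
    have h1 := (h.indep x 0 (by linear_combination (norm := module) h0)).1
    have h2 := Nat.le_of_dvd (h.pos hm) (by exact_mod_cast h1)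
    have := h.lt
    omega

/-- If all zero-sum-mod-`φ` subsequences of `R` of length `2m` have the same sum, then the elements
of `R` over the last element of the configuration agree. -/
lemma Conf.eq_of_star {G H : Type*} [AddCommGroup G] [AddCommGroup H] {φ : G →+ H} {m x : ℕ}
    {a b c d : H} (h : Conf m x a b c d) (hm : 2 ≤ m) (hexp : ∀ g : H, m • g = 0)
    {R : Multiset G} {w : G}
    (hR : R.map φ = Multiset.replicate (m - 1) a + Multiset.replicate (m - 1) b +
      Multiset.replicate (m - 1) c + Multiset.replicate (m - 1) d)
    (hstar : ∀ Z ≤ R, Z.card = 2 * m → φ Z.sum = 0 → Z.sum = w) {y y' : G} (hy : y ∈ R)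
    (hy' : y' ∈ R) (hyd : φ y = d) (hyd' : φ y' = d) : y = y' := by
  obtain ⟨hda, hdb, hdc⟩ := h.ne hm
  have hx := h.pos hm
  have hxm := h.lt
  obtain ⟨Z, hZ, hZm⟩ := exists_le_of_le_map (f := φ) (S := R)
    (T := Multiset.replicate (m - x) a + Multiset.replicate x b +
      Multiset.replicate (m - 1) c) (by
    rw [hR]
    refine (add_le_add (add_le_add ?_ ?_) le_rfl).trans (Multiset.le_add_right _ _) <;>
      exact Multiset.replicate_le_replicate _ |>.2 (by omega))
  have hdZ : d ∉ Z.map φ := by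
    rw [hZm]
    simp [Multiset.mem_replicate, hda, hdb, hdc]
  have hcard : Z.card = 2 * m - 1 := by
    rw [← Multiset.card_map φ, hZm]
    simp only [Multiset.card_add, Multiset.card_replicate]
    omega
  have hsum : φ Z.sum = -d := by
    rw [map_multiset_sum, hZm]
    simp only [Multiset.sum_add, Multiset.sum_replicate]
    have h1 := hexp (a + c)
    rw [← natCast_zsmul] at h1
    rw [← natCast_zsmul, ← natCast_zsmul, ← natCast_zsmul, Nat.cast_sub h.lt.le,
      Nat.cast_sub (show 1 ≤ m by omega), Nat.cast_one]
    linear_combination (norm := module) h1 + h.eq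
  have key : ∀ z ∈ R, φ z = d → z + Z.sum = w := by
    intro z hz hzd
    have hzZ : z ∉ Z := fun hz => hdZ (hzd ▸ Multiset.mem_map_of_mem φ hz)
    rw [← Multiset.sum_cons]
    refine hstar _ ((Multiset.cons_le_of_notMem hzZ).2 ⟨hz, hZ⟩) ?_ ?_
    · rw [Multiset.card_cons, hcard]; omega
    · rw [Multiset.sum_cons, map_add, hsum, hzd, add_neg_cancel]
  exact add_right_cancel ((key y hy hyd).trans (key y' hy' hyd').symm)

lemma exists_eq_replicate_of_forall {α : Type*} {a b c d : α} {P : Multiset α}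
    (h : ∀ B ∈ P, B = a ∨ B = b ∨ B = c ∨ B = d) : ∃ i j k l,
    P = Multiset.replicate i a + Multiset.replicate j b + Multiset.replicate k c +
      Multiset.replicate l d := by
  induction P using Multiset.induction with
  | empty => exact ⟨0, 0, 0, 0, by simp⟩
  | cons B P ih =>
    obtain ⟨i, j, k, l, rfl⟩ := ih fun C hC => h C (Multiset.mem_cons_of_mem hC)
    rcases h B (Multiset.mem_cons_self _ _) with rfl | rfl | rfl | rfl
    · exact ⟨i + 1, j, k, l, by simp [Multiset.replicate_succ]⟩
    · exact ⟨i, j + 1, k, l, by simp [Multiset.replicate_succ]⟩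
    · exact ⟨i, j, k + 1, l, by simp [Multiset.replicate_succ]⟩
    · exact ⟨i, j, k, l + 1, by simp [Multiset.replicate_succ]⟩

/-- The data describing an extremal sequence with four distinct elements. -/
structure Shape {G H : Type*} [AddCommGroup G] [AddCommGroup H] (φ : G →+ H) (m n x : ℕ)
    (S : Multiset G) (U V A B C D : G) (i j k l : ℕ) : Prop where
  conf : Conf m x (φ A) (φ B) (φ C) (φ D)
  eq : S = Multiset.replicate ((i + 1) * m - 1) A + Multiset.replicate ((j + 1) * m - 1) B +
    Multiset.replicate ((k + 1) * m - 1) C + Multiset.replicate ((l + 1) * m - 1) D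
  sums : Multiset.replicate i (m • A) + Multiset.replicate j (m • B) +
    Multiset.replicate k (m • C) + Multiset.replicate l (m • D) =
      Multiset.replicate (n - 1) U + Multiset.replicate (n - 1) V
  star : ∀ s t : ℕ, 1 ≤ s → s < m → 1 ≤ t → t < m → (m : ℤ) ∣ s - x * t →
    (m - s : ℤ) • A + (s : ℤ) • B + (m - t : ℤ) • C + (t : ℤ) • D = U + V
  order : ∀ r : ℤ, r • (U - V) = 0 → (n : ℤ) ∣ r

section

variable {G H : Type*} [AddCommGroup G] [AddCommGroup H] [DecidableEq G] [DecidableEq H] {m n : ℕ}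
  {φ : G →+ H} {ι : ZMod n →+ G} {κ : G → ZMod n} {S : Multiset G}

lemma Frame.sum_eq_of_le_rest (F : Frame φ ι κ m 4 n 2 S) (hn : 2 ≤ n)
    {P : Multiset (Multiset G)} {R : Multiset G} (hP : IsDec φ m (2 * (n - 1)) S P R) {u v : ZMod n}
    (huv : (P.map fun B => κ B.sum) =
      Multiset.replicate (n - 1) u + Multiset.replicate (n - 1) v)
    (hord : ∀ k : ℤ, k • (u - v) = 0 → (n : ℤ) ∣ k) {Z : Multiset G} (hZ : Z ≤ R)
    (hZc : Z.card = 2 * m) (hZ0 : φ Z.sum = 0) : Z.sum = ι u + ι v := by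
  have : NeZero n := ⟨by omega⟩
  have hinj : Function.Injective fun s : ZMod n => s * (u - v) := by
    intro s t hst
    have h1 := hord (s.val - t.val) (by
      rw [zsmul_eq_mul]
      push_cast
      rw [ZMod.natCast_zmod_val, ZMod.natCast_zmod_val, sub_mul, sub_eq_zero]
      exact hst)
    have := (ZMod.intCast_zmod_eq_zero_iff_dvd _ _).2 h1
    simpa [sub_eq_zero] using this
  obtain ⟨s, hs⟩ := Finite.injective_iff_surjective.1 hinj (2 * v - κ Z.sum)
  have hlt := ZMod.val_lt s
  have hs' := ZMod.natCast_zmod_val s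
  generalize s.val = t at *
  subst hs'
  rcases (show t = n - 1 ∨ t + 2 ≤ n by omega) with rfl | ht
  · rw [← F.sec _ hZ0, ← map_add]
    congr 1
    rw [Nat.cast_sub (by omega), ZMod.natCast_self] at hs
    push_cast at hs
    linear_combination hs
  · exfalso
    obtain ⟨Q, hQ, hQm⟩ := exists_le_of_le_map (S := P) (f := fun B => κ B.sum)
      (T := Multiset.replicate t u + Multiset.replicate (n - 2 - t) v) (by
      rw [huv]
      exact add_le_add (Multiset.replicate_le_replicate _ |>.2 (by omega))
        (Multiset.replicate_le_replicate _ |>.2 (by omega)))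
    have hb : ∀ B ∈ Q, B.card = m ∧ φ B.sum = 0 := fun B hB =>
      hP.block B (Multiset.mem_of_le hQ hB)
    have hQc : Q.card = n - 2 := by
      rw [← Multiset.card_map (fun B => κ B.sum), hQm]
      simp only [Multiset.card_add, Multiset.card_replicate]
      omega
    refine F.noZS (Q.join + Z) ?_ ?_ ?_
    · rw [← hP.eq]
      refine add_le_add ?_ hZ
      obtain ⟨Q', rfl⟩ := Multiset.le_iff_exists_add.1 hQ
      rw [Multiset.join_add]
      exact Multiset.le_add_right _ _
    · rw [Multiset.card_add, card_join_of_forall fun B hB => (hb B hB).1, hQc, hZc, ← add_mul,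
        Nat.sub_add_cancel hn, mul_comm]
    · rw [Multiset.sum_add, Multiset.sum_join, ← F.sec _ hZ0]
      have : Q.map Multiset.sum = (Q.map fun B => κ B.sum).map ι := by
        rw [Multiset.map_map]
        exact Multiset.map_congr rfl fun B hB => (F.sec _ (hb B hB).2).symm
      rw [this, hQm, ← map_multiset_sum, ← map_add, Multiset.sum_add, Multiset.sum_replicate,
        Multiset.sum_replicate, nsmul_eq_mul, nsmul_eq_mul, Nat.cast_sub (show t ≤ n - 2 by omega),
        Nat.cast_sub hn, ZMod.natCast_self, ← map_zero ι]
      congr 1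
      push_cast
      linear_combination hs

lemma Frame.exists_shape (F : Frame φ ι κ m 4 n 2 S) (hn : 2 ≤ n) (hι : Function.Injective ι)
    (hexp : ∀ g : H, m • g = 0)
    (hconf : ∀ T : Multiset H, T.card = 4 * (m - 1) → NoZS m T → ∃ x a b c d, Conf m x a b c d ∧
      T = Multiset.replicate (m - 1) a + Multiset.replicate (m - 1) b +
        Multiset.replicate (m - 1) c + Multiset.replicate (m - 1) d) :
    ∃ x U V A B C D i j k l, Shape φ m n x S U V A B C D i j k l := by
  have hm := F.two_le
  obtain ⟨P, R, hP⟩ := F.base.exists_isDec (by omega) φ (2 * (n - 1)) F.card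
  obtain ⟨x, a, b, c, d, hc, hR⟩ := hconf _ (by simpa using F.card_rest hP) (F.noZS_rest hP)
  obtain ⟨u, v, huv, hord⟩ := exists_eq_replicate_cyclic hn (by simp [hP.card])
    (F.noZS_blocks (by rw [← hP.eq]; exact Multiset.le_add_right _ _) hP.block)
  have hstar := fun Z hZ hZc hZ0 => F.sum_eq_of_le_rest hn hP huv hord (Z := Z) hZ hZc hZ0
  obtain ⟨y, -, hy⟩ := hc.exists_pair hexp hm
  have hRle : ∀ z ∈ R, z ∈ S := fun z hz => by rw [← hP.eq]; exact Multiset.mem_add.2 (Or.inr hz)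
  have hRconst : ∀ z ∈ R, ∀ z' ∈ R, φ z = φ z' → z = z' := by
    intro z hz z' hz' hzz
    have h1 := Multiset.mem_map_of_mem φ hz
    rw [hR] at h1
    simp only [Multiset.mem_add, Multiset.mem_replicate] at h1
    rcases h1 with ((⟨-, h1⟩ | ⟨-, h1⟩) | ⟨-, h1⟩) | ⟨-, h1⟩
    · exact hy.flip.eq_of_star hm hexp (by rw [hR]; abel) hstar hz hz' h1 (hzz ▸ h1)
    · exact hy.eq_of_star hm hexp (by rw [hR]; abel) hstar hz hz' h1 (hzz ▸ h1)
    · exact hc.flip.eq_of_star hm hexp (by rw [hR]; abel) hstar hz hz' h1 (hzz ▸ h1)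
    · exact hc.eq_of_star hm hexp hR hstar hz hz' h1 (hzz ▸ h1)
  have hconst : ∀ z ∈ S, ∀ z' ∈ S, φ z = φ z' → z = z' := by
    intro z hz z' hz' hzz
    have h1 := hz
    have h2 := hz'
    rw [← hP.eq, Multiset.mem_add, Multiset.mem_join] at h1 h2
    rcases h1 with ⟨B, hB, h1⟩ | h1
    · exact (F.eq_of_mem_block hP hB h1 hz' hzz.symm).symm
    rcases h2 with ⟨B, hB, h2⟩ | h2
    · exact F.eq_of_mem_block hP hB h2 hz hzz
    · exact hRconst z h1 z' h2 hzz
  obtain ⟨σ, hσ⟩ : ∃ σ : H → G, ∀ z ∈ S, σ (φ z) = z := by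
    classical
    refine ⟨fun h => if hh : ∃ z ∈ S, φ z = h then hh.choose else 0, fun z hz => ?_⟩
    have hh : ∃ z' ∈ S, φ z' = φ z := ⟨z, hz, rfl⟩
    beta_reduce
    rw [dif_pos hh]
    exact hconst _ hh.choose_spec.1 _ hz hh.choose_spec.2
  have hmap : ∀ T : Multiset G, (∀ z ∈ T, z ∈ S) → T = (T.map φ).map σ := by
    intro T hT
    rw [Multiset.map_map]
    conv_lhs => rw [← Multiset.map_id' T]
    exact Multiset.map_congr rfl fun z hz => (hσ z (hT z hz)).symm
  have hRσ := hmap R hRle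
  rw [hR] at hRσ
  simp only [Multiset.map_add, Multiset.map_replicate] at hRσ
  have hφσ : ∀ h ∈ R.map φ, φ (σ h) = h := by
    intro h hh
    obtain ⟨z, hz, rfl⟩ := Multiset.mem_map.1 hh
    rw [hσ z (hRle z hz)]
  have hm1 : m - 1 ≠ 0 := by omega
  have hφa := hφσ a (by rw [hR]; simp [Multiset.mem_replicate, hm1])
  have hφb := hφσ b (by rw [hR]; simp [Multiset.mem_replicate, hm1])
  have hφc := hφσ c (by rw [hR]; simp [Multiset.mem_replicate, hm1])
  have hφd := hφσ d (by rw [hR]; simp [Multiset.mem_replicate, hm1])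
  have hblock : ∀ B ∈ P, B = Multiset.replicate m (σ a) ∨ B = Multiset.replicate m (σ b) ∨
      B = Multiset.replicate m (σ c) ∨ B = Multiset.replicate m (σ d) := by
    intro B hB
    obtain ⟨e, he, hBe⟩ := F.exists_block_eq hP hB
    have h1 := hmap B fun z hz => by
      rw [← hP.eq]; exact Multiset.mem_add.2 (Or.inl (Multiset.mem_join.2 ⟨B, hB, hz⟩))
    rw [hBe, Multiset.map_replicate] at h1
    rw [hR] at he
    simp only [Multiset.mem_add, Multiset.mem_replicate] at he
    rcases he with ((⟨-, rfl⟩ | ⟨-, rfl⟩) | ⟨-, rfl⟩) | ⟨-, rfl⟩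
    · exact Or.inl h1
    · exact Or.inr (Or.inl h1)
    · exact Or.inr (Or.inr (Or.inl h1))
    · exact Or.inr (Or.inr (Or.inr h1))
  obtain ⟨i, j, k, l, hPe⟩ := exists_eq_replicate_of_forall hblock
  refine ⟨x, ι u, ι v, σ a, σ b, σ c, σ d, i, j, k, l, ?_, ?_, ?_, ?_, ?_⟩
  · rwa [hφa, hφb, hφc, hφd]
  · have hjoin : ∀ (i : ℕ) (z : G), (Multiset.replicate i (Multiset.replicate m z)).join +
        Multiset.replicate (m - 1) z = Multiset.replicate ((i + 1) * m - 1) z := by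
      intro i z
      rw [Multiset.join, Multiset.sum_replicate, Multiset.nsmul_replicate, ← Multiset.replicate_add]
      congr 1
      rw [add_mul, one_mul, Nat.add_sub_assoc (by omega)]
    rw [← hjoin, ← hjoin, ← hjoin, ← hjoin, ← hP.eq, hRσ, hPe]
    simp only [Multiset.join_add]
    abel
  · have h1 : P.map Multiset.sum = (P.map fun B => κ B.sum).map ι := by
      rw [Multiset.map_map]
      exact Multiset.map_congr rfl fun B hB => (F.sec _ (hP.block B hB).2).symm
    rw [huv, hPe] at h1
    simpa only [Multiset.map_add, Multiset.map_replicate, Multiset.sum_replicate] using h1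
  · intro s t hs hs' ht ht' hst
    have hZ := hstar (Multiset.replicate (m - s) (σ a) + Multiset.replicate s (σ b) +
      Multiset.replicate (m - t) (σ c) + Multiset.replicate t (σ d)) (by
        rw [hRσ]
        refine add_le_add (add_le_add (add_le_add ?_ ?_) ?_) ?_ <;>
          exact Multiset.replicate_le_replicate _ |>.2 (by omega)) (by
        simp only [Multiset.card_add, Multiset.card_replicate]
        omega) (by
        simp only [Multiset.sum_add, Multiset.sum_replicate, map_add, map_nsmul, hφa, hφb, hφc,
          hφd]
        have h1 := zsmul_eq_zero_of_dvd hexp hst (b - a)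
        have h2 := hexp (a + c)
        rw [← natCast_zsmul] at h2
        rw [← natCast_zsmul, ← natCast_zsmul, ← natCast_zsmul, ← natCast_zsmul,
          Nat.cast_sub hs'.le, Nat.cast_sub ht'.le]
        linear_combination (norm := module) h1 + h2 + (t : ℤ) • hc.eq)
    simp only [Multiset.sum_add, Multiset.sum_replicate] at hZ
    rw [← hZ, ← natCast_zsmul, ← natCast_zsmul, ← natCast_zsmul, ← natCast_zsmul,
      Nat.cast_sub hs'.le, Nat.cast_sub ht'.le]
  · intro r hr
    refine hord r (hι ?_)
    rw [map_zsmul, map_sub, hr, map_zero]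

end

/-- A sequence supported on four elements in one of the two extremal patterns. -/
def Standard {G H : Type*} [AddCommGroup G] [AddCommGroup H] (φ : G →+ H) (m n : ℕ)
    (S : Multiset G) : Prop :=
  ∃ (x : ℕ) (A B C D : G) (i j k l : ℕ), Conf m x (φ A) (φ B) (φ C) (φ D) ∧
    S = Multiset.replicate ((i + 1) * m - 1) A + Multiset.replicate ((j + 1) * m - 1) B +
      Multiset.replicate ((k + 1) * m - 1) C + Multiset.replicate ((l + 1) * m - 1) D ∧
    (∀ r : ℤ, r • ((m : ℤ) • (C - A)) = 0 → (n : ℤ) ∣ r) ∧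
    (((m : ℤ) • (B - A) = 0 ∧ D = C - (x : ℤ) • (B - A) ∧ i + j = n - 1 ∧ k + l = n - 1) ∨
      (B + D = A + C ∧ i = n - 1 ∧ j = 0 ∧ k = n - 1 ∧ l = 0))

lemma Conf.cross {H : Type*} [AddCommGroup H] {m : ℕ} {a b c d : H} (h : Conf m 1 a b c d) :
    Conf m 1 a d c b where
  lt := h.lt
  coprime := h.coprime
  eq := by linear_combination (norm := (push_cast; module)) h.eq
  indep i j hij := by
    obtain ⟨h1, h2⟩ := h.indep (-i) (i + j) (by
      linear_combination (norm := (push_cast; module)) hij - i • h.eq)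
    rw [dvd_neg] at h1
    exact ⟨h1, (dvd_add_right h1).1 h2⟩

namespace Shape

variable {G H : Type*} [AddCommGroup G] [AddCommGroup H] {φ : G →+ H} {m n x : ℕ} {S : Multiset G}
  {U V A B C D : G} {i j k l : ℕ}

lemma symm (h : Shape φ m n x S U V A B C D i j k l) : Shape φ m n x S V U A B C D i j k l where
  conf := h.conf
  eq := h.eq
  sums := by rw [h.sums, add_comm]
  star s t hs hs' ht ht' hst := by rw [h.star s t hs hs' ht ht' hst, add_comm]
  order r hr := h.order r (by rw [← neg_sub, smul_neg, hr, neg_zero])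

lemma flip (h : Shape φ m n x S U V A B C D i j k l) :
    Shape φ m n x S U V B A D C j i l k where
  conf := h.conf.flip
  eq := by rw [h.eq]; abel
  sums := by rw [← h.sums]; abel
  star s t hs hs' ht ht' hst := by
    obtain ⟨z, hz⟩ := hst
    have := h.star (m - s) (m - t) (by omega) (by omega) (by omega) (by omega)
      ⟨1 - x - z, by rw [Nat.cast_sub hs'.le, Nat.cast_sub ht'.le]; linear_combination -hz⟩
    rw [Nat.cast_sub hs'.le, Nat.cast_sub ht'.le] at this
    rw [← this]
    module
  order := h.order

lemma neg (h : Shape φ m n x S U V A B C D i j k l) (hexp : ∀ g : H, m • g = 0) (hm : 2 ≤ m) :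
    Shape φ m n (m - x) S U V B A C D j i k l where
  conf := h.conf.neg hexp hm
  eq := by rw [h.eq]; abel
  sums := by rw [← h.sums]; abel
  star s t hs hs' ht ht' hst := by
    obtain ⟨z, hz⟩ := hst
    rw [Nat.cast_sub h.conf.lt.le] at hz
    have := h.star (m - s) t (by omega) (by omega) ht ht'
      ⟨1 - t - z, by rw [Nat.cast_sub hs'.le]; linear_combination -hz⟩
    rw [Nat.cast_sub hs'.le] at this
    rw [← this]
    module
  order := h.order

lemma pair (h : Shape φ m n x S U V A B C D i j k l) (hexp : ∀ g : H, m • g = 0) {y : ℕ}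
    (hy : y < m) (hxy : (m : ℤ) ∣ y * x - 1) : Shape φ m n y S U V C D A B k l i j where
  conf := h.conf.pair hexp hy hxy
  eq := by rw [h.eq]; abel
  sums := by rw [← h.sums]; abel
  star s t hs hs' ht ht' hst := by
    obtain ⟨z, hz⟩ := hst
    obtain ⟨w, hw⟩ := hxy
    have := h.star t s ht ht' hs hs'
      ⟨-(x * z) - w * t, by linear_combination -(x : ℤ) * hz - (t : ℤ) * hw⟩
    rw [← this]
    module
  order := h.order

lemma pair_one (h : Shape φ m n 1 S U V A B C D i j k l) (hexp : ∀ g : H, m • g = 0) :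
    Shape φ m n 1 S U V C D A B k l i j :=
  h.pair hexp h.conf.lt (by simp)

lemma swap (h : Shape φ 2 n 1 S U V A B C D i j k l) (hexp : ∀ g : H, 2 • g = 0) :
    Shape φ 2 n 1 S U V A C B D i k j l where
  conf := by
    have h1 := hexp (φ C - φ B)
    refine ⟨h.conf.lt, h.conf.coprime, ?_, fun i j hij => ?_⟩
    · linear_combination (norm := (push_cast; module)) h.conf.eq + h1
    · exact (h.conf.indep j i (by rw [← hij]; abel)).symm
  eq := by rw [h.eq]; abel
  sums := by rw [← h.sums]; abel
  star s t hs hs' ht ht' hst := by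
    have hs1 : s = 1 := by omega
    have ht1 : t = 1 := by omega
    have := h.star s t hs hs' ht ht' hst
    subst hs1 ht1
    rw [← this]
    push_cast
    module
  order := h.order

lemma ne (h : Shape φ m n x S U V A B C D i j k l) (hn : 2 ≤ n) : U ≠ V := by
  rintro rfl
  have h1 := h.order 1 (by simp)
  have := Nat.le_of_dvd one_pos (show n ∣ 1 by exact_mod_cast h1)
  omega

lemma mem_left (h : Shape φ m n x S U V A B C D i j k l) (hn : 2 ≤ n) :
    m • A = U ∨ m • B = U ∨ m • C = U ∨ m • D = U := by
  have h1 : U ∈ Multiset.replicate (n - 1) U + Multiset.replicate (n - 1) V :=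
    Multiset.mem_add.2 (Or.inl (Multiset.mem_replicate.2 ⟨by omega, rfl⟩))
  rw [← h.sums] at h1
  simp only [Multiset.mem_add, Multiset.mem_replicate] at h1
  tauto

lemma mem_right (h : Shape φ m n x S U V A B C D i j k l) (hn : 2 ≤ n) :
    m • A = V ∨ m • B = V ∨ m • C = V ∨ m • D = V :=
  h.symm.mem_left hn

lemma card_eq (h : Shape φ m n x S U V A B C D i j k l) : i + j + k + l = 2 * (n - 1) := by
  have := congrArg Multiset.card h.sums
  simp only [Multiset.card_add, Multiset.card_replicate] at this
  omega

lemma count_left [DecidableEq G] (h : Shape φ m n x S U V A B C D i j k l) (hn : 2 ≤ n) :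
    (if m • A = U then i else 0) + (if m • B = U then j else 0) +
      (if m • C = U then k else 0) + (if m • D = U then l else 0) = n - 1 := by
  have := congrArg (Multiset.count U) h.sums
  simpa only [Multiset.count_add, Multiset.count_replicate, if_neg (h.ne hn).symm, if_true,
    add_zero] using this

lemma order_sub (h : Shape φ m n x S U V A B C D i j k l) (hA : m • A = U) (hC : m • C = V)
    (r : ℤ) (hr : r • ((m : ℤ) • (C - A)) = 0) : (n : ℤ) ∣ r := by
  refine h.order r ?_
  rw [← hA, ← hC, ← neg_eq_zero, ← hr, ← natCast_zsmul, ← natCast_zsmul]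
  module

lemma standard_of_eq (h : Shape φ m n x S U V A B C D i j k l) (hn : 2 ≤ n) (hA : m • A = U)
    (hC : m • C = V) (hB : m • B = U) (hD : m • D = V)
    (hQ : D = C - (x : ℤ) • (B - A)) : Standard φ m n S := by
  classical
  refine ⟨x, A, B, C, D, i, j, k, l, h.conf, h.eq, h.order_sub hA hC, Or.inl ⟨?_, hQ, ?_⟩⟩
  · rw [smul_sub, natCast_zsmul, natCast_zsmul, hA, hB, sub_self]
  · have h1 := h.count_left hn
    have h2 := h.card_eq
    simp only [hA, hB, hC, hD, if_true, if_neg (h.ne hn).symm] at h1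
    omega

lemma standard_of_eq_one (h : Shape φ m n 1 S U V A B C D i j k l) (hn : 2 ≤ n) (hA : m • A = U)
    (hC : m • C = V) (hQ : B + D = A + C) : Standard φ m n S := by
  classical
  have hne := h.ne hn
  have hBD : m • B + m • D = U + V := by rw [← smul_add, hQ, smul_add, hA, hC]
  have h1 := h.count_left hn
  have h2 := h.card_eq
  have h3 := h.symm.count_left hn
  by_cases hB : m • B = U
  · rw [hB, add_right_inj] at hBD
    refine h.standard_of_eq hn hA hC hB hBD ?_
    linear_combination (norm := (push_cast; module)) hQ
  by_cases hB' : m • B = V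
  · rw [hB', add_comm U, add_right_inj] at hBD
    refine ⟨1, A, D, C, B, i, l, k, j, h.conf.cross, by rw [h.eq]; abel, h.order_sub hA hC,
      Or.inl ⟨?_, ?_, ?_⟩⟩
    · rw [smul_sub, natCast_zsmul, natCast_zsmul, hA, hBD, sub_self]
    · linear_combination (norm := (push_cast; module)) hQ
    · simp only [hA, hB', hC, hBD, if_true, if_neg hne.symm] at h1
      omega
  · have hD : m • D ≠ U := by
      intro hD
      rw [hD, add_comm U, add_left_inj] at hBD
      exact hB' hBD
    have hD' : m • D ≠ V := by
      intro hD
      rw [hD, add_left_inj] at hBD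
      exact hB hBD
    simp only [hA, hC, if_true, if_neg hne.symm, if_neg hne, if_neg hB, if_neg hB', if_neg hD,
      if_neg hD'] at h1 h3
    exact ⟨1, A, B, C, D, i, j, k, l, h.conf, h.eq, h.order_sub hA hC,
      Or.inr ⟨hQ, by omega, by omega, by omega, by omega⟩⟩

lemma standard_one (h : Shape φ m n 1 S U V A B C D i j k l) (hexp : ∀ g : H, m • g = 0)
    (hm : 3 ≤ m) (hn : 2 ≤ n) : Standard φ m n S := by
  have h1 := h.star 1 1 le_rfl (by omega) le_rfl (by omega) (by simp)
  have h2 := h.star 2 2 (by omega) (by omega) (by omega) (by omega) (by simp)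
  have hQ : B + D = A + C := by
    linear_combination (norm := (push_cast; module)) h2 - h1
  have hAC : m • A + m • C = U + V := by
    rw [← natCast_zsmul, ← natCast_zsmul]
    linear_combination (norm := (push_cast; module)) h1 - hQ
  have hBD : m • B + m • D = U + V := by rw [← smul_add, hQ, smul_add, hAC]
  rcases h.mem_left hn with hX | hX | hX | hX
  · exact h.standard_of_eq_one hn hX (by rwa [hX, add_right_inj] at hAC) hQ
  · exact h.flip.standard_of_eq_one hn hX (by rwa [hX, add_right_inj] at hBD) hQ.symm
  · exact (h.pair_one hexp).standard_of_eq_one hn hX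
      (by rwa [hX, add_comm, add_right_inj] at hAC) (by rw [add_comm, hQ, add_comm])
  · exact (h.pair_one hexp).flip.standard_of_eq_one hn hX
      (by rwa [hX, add_comm, add_right_inj] at hBD) (by rw [add_comm C, ← hQ, add_comm])

lemma standard_two_of_eq (h : Shape φ 2 n 1 S U V A B C D i j k l) (hn : 2 ≤ n)
    (hA : 2 • A = U) (hC : 2 • C = V) : Standard φ 2 n S := by
  have h1 := h.star 1 1 le_rfl (by omega) le_rfl (by omega) (by simp)
  refine h.standard_of_eq_one hn hA hC ?_
  rw [← hA, ← hC] at h1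
  linear_combination (norm := (push_cast; module)) h1

lemma standard_two_of_left (h : Shape φ 2 n 1 S U V A B C D i j k l)
    (hexp : ∀ g : H, 2 • g = 0) (hn : 2 ≤ n) (hA : 2 • A = U) : Standard φ 2 n S := by
  rcases h.mem_right hn with hX | hX | hX | hX
  · exact absurd (hA.symm.trans hX) (h.ne hn)
  · exact (h.swap hexp).standard_two_of_eq hn hA hX
  · exact h.standard_two_of_eq hn hA hX
  · exact (((h.pair_one hexp).neg hexp le_rfl).pair_one hexp).standard_two_of_eq hn hA hX

lemma standard_two (h : Shape φ 2 n 1 S U V A B C D i j k l)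
    (hexp : ∀ g : H, 2 • g = 0) (hn : 2 ≤ n) : Standard φ 2 n S := by
  rcases h.mem_left hn with hX | hX | hX | hX
  · exact h.standard_two_of_left hexp hn hX
  · exact h.flip.standard_two_of_left hexp hn hX
  · exact (h.pair_one hexp).standard_two_of_left hexp hn hX
  · exact (h.pair_one hexp).flip.standard_two_of_left hexp hn hX

lemma standard_of_two_le (h : Shape φ m n x S U V A B C D i j k l)
    (hx : 2 ≤ x) (hxm : 2 * x < m) (hn : 2 ≤ n) : Standard φ m n S := by
  have h1 := h.star x 1 (by omega) (by omega) le_rfl (by omega) (by simp)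
  have h2 := h.star (2 * x) 2 (by omega) hxm (by omega) (by omega) (by push_cast; ring_nf; simp)
  have hQ : D = C - (x : ℤ) • (B - A) := by
    linear_combination (norm := (push_cast; module)) h2 - h1
  have hAC : m • A + m • C = U + V := by
    rw [← natCast_zsmul, ← natCast_zsmul]
    linear_combination (norm := (push_cast; module)) h1 - hQ
  have hP : (m : ℤ) • (B - A) = 0 := by
    have hdiv := Nat.div_add_mod m x
    have hlt := Nat.mod_lt m (show 0 < x by omega)
    generalize hr : m % x = r at *
    generalize m / x = q at *
    have hq : 2 * q ≤ x * q := Nat.mul_le_mul_right _ hx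
    have h3 := h.star (x - r) (q + 1) (by omega) (by omega) (by omega) (by omega) (by
      refine ⟨-1, ?_⟩
      rw [Nat.cast_sub hlt.le, ← hdiv]
      push_cast
      ring)
    have hm : (m : ℤ) = x * q + r := by rw [← hdiv]; push_cast; ring
    rw [Nat.cast_sub hlt.le] at h3
    rw [← natCast_zsmul, ← natCast_zsmul] at hAC
    rw [hm] at h3 hAC ⊢
    linear_combination (norm := (push_cast; module)) hAC - h3 + ((q : ℤ) + 1) • hQ
  have hB : m • B = m • A := by
    rw [← natCast_zsmul, ← natCast_zsmul]
    linear_combination (norm := module) hP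
  have hD : m • D = m • C := by
    rw [← natCast_zsmul, ← natCast_zsmul]
    linear_combination (norm := module) (m : ℤ) • hQ - (x : ℤ) • hP
  have key : ∀ {U V : G}, Shape φ m n x S U V A B C D i j k l → m • A + m • C = U + V →
      m • A = U → Standard φ m n S := by
    intro U V h hAC hA
    rw [hA, add_right_inj] at hAC
    exact h.standard_of_eq hn hA hAC (hB.trans hA) (hD.trans hAC) hQ
  have key' : m • C = U → Standard φ m n S := by
    intro hC
    rw [hC, add_comm, add_right_inj] at hAC
    exact key h.symm (by rw [hC, hAC, add_comm]) hAC
  rcases h.mem_left hn with hX | hX | hX | hX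
  · exact key h hAC hX
  · exact key h hAC (hB.symm.trans hX)
  · exact key' hX
  · exact key' (hD.symm.trans hX)

lemma standard_of_two_mul_le (h : Shape φ m n x S U V A B C D i j k l)
    (hexp : ∀ g : H, m • g = 0) (hm : 2 ≤ m) (hxm : 2 * x ≤ m) (hn : 2 ≤ n) :
    Standard φ m n S := by
  have hx := h.conf.pos hm
  rcases hx.eq_or_lt with rfl | hx2
  · rcases hm.eq_or_lt with rfl | hm3
    · exact h.standard_two hexp hn
    · exact h.standard_one hexp hm3 hn
  · refine h.standard_of_two_le hx2 (hxm.lt_of_ne ?_) hn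
    rintro rfl
    have := h.conf.coprime
    rw [Nat.Coprime, Nat.gcd_mul_left_right] at this
    omega

lemma standard (h : Shape φ m n x S U V A B C D i j k l)
    (hexp : ∀ g : H, m • g = 0) (hm : 2 ≤ m) (hn : 2 ≤ n) : Standard φ m n S := by
  rcases le_or_gt (2 * x) m with hx | hx
  · exact h.standard_of_two_mul_le hexp hm hx hn
  · exact (h.neg hexp hm).standard_of_two_mul_le hexp hm (by omega) hn

end Shape

/-! ### Sequences over `C_m ⊕ C_{mn}` -/

/-- Reduction `C_m ⊕ C_{mn} → C_m ⊕ C_m`. -/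
def red (m n : ℕ) : ZMod m × ZMod (m * n) →+ ZMod m × ZMod m :=
  (AddMonoidHom.id (ZMod m)).prodMap (redHom m n)

lemma nsmul_eq_zero_prod_mul (m n : ℕ) (g : ZMod m × ZMod (m * n)) : (m * n) • g = 0 := by
  ext
  · rw [Prod.smul_fst, nsmul_eq_mul, Nat.cast_mul, ZMod.natCast_self]; simp
  · rw [Prod.smul_snd, nsmul_eq_mul, ZMod.natCast_self]; simp

lemma mulHom_injective {a b : ℕ} (ha : 1 ≤ a) (hb : 1 ≤ b) : Function.Injective (mulHom a b) := by
  have : NeZero b := ⟨by omega⟩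
  rw [injective_iff_map_eq_zero]
  intro j hj
  rw [← ZMod.natCast_zmod_val j, mulHom_natCast, ZMod.natCast_eq_zero_iff] at hj
  rw [← ZMod.natCast_zmod_val j, ZMod.natCast_eq_zero_iff]
  exact Nat.dvd_of_mul_dvd_mul_left ha hj

lemma mulHom_divMap_eq {m n : ℕ} (hm : 1 ≤ m) (hn : 1 ≤ n) {g : ZMod m × ZMod (m * n)}
    (hg : red m n g = 0) : (0, mulHom m n (divMap m n g.2)) = g :=
  Prod.ext (congrArg Prod.fst hg).symm (mulHom_divMap hm hn (congrArg Prod.snd hg))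

lemma red_one_injective {m : ℕ} (hm : 1 ≤ m) : Function.Injective (red m 1) := by
  rw [injective_iff_map_eq_zero]
  intro g hg
  rw [← mulHom_divMap_eq hm le_rfl hg, Subsingleton.elim (divMap m 1 g.2) 0, map_zero]
  rfl

lemma standard_of_noZS_one {m : ℕ} (hm : 2 ≤ m) (hG : Good (ZMod m × ZMod m) m 4)
    {S : Multiset (ZMod m × ZMod (m * 1))} (hc : S.card = 4 * (m - 1)) (hS : NoZS m S) :
    Standard (red m 1) m 1 S := by
  have hinj := red_one_injective (m := m) (by omega)
  obtain ⟨x, a, b, c, d, h, hT⟩ := exists_conf hm hG (T := S.map (red m 1)) (by simpa using hc) (by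
    intro T hT hTc hT0
    obtain ⟨U, hU, rfl⟩ := exists_le_of_le_map hT
    refine hS U hU (by simpa using hTc) (hinj ?_)
    rw [map_multiset_sum, hT0, map_zero])
  have hm1 : m - 1 ≠ 0 := by omega
  have hmem : ∀ e ∈ S.map (red m 1), ∃ E, red m 1 E = e := by
    intro e he
    obtain ⟨E, -, hE⟩ := Multiset.mem_map.1 he
    exact ⟨E, hE⟩
  obtain ⟨A, rfl⟩ := hmem a (by rw [hT]; simp [Multiset.mem_replicate, hm1])
  obtain ⟨B, rfl⟩ := hmem b (by rw [hT]; simp [Multiset.mem_replicate, hm1])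
  obtain ⟨C, rfl⟩ := hmem c (by rw [hT]; simp [Multiset.mem_replicate, hm1])
  obtain ⟨D, rfl⟩ := hmem d (by rw [hT]; simp [Multiset.mem_replicate, hm1])
  refine ⟨x, A, B, C, D, 0, 0, 0, 0, h, ?_, fun r _ => by simp, Or.inl ⟨?_, ?_, rfl, rfl⟩⟩
  · refine Multiset.map_injective hinj ?_
    rw [hT]
    simp
  · have := nsmul_eq_zero_prod_mul m 1 (B - A)
    rw [natCast_zsmul]
    simpa only [mul_one] using this
  · refine hinj ?_
    rw [map_sub, map_zsmul, map_sub]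
    linear_combination (norm := module) h.eq

lemma standard_of_noZS {m n : ℕ} (hm : 2 ≤ m) (hn : 1 ≤ n)
    (h7 : ∀ p : ℕ, p.Prime → p ∣ m → p ≤ 7) {S : Multiset (ZMod m × ZMod (m * n))}
    (hc : S.card = 2 * m + 2 * (m * n) - 4) (hS : NoZS (m * n) S) :
    Standard (red m n) m n S := by
  have hG := good_prod m (by omega) h7
  have hmn : 2 * m + 2 * (m * n) - 4 = 4 * (m - 1) + 2 * (n - 1) * m := by
    obtain ⟨n, rfl⟩ : ∃ l, n = l + 1 := ⟨n - 1, by omega⟩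
    rw [Nat.add_sub_cancel, show 2 * n * m = 2 * (m * n) by ring, mul_add]
    omega
  rcases hn.eq_or_lt with rfl | hn2
  · exact standard_of_noZS_one hm hG (by rw [hc, hmn]; simp) (by simpa only [mul_one] using hS)
  · have F : Frame (red m n) ((AddMonoidHom.inr (ZMod m) (ZMod (m * n))).comp (mulHom m n))
        (fun g => divMap m n g.2) m 4 n 2 S :=
      ⟨hG, good_cyclic n hn, hm, fun g hg => mulHom_divMap_eq (by omega) hn hg,
        hc.trans hmn, hS⟩
    obtain ⟨x, U, V, A, B, C, D, i, j, k, l, h⟩ := F.exists_shape hn2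
      (fun s t hst => mulHom_injective (by omega) hn (congrArg Prod.snd hst))
      nsmul_eq_zero_prod fun T hTc hT => exists_conf hm hG hTc hT
    exact h.standard nsmul_eq_zero_prod hm hn2

section

variable {m n : ℕ} {e f : ZMod m × ZMod (m * n)}

lemma closure_pair_eq_top (hm : 1 ≤ m) (hn : 1 ≤ n)
    (he : ∀ i j : ℤ, i • e + j • f = 0 → (m : ℤ) ∣ i)
    (hf : ∀ j : ℤ, j • f = 0 → ((m * n : ℕ) : ℤ) ∣ j) :
    AddSubgroup.closure ({e, f} : Set (ZMod m × ZMod (m * n))) = ⊤ := by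
  have : NeZero m := ⟨by omega⟩
  have : NeZero (m * n) := ⟨(Nat.mul_pos hm hn).ne'⟩
  have hinj : Function.Injective fun s : ZMod m × ZMod (m * n) =>
      (s.1.val : ℤ) • e + (s.2.val : ℤ) • f := by
    intro s t hst
    have aux : ∀ {k : ℕ} [NeZero k] (y z : ZMod k), (k : ℤ) ∣ y.val - z.val → y = z := by
      intro k _ y z hyz
      have := (ZMod.intCast_zmod_eq_zero_iff_dvd _ _).2 hyz
      simpa [sub_eq_zero] using this
    have h1 := aux _ _ (he (s.1.val - t.1.val) (s.2.val - t.2.val) (by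
      rw [← sub_eq_zero.2 hst]; module))
    refine Prod.ext h1 (aux _ _ (hf _ ?_))
    have h2 : (s.1.val : ℤ) • e + (s.2.val : ℤ) • f = (t.1.val : ℤ) • e + (t.2.val : ℤ) • f := hst
    rw [h1, add_right_inj] at h2
    rw [sub_smul, h2, sub_self]
  rw [eq_top_iff]
  intro g _
  obtain ⟨s, rfl⟩ := Finite.injective_iff_surjective.1 hinj g
  exact add_mem (AddSubgroup.zsmul_mem _ (AddSubgroup.subset_closure (by simp)) _)
    (AddSubgroup.zsmul_mem _ (AddSubgroup.subset_closure (by simp)) _)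

lemma addOrderOf_eq (h : ∀ j : ℤ, j • f = 0 → ((m * n : ℕ) : ℤ) ∣ j) :
    addOrderOf f = m * n := by
  refine Nat.dvd_antisymm (addOrderOf_dvd_of_nsmul_eq_zero (nsmul_eq_zero_prod_mul m n f)) ?_
  have := h (addOrderOf f) (by rw [natCast_zsmul, addOrderOf_nsmul_eq_zero])
  exact_mod_cast this

/-- If `e` and `f` generate and `f` has order `mn`, then `e` has order `m` modulo `f`. -/
lemma dvd_of_zsmul_add_zsmul_eq_zero (hm : 1 ≤ m) (hn : 1 ≤ n)
    (hcl : AddSubgroup.closure ({e, f} : Set (ZMod m × ZMod (m * n))) = ⊤)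
    (hf : addOrderOf f = m * n) {i j : ℤ} (h : i • e + j • f = 0) : (m : ℤ) ∣ i := by
  have : NeZero m := ⟨by omega⟩
  have : NeZero (m * n) := ⟨(Nat.mul_pos hm hn).ne'⟩
  set N := AddSubgroup.zmultiples f
  have hcard : Nat.card ((ZMod m × ZMod (m * n)) ⧸ N) = m := by
    have h1 := AddSubgroup.card_eq_card_quotient_mul_card_addSubgroup N
    rw [Nat.card_zmultiples, hf, Nat.card_prod, Nat.card_zmod, Nat.card_zmod] at h1
    exact (Nat.eq_of_mul_eq_mul_right (Nat.mul_pos hm hn) h1).symm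
  have hgen : AddSubgroup.zmultiples (QuotientAddGroup.mk' N e) = ⊤ := by
    have h1 := congrArg (AddSubgroup.map (QuotientAddGroup.mk' N)) hcl
    rw [AddMonoidHom.map_closure, Set.image_pair,
      AddSubgroup.map_top_of_surjective _ (QuotientAddGroup.mk'_surjective N)] at h1
    rw [← h1, AddSubgroup.zmultiples_eq_closure]
    have hf0 : QuotientAddGroup.mk' N f = 0 :=
      (QuotientAddGroup.eq_zero_iff f).2 (AddSubgroup.mem_zmultiples f)
    rw [hf0, Set.pair_comm, AddSubgroup.closure_insert_zero]
  have hord : addOrderOf (QuotientAddGroup.mk' N e) = m := by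
    rw [← Nat.card_zmultiples, hgen, AddSubgroup.card_top, hcard]
  rw [← hord, addOrderOf_dvd_iff_zsmul_eq_zero, ← map_zsmul]
  refine (QuotientAddGroup.eq_zero_iff _).2 ?_
  rw [eq_neg_of_add_eq_zero_left h]
  exact neg_mem (AddSubgroup.zsmul_mem_zmultiples f j)

end

lemma Standard.eq_replicate {m n : ℕ} (hm : 2 ≤ m) (hn : 0 < n)
    {S : Multiset (ZMod m × ZMod (m * n))} (hS : Standard (red m n) m n S) :
    (∃ (e1 e2 g : ZMod m × ZMod (m * n)) (x : ℤ) (s t : ℕ),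
        (∀ a b : ℤ, a • e1 + b • e2 = 0 → a • e1 = 0 ∧ b • e2 = 0) ∧
        AddSubgroup.closure ({e1, e2} : Set (ZMod m × ZMod (m * n))) = ⊤ ∧
        addOrderOf e2 = m * n ∧ Int.gcd x m = 1 ∧
        1 ≤ s ∧ s ≤ n ∧ 1 ≤ t ∧ t ≤ n ∧
        S = Multiset.replicate (t * m - 1) g +
              Multiset.replicate ((n + 1 - t) * m - 1) (e1 + g) +
              Multiset.replicate (s * m - 1) (e2 + g) +
              Multiset.replicate ((n + 1 - s) * m - 1) ((-x) • e1 + e2 + g)) ∨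
      (∃ g1 g2 g : ZMod m × ZMod (m * n),
        AddSubgroup.closure ({g1, g2} : Set (ZMod m × ZMod (m * n))) = ⊤ ∧
        addOrderOf g2 = m * n ∧
        S = Multiset.replicate (m * n - 1) g +
              Multiset.replicate (m - 1) (g1 + g) +
              Multiset.replicate (m * n - 1) (g2 + g) +
              Multiset.replicate (m - 1) (-g1 + g2 + g)) := by
  obtain ⟨x, A, B, C, D, i, j, k, l, hconf, hS, hord, hcase⟩ := hS
  have hdvd : ∀ i j : ℤ, i • (B - A) + j • (C - A) = 0 → (m : ℤ) ∣ i ∧ (m : ℤ) ∣ j := by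
    intro i j hij
    refine hconf.indep i j ?_
    rw [← map_sub, ← map_sub, ← map_zsmul, ← map_zsmul, ← map_add, hij, map_zero]
  have hdvdC : ∀ j : ℤ, j • (C - A) = 0 → ((m * n : ℕ) : ℤ) ∣ j := by
    intro j hj
    obtain ⟨r, rfl⟩ := (hdvd 0 j (by rw [hj]; simp)).2
    rw [Nat.cast_mul]
    refine mul_dvd_mul_left _ (hord r ?_)
    rw [smul_smul, mul_comm r, hj]
  have hcl := closure_pair_eq_top (by omega) hn (fun i j hij => (hdvd i j hij).1) hdvdC
  rcases hcase with ⟨hB, hD, hij, hkl⟩ | ⟨hD, rfl, rfl, rfl, rfl⟩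
  · have hB' : ∀ i : ℤ, (m : ℤ) ∣ i → i • (B - A) = 0 := by
      rintro i ⟨r, rfl⟩
      rw [mul_comm _ r, mul_smul, hB, smul_zero]
    have hind : ∀ i j : ℤ, i • (B - A) + j • (C - A) = 0 → i • (B - A) = 0 ∧ j • (C - A) = 0 := by
      intro i j hij
      have h1 := hB' i (hdvd i j hij).1
      rw [h1, zero_add] at hij
      exact ⟨h1, hij⟩
    refine Or.inl ⟨B - A, C - A, A, x, k + 1, i + 1, hind, hcl, addOrderOf_eq hdvdC, ?_, by omega,
      by omega, by omega, by omega, ?_⟩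
    · rw [Int.gcd_natCast_natCast]; exact hconf.coprime
    · rw [show n + 1 - (i + 1) = j + 1 by omega, show n + 1 - (k + 1) = l + 1 by omega, hS, hD,
        show -(x : ℤ) • (B - A) + (C - A) + A = C - (x : ℤ) • (B - A) by module, sub_add_cancel,
        sub_add_cancel]
  · refine Or.inr ⟨B - A, C - A, A, hcl, addOrderOf_eq hdvdC, ?_⟩
    rw [hS, show -(B - A) + (C - A) + A = A + C - B by abel, ← hD, add_sub_cancel_left,
      Nat.sub_add_cancel (show 1 ≤ n from hn), sub_add_cancel, sub_add_cancel, mul_comm n]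
    simp

lemma exists_replicate_add_of_le {α : Type*} [DecidableEq α] {k : ℕ} {a : α} {T X : Multiset α}
    (h : T ≤ X + Multiset.replicate k a) :
    ∃ U ≤ X, ∃ i ≤ k, T = U + Multiset.replicate i a := by
  refine ⟨T - Multiset.replicate k a, by rwa [tsub_le_iff_right], min k (T.count a),
    min_le_left _ _, Multiset.ext.2 fun b => ?_⟩
  rw [Multiset.count_add, Multiset.count_sub, Multiset.count_replicate, Multiset.count_replicate]
  split_ifs with hb
  · subst hb
    omega
  · omega

lemma exists_replicate_of_le {α : Type*} [DecidableEq α] {a b c d : α} {i j k l : ℕ}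
    {T : Multiset α} (h : T ≤ Multiset.replicate i a + Multiset.replicate j b +
      Multiset.replicate k c + Multiset.replicate l d) :
    ∃ i' ≤ i, ∃ j' ≤ j, ∃ k' ≤ k, ∃ l' ≤ l, T = Multiset.replicate i' a +
      Multiset.replicate j' b + Multiset.replicate k' c + Multiset.replicate l' d := by
  obtain ⟨T₁, h₁, l', hl, rfl⟩ := exists_replicate_add_of_le h
  obtain ⟨T₂, h₂, k', hk, rfl⟩ := exists_replicate_add_of_le h₁
  obtain ⟨T₃, h₃, j', hj, rfl⟩ := exists_replicate_add_of_le h₂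
  obtain ⟨i', hi, rfl⟩ := Multiset.le_replicate_iff.1 h₃
  exact ⟨i', hi, j', hj, k', hk, l', hl, rfl⟩

lemma sum_replicate_four {G : Type*} [AddCommGroup G] {N : ℕ} (hexp : ∀ g : G, N • g = 0)
    {e f g : G} {x : ℤ} {i j k l : ℕ} (hc : i + j + k + l = N)
    (h : (Multiset.replicate i g + Multiset.replicate j (e + g) + Multiset.replicate k (f + g) +
      Multiset.replicate l (-x • e + f + g)).sum = 0) :
    (j - x * l : ℤ) • e + (k + l : ℤ) • f = 0 := by
  simp only [Multiset.sum_add, Multiset.sum_replicate, ← natCast_zsmul] at h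
  have h1 := hexp g
  rw [← hc, ← natCast_zsmul] at h1
  linear_combination (norm := (push_cast; module)) h - h1

lemma not_dvd_of_add_eq {m n a b p q : ℕ} (hp : p ≤ a * m - 1) (hq : q ≤ b * m - 1)
    (ha : 1 ≤ a) (hb : 1 ≤ b) (hm : 1 ≤ m) (hab : a + b = n + 1) (hpq : p + q = m * n) :
    ¬ m ∣ p := by
  intro h
  have h2 : m ∣ q := (Nat.dvd_add_right h).1 (hpq ▸ dvd_mul_right m n)
  obtain ⟨p, rfl⟩ := h
  obtain ⟨q, rfl⟩ := h2
  have ham := Nat.mul_pos ha hm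
  have hbm := Nat.mul_pos hb hm
  have h3 : p < a := by
    by_contra! hcon
    have := Nat.mul_le_mul_left m hcon
    rw [mul_comm a] at *
    omega
  have h4 : q < b := by
    by_contra! hcon
    have := Nat.mul_le_mul_left m hcon
    rw [mul_comm b] at *
    omega
  rw [← mul_add] at hpq
  have := Nat.eq_of_mul_eq_mul_left hm hpq
  omega

lemma eq_zero_or_eq_of_dvd {N p : ℕ} (h : N ∣ p) (hp : p ≤ N) : p = 0 ∨ p = N := by
  rcases Nat.eq_zero_or_pos p with h0 | h0
  · exact Or.inl h0
  · exact Or.inr (le_antisymm hp (Nat.le_of_dvd h0 h))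

section

variable {m n : ℕ}

lemma noZS_basis (hm : 1 ≤ m) (hn : 1 ≤ n) {e f g : ZMod m × ZMod (m * n)} {x : ℤ} {s t : ℕ}
    (hind : ∀ a b : ℤ, a • e + b • f = 0 → a • e = 0 ∧ b • f = 0)
    (hcl : AddSubgroup.closure ({e, f} : Set (ZMod m × ZMod (m * n))) = ⊤)
    (hf : addOrderOf f = m * n) (hx : Int.gcd x m = 1) (hs : 1 ≤ s) (hs' : s ≤ n) (ht : 1 ≤ t)
    (ht' : t ≤ n) :
    NoZS (m * n) (Multiset.replicate (t * m - 1) g +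
      Multiset.replicate ((n + 1 - t) * m - 1) (e + g) +
      Multiset.replicate (s * m - 1) (f + g) +
      Multiset.replicate ((n + 1 - s) * m - 1) ((-x) • e + f + g)) := by
  intro T hT hc h0
  obtain ⟨i, hi, j, hj, k, hk, l, hl, rfl⟩ := exists_replicate_of_le hT
  simp only [Multiset.card_add, Multiset.card_replicate] at hc
  have h1 := sum_replicate_four (nsmul_eq_zero_prod_mul m n) hc h0
  have h2 := dvd_of_zsmul_add_zsmul_eq_zero hm hn hcl hf h1
  have h3 : m * n ∣ k + l := by
    rw [← hf, addOrderOf_dvd_iff_nsmul_eq_zero, ← natCast_zsmul, Nat.cast_add]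
    exact (hind _ _ h1).2
  rcases eq_zero_or_eq_of_dvd h3 (by omega) with h4 | h4
  · obtain ⟨rfl, rfl⟩ : k = 0 ∧ l = 0 := by omega
    refine not_dvd_of_add_eq (n := n) hj hi (by omega) ht hm (by omega) (by omega) ?_
    simpa [Int.natCast_dvd_natCast] using h2
  · obtain ⟨rfl, rfl⟩ : i = 0 ∧ j = 0 := by omega
    refine not_dvd_of_add_eq (n := n) hl hk (by omega) hs hm (by omega) (by omega) ?_
    rw [Nat.cast_zero, zero_sub, dvd_neg] at h2
    have := (Int.isCoprime_iff_gcd_eq_one.2 hx).symm.dvd_of_dvd_mul_left h2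
    exact_mod_cast this

lemma noZS_generators (hm : 1 ≤ m) (hn : 1 ≤ n) {e f g : ZMod m × ZMod (m * n)}
    (hcl : AddSubgroup.closure ({e, f} : Set (ZMod m × ZMod (m * n))) = ⊤)
    (hf : addOrderOf f = m * n) :
    NoZS (m * n) (Multiset.replicate (m * n - 1) g + Multiset.replicate (m - 1) (e + g) +
      Multiset.replicate (m * n - 1) (f + g) + Multiset.replicate (m - 1) (-e + f + g)) := by
  intro T hT hc h0
  have hmn := Nat.mul_pos hm hn
  obtain ⟨i, hi, j, hj, k, hk, l, hl, rfl⟩ := exists_replicate_of_le hT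
  simp only [Multiset.card_add, Multiset.card_replicate] at hc
  have h1 := sum_replicate_four (x := 1) (nsmul_eq_zero_prod_mul m n) hc
    (by rwa [neg_one_smul])
  obtain ⟨z, hz⟩ := dvd_of_zsmul_add_zsmul_eq_zero hm hn hcl hf h1
  have hjl : j = l := by
    have := Int.eq_zero_of_abs_lt_dvd (m := m) (x := j - l) ⟨z, by rw [← hz, one_mul]⟩
      (by rw [abs_lt]; omega)
    omega
  subst hjl
  have h3 : m * n ∣ k + j := by
    rw [← hf, addOrderOf_dvd_iff_nsmul_eq_zero, ← natCast_zsmul, Nat.cast_add]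
    simpa using h1
  rcases eq_zero_or_eq_of_dvd h3 (by omega) with h4 | h4 <;> omega

lemma card_basis (hm : 1 ≤ m) {s t : ℕ} (hs : 1 ≤ s) (hs' : s ≤ n) (ht : 1 ≤ t) (ht' : t ≤ n) :
    t * m - 1 + ((n + 1 - t) * m - 1) + (s * m - 1) + ((n + 1 - s) * m - 1) =
      2 * m + 2 * (m * n) - 4 := by
  have aux : ∀ t, 1 ≤ t → t ≤ n → t * m - 1 + ((n + 1 - t) * m - 1) + 2 = m + m * n := by
    intro t ht ht'
    have h1 : t * m + (n + 1 - t) * m = m + m * n := by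
      rw [← add_mul, Nat.add_sub_cancel' (by omega)]
      ring
    have h2 := Nat.mul_pos ht hm
    have h3 := Nat.mul_pos (show 0 < n + 1 - t by omega) hm
    omega
  have h1 := aux t ht ht'
  have h2 := aux s hs hs'
  omega

end

end ZeroSum

/-- If no prime strictly greater than 7 divides `m`, then a sequence `S` over
`G = C_m ⊕ C_{mn}` has length `2m + 2mn - 4 = s(G) - 1` and no zero-sum subsequence of
length `mn = exp(G)` if and only if it is of form (a) or (b). -/
theorem stmt_7 (m n : ℕ) (hm : 2 ≤ m) (hn : 0 < n)
    (hprimes : ∀ p : ℕ, p.Prime → p ∣ m → p ≤ 7)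
    (S : Multiset (ZMod m × ZMod (m * n))) :
    (S.card = 2 * m + 2 * (m * n) - 4 ∧
      ¬ ∃ T ≤ S, T.sum = 0 ∧ Multiset.card T = m * n) ↔
    ((∃ (e1 e2 g : ZMod m × ZMod (m * n))  (x : ℤ) (s t : ℕ),
        (∀ a b : ℤ, a • e1 + b • e2 = 0 → a • e1 = 0 ∧ b • e2 = 0) ∧
        AddSubgroup.closure ({e1, e2} : Set (ZMod m × ZMod (m * n))) = ⊤ ∧
        addOrderOf e2 = m * n ∧ Int.gcd x m = 1 ∧
        1 ≤ s ∧ s ≤ n ∧ 1 ≤ t ∧ t ≤ n ∧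
        S = Multiset.replicate (t * m - 1) g +
              Multiset.replicate ((n + 1 - t) * m - 1) (e1 + g) +
              Multiset.replicate (s * m - 1) (e2 + g) +
              Multiset.replicate ((n + 1 - s) * m - 1) ((-x) • e1 + e2 + g)) ∨
      (∃ g1 g2 g : ZMod m × ZMod (m * n),
        AddSubgroup.closure ({g1, g2} : Set (ZMod m × ZMod (m * n))) = ⊤ ∧
        addOrderOf g2 = m * n ∧
        S = Multiset.replicate (m * n - 1) g +
              Multiset.replicate (m - 1) (g1 + g) +
              Multiset.replicate (m * n - 1) (g2 + g) +
              Multiset.replicate (m - 1) (-g1 + g2 + g))) := by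
  constructor
  · rintro ⟨hc, hS⟩
    exact (ZeroSum.standard_of_noZS hm hn hprimes hc
      fun T hT hTc hT0 => hS ⟨T, hT, hT0, hTc⟩).eq_replicate hm hn
  · rintro (⟨e, f, g, x, s, t, hind, hcl, hf, hx, hs, hs', ht, ht', rfl⟩ |
      ⟨e, f, g, hcl, hf, rfl⟩)
    · refine ⟨?_, fun ⟨T, hT, hT0, hTc⟩ => ZeroSum.noZS_basis (by omega) hn hind hcl hf hx hs hs'
        ht ht' T hT hTc hT0⟩
      simp only [Multiset.card_add, Multiset.card_replicate]
      exact ZeroSum.card_basis (by omega) hs hs' ht ht'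
    · refine ⟨?_, fun ⟨T, hT, hT0, hTc⟩ => ZeroSum.noZS_generators (by omega) hn hcl hf T hT hTc
        hT0⟩
      have := Nat.mul_le_mul hm (show 1 ≤ n from hn)
      simp only [Multiset.card_add, Multiset.card_replicate]
      omega
end

section
/- Let m, n be positive integers and let G = C_m ⊕ C_{mn}. Then η(G) = 2m + mn − 2; that is, every sequence over G of length at least 2m + mn − 2 has a short zero-sum subsequence (a nonempty zero-sum subsequence of length at most mn = exp(G)), and there exists a sequence over G of length 2m + mn − 3 with no short zero-sum subsequence. -/
namespace Multiset

theorem exists_le_map_eq {α β : Type*} {f : α → β} {S : Multiset α} {T : Multiset β}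
    (h : T ≤ S.map f) : ∃ U ≤ S, U.map f = T := by
  classical
  induction T using Multiset.induction generalizing S with
  | empty => exact ⟨0, S.zero_le, by simp⟩
  | cons a T ih =>
    obtain ⟨x, hx, rfl⟩ := mem_map.1 (mem_of_le h (mem_cons_self a T))
    obtain ⟨S', rfl⟩ := exists_cons_of_mem hx
    rw [map_cons, cons_le_cons_iff] at h
    obtain ⟨U, hU, rfl⟩ := ih h
    exact ⟨x ::ₘ U, cons_le_cons x hU, by simp⟩

theorem exists_le_card_eq_of_le {α : Type*} {S : Multiset α} {k : ℕ} (h : k ≤ S.card) :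
    ∃ U ≤ S, U.card = k := by
  induction S using Quotient.inductionOn with
  | h l =>
    exact ⟨(l.take k : List α), coe_le.2 (List.take_sublist k l).subperm, by simpa using h⟩

theorem exists_eq_add_of_le_add {α : Type*} {S A B : Multiset α} (h : S ≤ A + B) :
    ∃ A' ≤ A, ∃ B' ≤ B, S = A' + B' := by
  classical
  refine ⟨S ∩ A, inter_le_right, S - A, ?_, ?_⟩
  · rwa [tsub_le_iff_left]
  · rw [add_comm, sub_add_inter]

theorem sum_map_apply_eq_zero {α ι M : Type*} [AddCommMonoid M] {f : α → ι → M} {T : Multiset α}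
    (h : (T.map f).sum = 0) (i : ι) : (T.map fun x => f x i).sum = 0 := by
  have := congrArg (Pi.evalAddMonoidHom (fun _ : ι => M) i) h
  rwa [map_multiset_sum, map_map, _root_.map_zero] at this

end Multiset

/-- Every sequence over `G` of length at least `l` has a nonempty zero-sum subsequence of length
at most `L`. -/
def HasShortZeroSum (G : Type*) [AddCommGroup G] (L l : ℕ) : Prop :=
  ∀ S : Multiset G, l ≤ S.card → ∃ T ≤ S, T ≠ 0 ∧ T.sum = 0 ∧ T.card ≤ L

namespace HasShortZeroSum

variable {G H K : Type*} [AddCommGroup G] [AddCommGroup H] [AddCommGroup K]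

/-- Repeatedly splitting off short subsequences whose image under `φ` has sum zero. -/
theorem exists_disjoint {a l : ℕ} (hH : HasShortZeroSum H a l) (φ : G →+ H) (t : ℕ)
    (S : Multiset G) (hS : a * t + l ≤ S.card + a) :
    ∃ M : Multiset (Multiset G), M.card = t ∧ M.sum ≤ S ∧
      ∀ T ∈ M, T ≠ 0 ∧ φ T.sum = 0 ∧ T.card ≤ a := by
  classical
  induction t generalizing S with
  | zero => exact ⟨0, by simp, by simp, by simp⟩
  | succ t ih =>
    rw [mul_add, mul_one] at hS
    obtain ⟨_, hT, hT0, hTs, hTc⟩ := hH (S.map φ) (by rw [Multiset.card_map]; omega)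
    obtain ⟨T, hTS, rfl⟩ := Multiset.exists_le_map_eq hT
    rw [Multiset.card_map] at hTc
    have hcard := Multiset.card_sub hTS
    have hle := Multiset.card_le_card hTS
    obtain ⟨M, hMc, hMS, hM⟩ := ih (S - T) (by omega)
    refine ⟨T ::ₘ M, by simp [hMc], ?_, ?_⟩
    · rw [Multiset.sum_cons, ← add_tsub_cancel_of_le hTS]
      exact add_le_add_right hMS T
    · intro U hU
      rcases Multiset.mem_cons.1 hU with rfl | hU
      · refine ⟨?_, ?_, hTc⟩
        · rintro rfl
          simp at hT0
        · rw [map_multiset_sum, hTs]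
      · exact hM U hU

theorem extension {a l b k : ℕ} (hH : HasShortZeroSum H a l) (hK : HasShortZeroSum K b k)
    (φ : G →+ H) (ψ : K →+ G) (hφψ : ∀ x, φ x = 0 → ∃ y, ψ y = x) (r : ℕ)
    (hr : a * k + l ≤ r + a) : HasShortZeroSum G (a * b) r := by
  intro S hS
  obtain ⟨M, hMc, hMS, hM⟩ := hH.exists_disjoint φ k S (by omega)
  choose s hs using hφψ
  classical
  let f : Multiset G → K := fun T => if h : φ T.sum = 0 then s _ h else 0
  have hf : ∀ T ∈ M, ψ (f T) = T.sum := by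
    intro T hT
    simp only [f, dif_pos (hM T hT).2.1, hs]
  obtain ⟨_, hN, hN0, hNs, hNc⟩ := hK (M.map f) (by simp [hMc])
  obtain ⟨N, hNM, rfl⟩ := Multiset.exists_le_map_eq hN
  rw [Multiset.card_map] at hNc
  have hmem : ∀ T ∈ N, T ∈ M := fun T hT => Multiset.mem_of_le hNM hT
  refine ⟨N.sum, le_trans ?_ hMS, ?_, ?_, ?_⟩
  · rw [← add_tsub_cancel_of_le hNM, Multiset.sum_add]
    exact Multiset.le_add_right _ _
  · have hne : N ≠ 0 := by
      rintro rfl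
      simp at hN0
    obtain ⟨T, hT⟩ := Multiset.exists_mem_of_ne_zero hne
    obtain ⟨N', rfl⟩ := Multiset.exists_cons_of_mem hT
    rw [Multiset.sum_cons]
    intro h
    have := congrArg Multiset.card h
    have hpos := Multiset.card_pos.2 (hM T (hmem T hT)).1
    simp only [Multiset.card_add, Multiset.card_zero] at this
    omega
  · have h1 : N.sum.sum = (N.map Multiset.sum).sum :=
      map_multiset_sum (Multiset.sumAddMonoidHom : Multiset G →+ G) N
    have h2 : N.map Multiset.sum = (N.map f).map ψ := by
      rw [Multiset.map_map]
      exact Multiset.map_congr rfl fun T hT => (hf T (hmem T hT)).symm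
    rw [h1, h2, ← map_multiset_sum, hNs, map_zero]
  · have h1 : N.sum.card = (N.map Multiset.card).sum :=
      map_multiset_sum (Multiset.cardHom : Multiset G →+ ℕ) N
    have h2 := Multiset.sum_le_card_nsmul (N.map Multiset.card) a (by
      intro c hc
      obtain ⟨T, hT, rfl⟩ := Multiset.mem_map.1 hc
      exact (hM T (hmem T hT)).2.2)
    rw [Multiset.card_map, smul_eq_mul] at h2
    rw [h1, mul_comm]
    exact h2.trans (Nat.mul_le_mul_right a hNc)

end HasShortZeroSum

open MvPolynomial in
/-- The upper bound for the Davenport constant of an elementary abelian `p`-group. -/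
theorem exists_zero_sum_of_card_lt {ι : Type*} [Fintype ι] (p : ℕ) [Fact p.Prime]
    (S : Multiset (ι → ZMod p)) (hS : Fintype.card ι * (p - 1) < S.card) :
    ∃ T ≤ S, T ≠ 0 ∧ T.sum = 0 := by
  classical
  have hp1 : p - 1 ≠ 0 := Nat.sub_ne_zero_of_lt (Fact.out : p.Prime).one_lt
  let F : ι → MvPolynomial S.ToType (ZMod p) := fun i => ∑ j, C (j.1 i) * X j ^ (p - 1)
  have hdeg : (∑ i, (F i).totalDegree) < Fintype.card S.ToType := by
    rw [Multiset.card_coe]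
    refine lt_of_le_of_lt ?_ hS
    refine (Finset.sum_le_card_nsmul _ _ (p - 1) fun i _ => ?_).trans_eq (by simp)
    refine totalDegree_finsetSum_le fun j _ => ?_
    refine (totalDegree_mul _ _).trans ?_
    rw [totalDegree_C, zero_add, totalDegree_X_pow]
  have hdvd := char_dvd_card_solutions_of_fintype_sum_lt p hdeg
  have hzero : ∀ i, eval (0 : S.ToType → ZMod p) (F i) = 0 := fun i => by simp [F, hp1]
  have hlt : 1 < Fintype.card {x : S.ToType → ZMod p // ∀ i, eval x (F i) = 0} :=
    (Fact.out : p.Prime).one_lt.trans_le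
      (Nat.le_of_dvd (Fintype.card_pos_iff.2 ⟨⟨0, hzero⟩⟩) hdvd)
  obtain ⟨⟨x, hx⟩, hne⟩ := Fintype.exists_ne_of_one_lt_card hlt ⟨0, hzero⟩
  have hx0 : x ≠ 0 := fun h => hne (Subtype.ext h)
  obtain ⟨j, hj⟩ := Function.ne_iff.1 hx0
  refine ⟨(Finset.univ.filter fun j => x j ≠ 0).val.map fun j => j.1, ?_, ?_, ?_⟩
  · conv_rhs => rw [← Multiset.map_univ_coe S]
    exact Multiset.map_le_map (Finset.val_le_iff.2 (Finset.filter_subset _ _))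
  · rw [Ne, Multiset.map_eq_zero, Finset.val_eq_zero]
    exact Finset.ne_empty_of_mem (Finset.mem_filter.2 ⟨Finset.mem_univ j, hj⟩)
  · change (∑ j with x j ≠ 0, j.1) = 0
    funext i
    rw [Finset.sum_apply, Finset.sum_filter, Pi.zero_apply]
    refine Eq.trans ?_ (hx i)
    simp only [F, map_sum, map_mul, eval_C, map_pow, eval_X]
    refine Finset.sum_congr rfl fun j _ => ?_
    by_cases h : x j = 0
    · simp [h, hp1]
    · simp [h, ZMod.pow_card_sub_one_eq_one h]

theorem exists_zero_sum_prod_of_card_lt (p : ℕ) [Fact p.Prime] (S : Multiset (ZMod p × ZMod p))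
    (hS : 2 * (p - 1) < S.card) : ∃ T ≤ S, T ≠ 0 ∧ T.sum = 0 := by
  obtain ⟨_, hT, hT0, hTs⟩ :=
    exists_zero_sum_of_card_lt p (S.map fun g => ![g.1, g.2]) (by simpa using hS)
  obtain ⟨T, hTS, rfl⟩ := Multiset.exists_le_map_eq hT
  refine ⟨T, hTS, fun h => hT0 (by simp [h]), Prod.ext ?_ ?_⟩
  · exact (map_multiset_sum (AddMonoidHom.fst _ _) T).trans (Multiset.sum_map_apply_eq_zero hTs 0)
  · exact (map_multiset_sum (AddMonoidHom.snd _ _) T).trans (Multiset.sum_map_apply_eq_zero hTs 1)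

namespace HasShortZeroSum

theorem prime_prod (p : ℕ) [Fact p.Prime] : HasShortZeroSum (ZMod p × ZMod p) p (3 * p - 2) := by
  classical
  have hp : 2 ≤ p := (Fact.out : p.Prime).two_le
  intro S₀ hS₀
  obtain ⟨S, hSS₀, hS⟩ := Multiset.exists_le_card_eq_of_le hS₀
  obtain ⟨_, hT, hT0, hTs⟩ := exists_zero_sum_of_card_lt p (S.map fun g => ![g.1, g.2, 1])
    (by simp only [Fintype.card_fin, Multiset.card_map]; omega)
  obtain ⟨T, hTS, rfl⟩ := Multiset.exists_le_map_eq hT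
  have hT0' : T ≠ 0 := fun h => hT0 (by simp [h])
  have hsum : T.sum = 0 := by
    refine Prod.ext ?_ ?_
    · exact (map_multiset_sum (AddMonoidHom.fst _ _) T).trans (Multiset.sum_map_apply_eq_zero hTs 0)
    · exact (map_multiset_sum (AddMonoidHom.snd _ _) T).trans (Multiset.sum_map_apply_eq_zero hTs 1)
  have hdvd : p ∣ T.card := by
    have : (T.map fun _ => (1 : ZMod p)).sum = 0 := Multiset.sum_map_apply_eq_zero hTs 2
    rw [← ZMod.natCast_eq_zero_iff]
    simpa using this
  by_cases hle : T.card ≤ p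
  · exact ⟨T, hTS.trans hSS₀, hT0', hsum, hle⟩
  have hcard : T.card = 2 * p := by
    have h1 := Multiset.card_le_card hTS
    obtain ⟨c, hc⟩ := hdvd
    have hc1 : 1 < c := by
      by_contra! h
      exact hle (hc.trans_le (by simpa using Nat.mul_le_mul_left p h))
    have hc3 : c < 3 := by
      by_contra! h
      have := Nat.mul_le_mul_left p h
      omega
    obtain rfl : c = 2 := by omega
    omega
  obtain ⟨x, hx⟩ := Multiset.exists_mem_of_ne_zero hT0'
  have herase := Multiset.card_erase_add_one hx
  obtain ⟨U, hU, hU0, hUs⟩ := exists_zero_sum_prod_of_card_lt p (T.erase x) (by omega)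
  have hUc := Multiset.card_le_card hU
  have hUT : U ≤ T := hU.trans (Multiset.erase_le x T)
  by_cases hUp : U.card ≤ p
  · exact ⟨U, (hUT.trans hTS).trans hSS₀, hU0, hUs, hUp⟩
  have hsub := Multiset.card_sub hUT
  refine ⟨T - U, (tsub_le_self.trans hTS).trans hSS₀, ?_, ?_, by omega⟩
  · rw [← Multiset.card_pos]
    omega
  · have := congrArg Multiset.sum (add_tsub_cancel_of_le hUT)
    rwa [Multiset.sum_add, hUs, zero_add, hsum] at this

theorem zmod (n : ℕ) (hn : 0 < n) : HasShortZeroSum (ZMod n) n n := by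
  intro S hS
  obtain ⟨T, hT, hTc, hTs⟩ := ZMod.erdos_ginzburg_ziv_multiset
    (S + Multiset.replicate (n - 1) 0)
    (by simp only [Multiset.card_add, Multiset.card_replicate]; omega)
  obtain ⟨A, hA, B, hB, rfl⟩ := Multiset.exists_eq_add_of_le_add hT
  obtain ⟨k, hk, rfl⟩ := Multiset.le_replicate_iff.1 hB
  rw [Multiset.card_add, Multiset.card_replicate] at hTc
  refine ⟨A, hA, Multiset.card_pos.1 (by omega), by simpa using hTs, by omega⟩

end HasShortZeroSum

/-- Multiplication by `a`, as a map from `ℤ/b` to `ℤ/ab`. -/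
def ZMod.mulLeftHom (a b : ℕ) : ZMod b →+ ZMod (a * b) :=
  ZMod.lift b ⟨zmultiplesHom _ (a : ZMod (a * b)), by
    rw [zmultiplesHom_apply, natCast_zsmul, nsmul_eq_mul, mul_comm, ← Nat.cast_mul,
      ZMod.natCast_self]⟩

theorem ZMod.exists_mulLeftHom_eq {a b : ℕ} (x : ZMod (a * b))
    (hx : ZMod.castHom (dvd_mul_right a b) (ZMod a) x = 0) : ∃ y, ZMod.mulLeftHom a b y = x := by
  obtain ⟨z, rfl⟩ := ZMod.intCast_surjective x
  rw [map_intCast, ZMod.intCast_zmod_eq_zero_iff_dvd] at hx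
  obtain ⟨y, rfl⟩ := hx
  refine ⟨(y : ZMod b), ?_⟩
  rw [ZMod.mulLeftHom, ZMod.lift_coe]
  simp [mul_comm]

namespace HasShortZeroSum

theorem zmod_prod (m : ℕ) (hm : 0 < m) : HasShortZeroSum (ZMod m × ZMod m) m (3 * m - 2) := by
  induction m using induction_on_primes with
  | zero => omega
  | one =>
    intro S hS
    obtain ⟨x, hx⟩ := Multiset.exists_mem_of_ne_zero (Multiset.card_pos.1 hS)
    exact ⟨{x}, Multiset.singleton_le.2 hx, by simp, Subsingleton.elim _ _, by simp⟩
  | prime_mul p k hp ih =>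
    have : Fact p.Prime := ⟨hp⟩
    have hk : 0 < k := Nat.pos_of_mul_pos_left hm
    let φ := (ZMod.castHom (dvd_mul_right p k) (ZMod p)).toAddMonoidHom
    refine (prime_prod p).extension (ih hk) (φ.prodMap φ)
      ((ZMod.mulLeftHom p k).prodMap (ZMod.mulLeftHom p k)) ?_ _ ?_
    · rintro ⟨x, y⟩ h
      obtain ⟨u, hu⟩ := ZMod.exists_mulLeftHom_eq x (congrArg Prod.fst h)
      obtain ⟨v, hv⟩ := ZMod.exists_mulLeftHom_eq y (congrArg Prod.snd h)
      exact ⟨(u, v), Prod.ext hu hv⟩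
    · obtain ⟨k, rfl⟩ := Nat.exists_eq_succ_of_ne_zero hk.ne'
      have hp2 := hp.two_le
      have h1 : 3 * (k + 1) - 2 = 3 * k + 1 := by omega
      rw [Nat.succ_eq_add_one, h1, mul_add, mul_add, mul_left_comm]
      omega

theorem zmod_prod_mul (m n : ℕ) (hm : 0 < m) (hn : 0 < n) :
    HasShortZeroSum (ZMod m × ZMod (m * n)) (m * n) (2 * m + m * n - 2) := by
  refine (zmod_prod m hm).extension (zmod n hn)
    ((AddMonoidHom.id (ZMod m)).prodMap
      (ZMod.castHom (dvd_mul_right m n) (ZMod m)).toAddMonoidHom)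
    ((AddMonoidHom.inr _ _).comp (ZMod.mulLeftHom m n)) ?_ _ (by omega)
  rintro ⟨x, y⟩ h
  obtain ⟨v, hv⟩ := ZMod.exists_mulLeftHom_eq y (congrArg Prod.snd h)
  exact ⟨v, Prod.ext (congrArg Prod.fst h).symm hv⟩

end HasShortZeroSum

/-- A sequence of length `2m + mn - 3` without short zero-sum subsequences. -/
theorem exists_card_eq_and_not_short_zero_sum (m n : ℕ) (hm : 0 < m) (hn : 0 < n) :
    ∃ S : Multiset (ZMod m × ZMod (m * n)), S.card = 2 * m + m * n - 3 ∧
      ¬ ∃ T ≤ S, T ≠ 0 ∧ T.sum = 0 ∧ Multiset.card T ≤ m * n := by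
  have hmn : 0 < m * n := Nat.mul_pos hm hn
  refine ⟨Multiset.replicate (m * n - 1) (0, 1) + (Multiset.replicate (m - 1) (1, 0) +
    Multiset.replicate (m - 1) (1, 1)), ?_, ?_⟩
  · simp only [Multiset.card_add, Multiset.card_replicate]
    omega
  rintro ⟨T, hT, hT0, hTs, hTc⟩
  obtain ⟨A, hA, R, hR, rfl⟩ := Multiset.exists_eq_add_of_le_add hT
  obtain ⟨B, hB, C, hC, rfl⟩ := Multiset.exists_eq_add_of_le_add hR
  obtain ⟨a, ha, rfl⟩ := Multiset.le_replicate_iff.1 hA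
  obtain ⟨b, hb, rfl⟩ := Multiset.le_replicate_iff.1 hB
  obtain ⟨c, hc, rfl⟩ := Multiset.le_replicate_iff.1 hC
  rw [← Multiset.card_pos] at hT0
  simp only [Multiset.card_add, Multiset.card_replicate] at hT0 hTc
  simp only [Multiset.sum_add, Multiset.sum_replicate, Prod.smul_mk, Prod.mk_add_mk, smul_zero,
    nsmul_one, Prod.mk_eq_zero, zero_add, ← Nat.cast_add, ZMod.natCast_eq_zero_iff] at hTs
  obtain ⟨hbc, hac⟩ := hTs
  have hac' : a + c = 0 ∨ m * n ≤ a + c :=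
    (Nat.eq_zero_or_pos _).imp_right fun h => Nat.le_of_dvd h hac
  have hbc' : b + c = 0 ∨ m ≤ b + c :=
    (Nat.eq_zero_or_pos _).imp_right fun h => Nat.le_of_dvd h hbc
  omega

/-- For `G = C_m ⊕ C_{mn}`, `η(G) = 2m + mn - 2`: every sequence of length
at least `2m + mn - 2` has a short zero-sum subsequence (nonempty, of length at most
`mn = exp(G)`), and there is a sequence of length `2m + mn - 3` with none. -/
theorem stmt_10 (m n : ℕ) (hm : 0 < m) (hn : 0 < n) :
    (∀ S : Multiset (ZMod m × ZMod (m * n)), 2 * m + m * n - 2 ≤ S.card →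
      ∃ T ≤ S, T ≠ 0 ∧ T.sum = 0 ∧ Multiset.card T ≤ m * n) ∧
    (∃ S : Multiset (ZMod m × ZMod (m * n)), S.card = 2 * m + m * n - 3 ∧
      ¬ ∃ T ≤ S, T ≠ 0 ∧ T.sum = 0 ∧ Multiset.card T ≤ m * n) := by
  exact ⟨HasShortZeroSum.zmod_prod_mul m n hm hn, exists_card_eq_and_not_short_zero_sum m n hm hn⟩
end
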